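/- arXiv:1911.06403 — 2 statements merged into one kernel-verified Lean document; each statement's English description precedes it below -/
import Mathlib

section
/- The biplanar crossing number of K_{21,21} satisfies cr_2(K_{21,21}) ≥ 817. -/
open SimpleGraph

/-- A drawing of a simple graph `G` in the plane: an injective placement of the
vertices, together with, for each (oriented) edge, a simple arc between the images
of its endpoints that avoids all vertex images in its interior; the two
orientations of an edge are drawn by the same arc (reversed). -/
structure Drawing {V : Type*} (G : SimpleGraph V) where
  pos : V → ℝ × ℝ
  pos_inj : Function.Injective pos
  arc : ∀ ⦃u v : V⦄, G.Adj u v → Path (pos u) (pos v)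
  arc_symm : ∀ ⦃u v : V⦄ (h : G.Adj u v), arc h.symm = (arc h).symm
  arc_inj : ∀ ⦃u v : V⦄ (h : G.Adj u v), Function.Injective (arc h)
  arc_avoid : ∀ ⦃u v : V⦄ (h : G.Adj u v) (w : V) (t : unitInterval),
    arc h t = pos w → t = 0 ∨ t = 1

/-- The interior of the curve representing an edge `e` in a drawing:
the image of the open arc, excluding the endpoints. -/
def Drawing.edgeInterior {V : Type*} {G : SimpleGraph V} (D : Drawing G) (e : Sym2 V) :
    Set (ℝ × ℝ) :=
  ⋃ (u : V) (v : V) (h : G.Adj u v) (_ : e = s(u, v)),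
    (D.arc h) '' {t : unitInterval | t ≠ 0 ∧ t ≠ 1}

/-- Two edges of `G` cross in the drawing `D` if they are distinct edges of `G`
whose interiors meet. -/
def Drawing.Crosses {V : Type*} {G : SimpleGraph V} (D : Drawing G) (e f : Sym2 V) : Prop :=
  e ∈ G.edgeSet ∧ f ∈ G.edgeSet ∧ e ≠ f ∧ (D.edgeInterior e ∩ D.edgeInterior f).Nonempty

/-- The number of crossings of a drawing: the number of unordered pairs of
distinct edges that cross (in a simple/nice drawing every crossing pair of edges
crosses exactly once). -/
noncomputable def Drawing.crossCount {V : Type*} {G : SimpleGraph V} (D : Drawing G) : ℕ :=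
  {p : Sym2 V × Sym2 V | D.Crosses p.1 p.2}.ncard / 2

/-- The crossing number `cr(G)`: the minimum number of crossings over all drawings
of `G` in the plane. -/
noncomputable def crossingNumber {V : Type*} (G : SimpleGraph V) : ℕ :=
  sInf {n : ℕ | ∃ D : Drawing G, D.crossCount = n}

/-- The `k`-planar crossing number `cr_k(G)`: the minimum of
`cr(G₁) + ⋯ + cr(G_k)` over all decompositions of the edge set of `G` into `k`
edge-disjoint subgraphs `G₁, …, G_k` on the same vertex set. -/
noncomputable def kCrossingNumber {V : Type*} (k : ℕ) (G : SimpleGraph V) : ℕ :=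
  sInf {n : ℕ | ∃ f : Fin k → SimpleGraph V,
    (⨆ i, f i) = G ∧
    (∀ i j : Fin k, i ≠ j → Disjoint (f i).edgeSet (f j).edgeSet) ∧
    n = ∑ i : Fin k, crossingNumber (f i)}

open Finset in
theorem exists_ne_zero_forall_sum_mul_eq_zero {R ι κ : Type*} [CommRing R] [Nontrivial R]
    [Fintype ι] [Fintype κ] (c : κ → ι → R) (h : Fintype.card κ < Fintype.card ι) :
    ∃ w : ι → R, w ≠ 0 ∧ ∀ k, ∑ i, c k i * w i = 0 := by
  by_contra! hcon
  refine h.not_ge (card_le_of_injective R (Matrix.mulVecLin (Matrix.of c)) ?_)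
  rw [← LinearMap.ker_eq_bot, LinearMap.ker_eq_bot']
  intro w hw
  by_contra hne
  obtain ⟨k, hk⟩ := hcon w hne
  exact hk (by simpa [Matrix.mulVec, dotProduct] using congrFun hw k)

/-- Weights on the pairs of a relation between two point sets on lines, in equilibrium (to first
order) at every point of both sets. -/
structure IsStress {R α β : Type*} [CommRing R] [Fintype α] [Fintype β]
    (x : α → R) (y : β → R) (w : α → β → R) : Prop where
  sum_left : ∀ b, ∑ a, w a b = 0
  sum_left_mul : ∀ b, ∑ a, x a * w a b = 0
  sum_right : ∀ a, ∑ b, w a b = 0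
  sum_right_mul : ∀ a, ∑ b, y b * w a b = 0

open Finset in
theorem exists_isStress {R α β : Type*} [CommRing R] [IsDomain R] [Fintype α] [Fintype β]
    {x : α → R} (hx : Function.Injective x) (y : β → R) (E : Finset (α × β))
    (hα : 2 ≤ Fintype.card α) (hE : 2 * (Fintype.card α + Fintype.card β) < #E + 4) :
    ∃ w : α → β → R, w ≠ 0 ∧ (∀ a b, (a, b) ∉ E → w a b = 0) ∧ IsStress x y w := by
  classical
  obtain ⟨a₀, a₁, h01⟩ := Fintype.one_lt_card_iff.1 hα
  let κ := ({a : α // a ≠ a₀ ∧ a ≠ a₁} ⊕ {a : α // a ≠ a₀ ∧ a ≠ a₁}) ⊕ (β ⊕ β)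
  let c : κ → E → R := Sum.elim
    (Sum.elim (fun a e => if e.1.1 = a then 1 else 0) (fun a e => if e.1.1 = a then y e.1.2 else 0))
    (Sum.elim (fun b e => if e.1.2 = b then 1 else 0) (fun b e => if e.1.2 = b then x e.1.1 else 0))
  have hcard : Fintype.card {a : α // a ≠ a₀ ∧ a ≠ a₁} + 2 = Fintype.card α := by
    rw [Fintype.card_subtype]
    have : ({a | a ≠ a₀ ∧ a ≠ a₁} : Finset α) = univ \ {a₀, a₁} := by ext; simp
    rw [this, card_sdiff_of_subset (subset_univ _), card_pair h01, card_univ]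
    omega
  have hκ : Fintype.card κ < Fintype.card E := by
    simp only [κ, Fintype.card_sum, Fintype.card_coe]
    omega
  obtain ⟨v, hv0, hv⟩ := exists_ne_zero_forall_sum_mul_eq_zero c hκ
  let w : α → β → R := fun a b => if h : (a, b) ∈ E then v ⟨(a, b), h⟩ else 0
  have hw : ∀ e : E, w e.1.1 e.1.2 = v e := fun e => by simp [w]
  have hsum : ∀ g : α × β → R, ∑ e : E, g e.1 * v e = ∑ a, ∑ b, g (a, b) * w a b := by
    intro g
    rw [← Fintype.sum_prod_type' (f := fun a b => g (a, b) * w a b)]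
    rw [← Finset.sum_subset (subset_univ E) fun e _ he => by simp [w, he],
      ← Finset.sum_coe_sort E fun e => g (e.1, e.2) * w e.1 e.2]
    exact Finset.sum_congr rfl fun e _ => by rw [hw]
  have hr : ∀ a, a ≠ a₀ → a ≠ a₁ → ∑ b, w a b = 0 := by
    intro a h0 h1
    have := hv (.inl (.inl ⟨a, h0, h1⟩))
    simp only [c, Sum.elim_inl] at this
    rw [hsum fun e => if e.1 = a then 1 else 0] at this
    simpa [Finset.sum_ite_eq, ← Finset.mul_sum] using this
  have hry : ∀ a, a ≠ a₀ → a ≠ a₁ → ∑ b, y b * w a b = 0 := by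
    intro a h0 h1
    have := hv (.inl (.inr ⟨a, h0, h1⟩))
    simp only [c, Sum.elim_inl, Sum.elim_inr] at this
    rw [hsum fun e => if e.1 = a then y e.2 else 0, sum_comm] at this
    simpa [Finset.sum_ite_eq] using this
  have hl : ∀ b, ∑ a, w a b = 0 := by
    intro b
    have := hv (.inr (.inl b))
    simp only [c, Sum.elim_inr, Sum.elim_inl] at this
    rw [hsum fun e => if e.2 = b then 1 else 0] at this
    simpa [Finset.sum_ite_eq] using this
  have hlx : ∀ b, ∑ a, x a * w a b = 0 := by
    intro b
    have := hv (.inr (.inr b))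
    simp only [c, Sum.elim_inr] at this
    rw [hsum fun e => if e.2 = b then x e.1 else 0] at this
    simpa [Finset.sum_ite_eq] using this
  have key : ∀ r : α → R, (∀ a, a ≠ a₀ → a ≠ a₁ → r a = 0) → ∑ a, r a = 0 →
      ∑ a, x a * r a = 0 → ∀ a, r a = 0 := by
    intro r hr h1 h2
    have e1 : r a₀ + r a₁ = 0 := by
      rw [← h1, ← Finset.sum_pair h01]
      exact Finset.sum_subset (subset_univ _) fun a _ ha => by
        simp only [mem_insert, mem_singleton, not_or] at ha
        exact hr a ha.1 ha.2
    have e2 : x a₀ * r a₀ + x a₁ * r a₁ = 0 := by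
      rw [← h2, ← Finset.sum_pair (f := fun a => x a * r a) h01]
      exact Finset.sum_subset (subset_univ _) fun a _ ha => by
        simp only [mem_insert, mem_singleton, not_or] at ha
        rw [hr a ha.1 ha.2, mul_zero]
    have e3 : (x a₀ - x a₁) * r a₀ = 0 := by linear_combination e2 - x a₁ * e1
    have e4 : r a₀ = 0 := (mul_eq_zero.1 e3).resolve_left (sub_ne_zero.2 (hx.ne h01))
    have e5 : r a₁ = 0 := by simpa [e4] using e1
    intro a
    by_cases h0 : a = a₀
    · rw [h0, e4]
    by_cases h1 : a = a₁
    · rw [h1, e5]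
    exact hr a h0 h1
  refine ⟨w, ?_, fun a b h => by simp [w, h], hl, hlx, ?_, ?_⟩
  · intro h0
    apply hv0
    ext e
    rw [← hw, h0]
    rfl
  · refine key _ hr ?_ ?_
    · rw [sum_comm]
      simp [hl]
    · simp_rw [Finset.mul_sum]
      rw [sum_comm]
      simp [hlx]
  · refine key _ hry ?_ ?_
    · rw [sum_comm]
      simp [← Finset.mul_sum, hl]
    · simp_rw [Finset.mul_sum]
      rw [sum_comm]
      simp_rw [mul_left_comm (x _), ← Finset.mul_sum, hlx, mul_zero, sum_const_zero]

open Finset in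
theorem sum_sum_eq_sum_diag_add_sum_lt {R ι : Type*} [AddCommMonoid R] [Fintype ι]
    [LinearOrder ι] (F : ι → ι → R) :
    ∑ i, ∑ j, F i j = ∑ i, F i i + ∑ i, ∑ j, if i < j then F i j + F j i else 0 := by
  have h : ∀ i j, F i j = (if i = j then F i j else 0) + ((if i < j then F i j else 0) +
      if j < i then F i j else 0) := by
    intro i j
    rcases lt_trichotomy i j with h | h | h
    · simp [h, h.ne, h.not_gt]
    · simp [h]
    · simp [h, h.ne', h.not_gt]
  calc ∑ i, ∑ j, F i j = ∑ i, F i i + (∑ i, ∑ j, (if i < j then F i j else 0) +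
        ∑ i, ∑ j, if j < i then F i j else 0) := by
        simp_rw [← sum_add_distrib]
        refine sum_congr rfl fun i _ => ?_
        conv_lhs => enter [2, j]; rw [h i j]
        simp [sum_add_distrib]
    _ = _ := by
        congr 1
        rw [sum_comm (f := fun i j => if j < i then F i j else 0)]
        simp_rw [← sum_add_distrib]
        refine sum_congr rfl fun i _ => sum_congr rfl fun j _ => ?_
        split_ifs <;> simp

open Finset in
theorem IsStress.sum_mul_sq_eq_zero {R α β : Type*} [CommRing R] [CharP R 2]
    [Fintype α] [LinearOrder α] [Fintype β] [LinearOrder β]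
    {x : α → R} {y : β → R} {w : α → β → R} (hw : IsStress x y w)
    (n : α → β → α → R) (m : α → β → β → R)
    (h : ∀ a a' b b', w a b ≠ 0 → w a' b' ≠ 0 → a < a' → b ≠ b' →
      n a b a' + n a' b' a + m a b b' + m a' b' b = if b < b' then 1 else 0) :
    ∑ a, ∑ b, x a * y b * w a b ^ 2 = 0 := by
  have dbl : ∀ r : R, r + r = 0 := CharTwo.add_self_eq_zero
  have eqo : ∀ {r s : R}, r + s = 0 → r = s := CharTwo.add_eq_zero.1
  set T : α → α → R := fun a a' =>
    ∑ b, ∑ b', if b < b' then w a b * w a' b' * (y b + y b') else 0 with hT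
  have z1 : ∀ a a' b, ∑ b', w a b * w a' b' * (y b + y b') = 0 := by
    intro a a' b
    have : ∀ b', w a b * w a' b' * (y b + y b') = (w a b * y b) * w a' b' +
      w a b * (y b' * w a' b') := fun b' => by ring
    simp_rw [this, sum_add_distrib, ← mul_sum, hw.sum_right, hw.sum_right_mul]
    ring
  have z2 : ∀ a b b', ∑ a', w a b * w a' b' * (x a + x a') = 0 := by
    intro a b b'
    have : ∀ a', w a b * w a' b' * (x a + x a') = (w a b * x a) * w a' b' +
      w a b * (x a' * w a' b') := fun a' => by ring
    simp_rw [this, sum_add_distrib, ← mul_sum, hw.sum_left, hw.sum_left_mul]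
    ring
  have T_symm : ∀ a a', T a a' = T a' a := by
    intro a a'
    have := sum_sum_eq_sum_diag_add_sum_lt fun b b' => w a b * w a' b' * (y b + y b')
    simp only [z1, dbl, mul_zero, sum_const_zero, zero_add] at this
    refine eqo (Eq.trans ?_ this.symm)
    simp only [hT, ← sum_add_distrib]
    refine sum_congr rfl fun b _ => sum_congr rfl fun b' _ => ?_
    split_ifs
    · ring
    · simp
  have T_diag : ∀ a, ∑ b, y b * w a b ^ 2 = T a a := by
    intro a
    have := sum_sum_eq_sum_diag_add_sum_lt fun b b' => (y b * w a b) * w a b'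
    simp only [← mul_sum, hw.sum_right, mul_zero, sum_const_zero] at this
    refine eqo (Eq.trans ?_ this.symm)
    congr 1
    · exact sum_congr rfl fun b _ => by ring
    · refine sum_congr rfl fun b _ => sum_congr rfl fun b' _ => ?_
      split_ifs
      · ring
      · rfl
  have S_eq : ∑ a, ∑ b, x a * y b * w a b ^ 2 =
      ∑ a, ∑ a', if a < a' then (x a + x a') * T a a' else 0 := by
    have := sum_sum_eq_sum_diag_add_sum_lt fun a a' => x a' * T a a'
    have t0 : ∑ a, ∑ a', x a' * T a a' = 0 := by
      simp only [hT, mul_sum]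
      rw [sum_comm]
      refine sum_eq_zero fun a' _ => ?_
      rw [sum_comm]
      refine sum_eq_zero fun b _ => ?_
      rw [sum_comm]
      refine sum_eq_zero fun b' _ => ?_
      split_ifs
      · have : ∀ a, x a' * (w a b * w a' b' * (y b + y b')) =
          (x a' * w a' b' * (y b + y b')) * w a b := fun a => by ring
        simp_rw [this, ← mul_sum, hw.sum_left, mul_zero]
      · simp
    rw [t0] at this
    refine eqo (Eq.trans ?_ this.symm)
    congr 1
    · refine sum_congr rfl fun a _ => ?_
      rw [← T_diag, mul_sum]
      exact sum_congr rfl fun b _ => by ring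
    · refine sum_congr rfl fun a _ => sum_congr rfl fun a' _ => ?_
      rw [T_symm a' a]
      split_ifs
      · ring
      · rfl
  set G : α → α → R := fun a a' => ∑ b, ∑ b',
    (n a b a' + m a b b') * (w a b * w a' b' * (x a + x a') * (y b + y b')) with hG
  have G_diag : ∀ a, G a a = 0 := by
    intro a
    simp [hG, dbl]
  have G_sum : ∑ a, ∑ a', G a a' = 0 := by
    simp only [hG, add_mul, sum_add_distrib]
    have u1 : ∑ a, ∑ a', ∑ b, ∑ b',
        n a b a' * (w a b * w a' b' * (x a + x a') * (y b + y b')) = 0 := by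
      refine sum_eq_zero fun a _ => sum_eq_zero fun a' _ => sum_eq_zero fun b _ => ?_
      have : ∀ b', n a b a' * (w a b * w a' b' * (x a + x a') * (y b + y b')) =
        (n a b a' * (x a + x a')) * (w a b * w a' b' * (y b + y b')) := fun b' => by ring
      simp_rw [this, ← mul_sum, z1, mul_zero]
    have u2 : ∑ a, ∑ a', ∑ b, ∑ b',
        m a b b' * (w a b * w a' b' * (x a + x a') * (y b + y b')) = 0 := by
      refine sum_eq_zero fun a _ => ?_
      rw [sum_comm]
      refine sum_eq_zero fun b _ => ?_
      rw [sum_comm]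
      refine sum_eq_zero fun b' _ => ?_
      have : ∀ a', m a b b' * (w a b * w a' b' * (x a + x a') * (y b + y b')) =
        (m a b b' * (y b + y b')) * (w a b * w a' b' * (x a + x a')) := fun a' => by ring
      simp_rw [this, ← mul_sum, z2, mul_zero]
    rw [u1, u2, add_zero]
  have := sum_sum_eq_sum_diag_add_sum_lt G
  simp only [G_sum, G_diag, sum_const_zero, zero_add] at this
  refine S_eq.trans (Eq.trans ?_ this.symm)
  refine sum_congr rfl fun a _ => sum_congr rfl fun a' _ => ?_
  split_ifs with haa
  · simp only [hG, hT]
    rw [sum_comm (f := fun b b' => (n a' b a + m a' b b') * _)]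
    rw [mul_sum, ← sum_add_distrib]
    refine sum_congr rfl fun b _ => ?_
    rw [mul_sum, ← sum_add_distrib]
    refine sum_congr rfl fun b' _ => ?_
    by_cases hbb : b = b'
    · simp [hbb, dbl]
    by_cases hab : w a b = 0
    · simp [hab]
    by_cases hab' : w a' b' = 0
    · simp [hab']
    have := h a a' b b' hab hab' haa hbb
    calc _ = (if b < b' then 1 else 0) * (w a b * w a' b' * (x a + x a') * (y b + y b')) := by
          split_ifs <;> ring
      _ = _ := by rw [← this]; ring
  · rfl

open MvPolynomial in
theorem MvPolynomial.eq_zero_of_sum_X_mul_X_mul_sq_eq_zero {α β : Type*} [Fintype α] [Fintype β]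
    {w : α → β → MvPolynomial (α ⊕ β) (ZMod 2)}
    (h : ∑ a, ∑ b, X (.inl a) * X (.inr b) * w a b ^ 2 = 0) : w = 0 := by
  classical
  ext a b d
  have hc := congrArg (coeff (Finsupp.single (.inl a) 1 + (Finsupp.single (.inr b) 1 + 2 • d))) h
  simp only [coeff_sum, coeff_zero] at hc
  have hterm : ∀ a' b', coeff (Finsupp.single (.inl a) 1 + (Finsupp.single (.inr b) 1 + 2 • d))
      (X (.inl a') * X (.inr b') * w a' b' ^ 2) =
      if a' = a then if b' = b then coeff d (w a b) else 0 else 0 := by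
    intro a' b'
    have hodd : ∀ i (e : α ⊕ β →₀ ℕ), Odd (e i) → coeff e (expand 2 (w a' b')) = 0 :=
      fun i e he => coeff_expand_of_not_dvd _ fun h2 =>
        Nat.not_even_iff_odd.2 he (even_iff_two_dvd.2 h2)
    rw [← MvPolynomial.expand_zmod, mul_assoc]
    by_cases ha : a' = a
    · subst ha
      rw [if_pos rfl, coeff_X_mul]
      by_cases hb : b' = b
      · subst hb
        rw [if_pos rfl, coeff_X_mul, coeff_expand_smul _ two_ne_zero]
      · rw [if_neg hb, coeff_X_mul']
        split_ifs
        · refine hodd (.inr b) _ ?_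
          simp [hb]
        · rfl
    · rw [if_neg ha, coeff_X_mul', coeff_X_mul']
      split_ifs
      · refine hodd (.inl a) _ ?_
        simp [ha]
      · rfl
      · rfl
  simpa [hterm] using hc

open Finset in
theorem card_add_four_le_of_parity {α β : Type*} [Fintype α] [LinearOrder α] [Fintype β]
    [LinearOrder β] (E : Finset (α × β)) (hα : 2 ≤ Fintype.card α)
    (n : α × β → α → ZMod 2) (m : α × β → β → ZMod 2)
    (h : ∀ e ∈ E, ∀ f ∈ E, e.1 < f.1 → e.2 ≠ f.2 →
      n e f.1 + n f e.1 + m e f.2 + m f e.2 = if e.2 < f.2 then 1 else 0) :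
    #E + 4 ≤ 2 * (Fintype.card α + Fintype.card β) := by
  by_contra! hE
  obtain ⟨w, hw0, hwE, hw⟩ := exists_isStress
    (x := fun a : α => (MvPolynomial.X (.inl a) : MvPolynomial (α ⊕ β) (ZMod 2)))
    ((MvPolynomial.X_injective (R := ZMod 2)).comp Sum.inl_injective)
    (fun b : β => MvPolynomial.X (.inr b)) E hα hE
  refine hw0 (MvPolynomial.eq_zero_of_sum_X_mul_X_mul_sq_eq_zero
    (hw.sum_mul_sq_eq_zero (fun a b a' => MvPolynomial.C (n (a, b) a'))
      (fun a b b' => MvPolynomial.C (m (a, b) b')) ?_))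
  intro a a' b b' hab hab' ha hb
  have := h (a, b) (by_contra fun h => hab (hwE _ _ h)) (a', b')
    (by_contra fun h => hab' (hwE _ _ h)) ha hb
  simp only [← map_add, this]
  split_ifs <;> simp

namespace Complex

theorem exists_continuous_exp_eq {A : Type*} [AddCommGroup A] [Module ℝ A] [TopologicalSpace A]
    [IsTopologicalAddGroup A] [ContinuousSMul ℝ A] [LocallyConvexSpace ℝ A]
    {f : A → ℂ} (hf : Continuous f) (h0 : ∀ x, f x ≠ 0) :
    ∃ g : A → ℂ, Continuous g ∧ ∀ x, exp (g x) = f x := by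
  have : SimplyConnectedSpace A := SimplyConnectedSpace.ofContractible A
  let F : C(A, {z : ℂ // z ≠ 0}) := ⟨fun x => ⟨f x, h0 x⟩, by fun_prop⟩
  obtain ⟨G, ⟨-, hG⟩, -⟩ := isCoveringMap_exp.existsUnique_continuousMap_lifts F 0 (log (f 0))
    (Subtype.ext (exp_log (h0 0)))
  exact ⟨G, G.continuous, fun x => congrArg Subtype.val (congrFun hG x)⟩

/-- The change of a continuous logarithm of `f` between `0` and `1`. -/
noncomputable def logChange (f : ℝ → ℂ) : ℂ :=
  open Classical in
  if h : ∃ g : ℝ → ℂ, Continuous g ∧ ∀ t, exp (g t) = f t then h.choose 1 - h.choose 0 else 0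

theorem logChange_eq {f g : ℝ → ℂ} (hg : Continuous g) (h : ∀ t, exp (g t) = f t) :
    logChange f = g 1 - g 0 := by
  have hex : ∃ g : ℝ → ℂ, Continuous g ∧ ∀ t, exp (g t) = f t := ⟨g, hg, h⟩
  rw [logChange, dif_pos hex]
  obtain ⟨hc, he⟩ := hex.choose_spec
  set k := hex.choose
  have h0 : exp (k 0) = exp (g 0) := (he 0).trans (h 0).symm
  obtain ⟨n, hn⟩ := exp_eq_exp_iff_exists_int.1 h0
  have := isCoveringMap_exp.eq_of_comp_eq (g₁ := k)
    (g₂ := fun t => g t + n * (2 * Real.pi * I)) hc (by fun_prop) (by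
      ext t
      simp only [Function.comp_apply]
      rw [he, exp_add, h, exp_int_mul_two_pi_mul_I, mul_one]) 0 hn
  rw [this]
  ring

theorem exists_logChange_eq {f : ℝ → ℂ} (hf : Continuous f) (h0 : ∀ t, f t ≠ 0) {u v : ℂ}
    (hu : exp u = f 0) (hv : exp v = f 1) :
    ∃ n : ℤ, logChange f = v - u + n * (2 * Real.pi * I) := by
  obtain ⟨g, hg, h⟩ := exists_continuous_exp_eq hf h0
  obtain ⟨n, hn⟩ := exp_eq_exp_iff_exists_int.1 ((h 0).trans hu.symm)
  obtain ⟨m, hm⟩ := exp_eq_exp_iff_exists_int.1 ((h 1).trans hv.symm)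
  refine ⟨m - n, ?_⟩
  rw [logChange_eq hg h, hn, hm]
  push_cast
  ring

theorem logChange_sub_add_logChange_sub {γ δ : ℝ → ℂ} (hγ : Continuous γ) (hδ : Continuous δ)
    (h : ∀ s t, γ s ≠ δ t) :
    logChange (fun s => γ s - δ 0) + logChange (fun t => δ t - γ 1) =
      logChange (fun t => δ t - γ 0) + logChange (fun s => γ s - δ 1) := by
  obtain ⟨G, hG, hexp⟩ := exists_continuous_exp_eq (A := ℝ × ℝ)
    (f := fun p => γ p.1 - δ p.2) (by fun_prop) fun p => sub_ne_zero.2 (h _ _)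
  have e1 : ∀ t, logChange (fun s => γ s - δ t) = G (1, t) - G (0, t) := fun t =>
    logChange_eq (g := fun s => G (s, t)) (by fun_prop) fun s => hexp (s, t)
  have e2 : ∀ s, logChange (fun t => δ t - γ s) = G (s, 1) - G (s, 0) := by
    intro s
    rw [logChange_eq (g := fun t => G (s, t) + Real.pi * I) (by fun_prop)]
    · ring
    · intro t
      rw [exp_add, exp_pi_mul_I, hexp]
      ring
  rw [e1, e1, e2, e2]
  ring

theorem exists_antisymm_log {κ : Type*} [LinearOrder κ] (p : κ → ℂ) (hp : Function.Injective p) :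
    ∃ L : κ → κ → ℂ, (∀ i j, i ≠ j → exp (L i j) = p i - p j) ∧
      ∀ i j, i < j → L i j = L j i + Real.pi * I := by
  refine ⟨fun i j => if i < j then log (p j - p i) + Real.pi * I else log (p i - p j), ?_, ?_⟩
  · intro i j hij
    have := sub_ne_zero.2 (hp.ne hij)
    have := sub_ne_zero.2 (hp.ne hij.symm)
    dsimp only
    split_ifs
    · rw [exp_add, exp_pi_mul_I, exp_log this]
      ring
    · rw [exp_log ‹_›]
  · intro i j hij
    simp [hij, hij.not_gt]

end Complex

open Finset Complex in
/-- A bipartite graph with a drawing in the plane in which edges without common endpoint are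
disjoint satisfies the edge bound for planar bipartite graphs. -/
theorem card_add_four_le_of_curves {α β : Type*} [Fintype α] [Fintype β]
    (E : Finset (α × β)) (hα : 2 ≤ Fintype.card α) {P : α → ℂ} (hP : Function.Injective P)
    {Q : β → ℂ} (hQ : Function.Injective Q) (γ : α × β → ℝ → ℂ)
    (hγ : ∀ e ∈ E, Continuous (γ e)) (h0 : ∀ e ∈ E, γ e 0 = P e.1) (h1 : ∀ e ∈ E, γ e 1 = Q e.2)
    (hγP : ∀ e ∈ E, ∀ a, a ≠ e.1 → ∀ t, γ e t ≠ P a)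
    (hγQ : ∀ e ∈ E, ∀ b, b ≠ e.2 → ∀ t, γ e t ≠ Q b)
    (hdisj : ∀ e ∈ E, ∀ f ∈ E, e.1 ≠ f.1 → e.2 ≠ f.2 → ∀ s t, γ e s ≠ γ f t) :
    #E + 4 ≤ 2 * (Fintype.card α + Fintype.card β) := by
  let _ : LinearOrder α := IsWellOrder.linearOrder WellOrderingRel
  let _ : LinearOrder β := IsWellOrder.linearOrder WellOrderingRel
  obtain ⟨LA, hLA, hLA'⟩ := exists_antisymm_log P hP
  obtain ⟨LB, hLB, hLB'⟩ := exists_antisymm_log Q hQ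
  have hPQ : ∀ e ∈ E, ∀ a, a ≠ e.1 → Q e.2 - P a ≠ 0 := fun e he a ha =>
    sub_ne_zero.2 (h1 e he ▸ hγP e he a ha 1)
  have hQP : ∀ e ∈ E, ∀ b, b ≠ e.2 → Q b - P e.1 ≠ 0 := fun e he b hb =>
    sub_ne_zero.2 (h0 e he ▸ (hγQ e he b hb 0).symm)
  have hn : ∀ e a, ∃ n : ℤ, e ∈ E → a ≠ e.1 → logChange (fun t => γ e t - P a) =
      log (Q e.2 - P a) - LA e.1 a + n * (2 * Real.pi * I) := by
    intro e a
    by_cases he : e ∈ E; swap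
    · exact ⟨0, fun h => absurd h he⟩
    by_cases ha : a = e.1
    · exact ⟨0, fun _ h => absurd ha h⟩
    obtain ⟨n, hn⟩ := exists_logChange_eq (f := fun t => γ e t - P a)
      ((hγ e he).sub continuous_const) (fun t => sub_ne_zero.2 (hγP e he a ha t))
      ((hLA e.1 a (Ne.symm ha)).trans (by rw [h0 e he]))
      ((exp_log (hPQ e he a ha)).trans (by rw [h1 e he]))
    exact ⟨n, fun _ _ => hn⟩
  have hm : ∀ e b, ∃ m : ℤ, e ∈ E → b ≠ e.2 → logChange (fun t => γ e t - Q b) =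
      LB e.2 b - (log (Q b - P e.1) + Real.pi * I) + m * (2 * Real.pi * I) := by
    intro e b
    by_cases he : e ∈ E; swap
    · exact ⟨0, fun h => absurd h he⟩
    by_cases hb : b = e.2
    · exact ⟨0, fun _ h => absurd hb h⟩
    obtain ⟨m, hm⟩ := exists_logChange_eq (f := fun t => γ e t - Q b)
      (u := log (Q b - P e.1) + Real.pi * I)
      ((hγ e he).sub continuous_const) (fun t => sub_ne_zero.2 (hγQ e he b hb t))
      (by rw [exp_add, exp_pi_mul_I, exp_log (hQP e he b hb), h0 e he]; ring)
      ((hLB e.2 b (Ne.symm hb)).trans (by rw [h1 e he]))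
    exact ⟨m, fun _ _ => hm⟩
  choose n hn using hn
  choose m hm using hm
  refine card_add_four_le_of_parity E hα (fun e a => n e a) (fun e b => m e b) ?_
  intro e he f hf hlt hne
  have hsq := logChange_sub_add_logChange_sub (hγ e he) (hγ f hf) (hdisj e he f hf hlt.ne hne)
  rw [h0 e he, h0 f hf, h1 e he, h1 f hf, hn e _ he hlt.ne', hn f _ hf hlt.ne,
    hm e _ he hne.symm, hm f _ hf hne, hLA' _ _ hlt] at hsq
  have hπ : (2 * Real.pi * I : ℂ) ≠ 0 := two_pi_I_ne_zero
  have hint : n e f.1 + m f e.2 = n f e.1 + m e f.2 + if e.2 < f.2 then 1 else 0 := by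
    split_ifs with hb
    · rw [hLB' _ _ hb] at hsq
      have : ((n e f.1 + m f e.2 : ℤ) : ℂ) * (2 * Real.pi * I) =
          ((n f e.1 + m e f.2 + 1 : ℤ) : ℂ) * (2 * Real.pi * I) := by
        push_cast
        linear_combination hsq
      exact_mod_cast mul_right_cancel₀ hπ this
    · rw [hLB' _ _ (lt_of_le_of_ne (not_lt.1 hb) hne.symm)] at hsq
      have : ((n e f.1 + m f e.2 : ℤ) : ℂ) * (2 * Real.pi * I) =
          ((n f e.1 + m e f.2 : ℤ) : ℂ) * (2 * Real.pi * I) := by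
        push_cast
        linear_combination hsq
      rw [add_zero]
      exact_mod_cast mul_right_cancel₀ hπ this
  have h2 := congrArg (fun z : ℤ => (z : ZMod 2)) hint
  push_cast at h2
  have dbl : ∀ r : ZMod 2, r + r = 0 := CharTwo.add_self_eq_zero
  split_ifs at h2 ⊢ <;>
  linear_combination h2 + dbl (n f e.1) + dbl (m e f.2)

/-- A set of edges is crossing-connected if it can be built up from a single edge by adding edges
that cross an earlier one. -/
inductive CrossConnected {ι : Type*} [DecidableEq ι] (H : SimpleGraph ι) : Finset ι → Prop
  | singleton (e : ι) : CrossConnected H {e}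
  | insert {K : Finset ι} {e f : ι} : CrossConnected H K → f ∈ K → H.Adj f e →
      CrossConnected H (insert e K)

/-- Two sets of edges are apart if they are disjoint and no edge of one crosses an edge of the
other. -/
def Apart {ι : Type*} (H : SimpleGraph ι) (K L : Finset ι) : Prop :=
  ∀ x ∈ K, ∀ y ∈ L, x ≠ y ∧ ¬H.Adj x y

/-- The number of ordered crossing pairs within `S`. -/
def crossSum {ι : Type*} (H : SimpleGraph ι) [DecidableRel H.Adj] (S : Finset ι) : ℕ :=
  ∑ e ∈ S, (S.filter (H.Adj e)).card

/-- The number of endpoints of the edges in `K`. -/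
def span {α β : Type*} [DecidableEq α] [DecidableEq β] (K : Finset (α × β)) : ℕ :=
  (K.image Prod.fst).card + (K.image Prod.snd).card

/-- Two ways to extract planar bipartite graphs from the edges `S` of a drawing: a set `T` of edges,
each of which can be redrawn along its support `ρ`, and a family `𝒦` of sets of edges, each of which
can be contracted to a vertex joined to all endpoints of its edges. -/
structure Packing {α β : Type*} [DecidableEq α] [DecidableEq β] (H : SimpleGraph (α × β))
    (S T : Finset (α × β)) (ρ : α × β → Finset (α × β)) (𝒦 : Finset (Finset (α × β))) : Prop where
  connected : ∀ e ∈ T, CrossConnected H (ρ e)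
  subset : ∀ e ∈ T, ρ e ⊆ S
  fst_mem : ∀ e ∈ T, e.1 ∈ (ρ e).image Prod.fst
  snd_mem : ∀ e ∈ T, e.2 ∈ (ρ e).image Prod.snd
  apart : ∀ e ∈ T, ∀ f ∈ T, e.1 ≠ f.1 → e.2 ≠ f.2 → Apart H (ρ e) (ρ f)
  family_connected : ∀ K ∈ 𝒦, CrossConnected H K
  family_subset : ∀ K ∈ 𝒦, K ⊆ S
  family_apart : ∀ K ∈ 𝒦, ∀ L ∈ 𝒦, K ≠ L → Apart H K L

/-- `S` has a packing that is large compared with the number of crossings. -/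
def HasLargePacking {α β : Type*} [DecidableEq α] [DecidableEq β] (H : SimpleGraph (α × β))
    [DecidableRel H.Adj] (S : Finset (α × β)) : Prop :=
  ∃ T ρ 𝒦, T ⊆ S ∧ Packing H S T ρ 𝒦 ∧
    6 * S.card + 4 * 𝒦.card ≤ crossSum H S + 6 * T.card + 2 * ∑ K ∈ 𝒦, span K

section

open Finset

theorem CrossConnected.nonempty {ι : Type*} [DecidableEq ι] {H : SimpleGraph ι} {K : Finset ι}
    (h : CrossConnected H K) : K.Nonempty := by
  cases h <;> simp

theorem Apart.symm {ι : Type*} {H : SimpleGraph ι} {K L : Finset ι}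
    (h : Apart H K L) : Apart H L K :=
  fun x hx y hy => ⟨(h y hy x hx).1.symm, fun hxy => (h y hy x hx).2 (hxy.symm)⟩

theorem Apart.mono {ι : Type*} {H : SimpleGraph ι} {K K' L L' : Finset ι} (h : Apart H K L)
    (hK : K' ⊆ K) (hL : L' ⊆ L) : Apart H K' L' :=
  fun x hx y hy => h x (hK hx) y (hL hy)

theorem crossSum_eq_sdiff_add {ι : Type*} [DecidableEq ι] {H : SimpleGraph ι} [DecidableRel H.Adj]
    {S R : Finset ι} (hR : R ⊆ S) :
    crossSum H S = crossSum H (S \ R) +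
      ∑ e ∈ R, (#(S.filter (H.Adj e)) + #(S.filter (H.Adj e) \ R)) := by
  have h1 : ∀ e, #(S.filter (H.Adj e)) = #((S \ R).filter (H.Adj e)) + #(R.filter (H.Adj e)) := by
    intro e
    rw [← card_union_of_disjoint, ← filter_union, sdiff_union_of_subset hR]
    exact disjoint_filter_filter sdiff_disjoint
  have h2 : ∀ e, S.filter (H.Adj e) \ R = (S \ R).filter (H.Adj e) := by
    intro e
    ext f
    simp only [mem_sdiff, mem_filter]
    tauto
  have h3 : ∑ e ∈ S \ R, #(R.filter (H.Adj e)) = ∑ e ∈ R, #((S \ R).filter (H.Adj e)) := by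
    simp only [card_filter]
    rw [sum_comm]
    exact sum_congr rfl fun e _ => sum_congr rfl fun f _ => by simp only [H.adj_comm e f]
  rw [crossSum, crossSum, ← sum_sdiff hR, sum_add_distrib]
  simp_rw [h2]
  rw [← h3, sum_congr rfl fun e (_ : e ∈ S \ R) => h1 e, sum_add_distrib]
  ring

theorem card_le_card_image_fst_mul {α β : Type*} [DecidableEq α] [DecidableEq β]
    (K : Finset (α × β)) : #K ≤ #(K.image Prod.fst) * #(K.image Prod.snd) := by
  rw [← card_product]
  exact card_le_card subset_product

theorem four_le_span {α β : Type*} [DecidableEq α] [DecidableEq β] {K : Finset (α × β)}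
    (h : 3 ≤ #K) : 4 ≤ span K := by
  have := h.trans (card_le_card_image_fst_mul K)
  rw [span]
  nlinarith [sq_nonneg ((#(K.image Prod.fst) : ℤ) - #(K.image Prod.snd))]

theorem three_le_span {α β : Type*} [DecidableEq α] [DecidableEq β] {K : Finset (α × β)}
    (h : 2 ≤ #K) : 3 ≤ span K := by
  have := h.trans (card_le_card_image_fst_mul K)
  rw [span]
  nlinarith [sq_nonneg ((#(K.image Prod.fst) : ℤ) - #(K.image Prod.snd))]

theorem Packing.of_singletons {α β : Type*} [DecidableEq α] [DecidableEq β]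
    {H : SimpleGraph (α × β)} {C T K : Finset (α × β)} (hTC : T ⊆ C)
    (hT : ∀ e ∈ T, ∀ f ∈ T, e.1 ≠ f.1 → e.2 ≠ f.2 → ¬H.Adj e f) (hK : CrossConnected H K)
    (hKC : K ⊆ C) : Packing H C T (fun e => {e}) {K} where
  connected e _ := .singleton e
  subset e he := singleton_subset_iff.2 (hTC he)
  fst_mem e _ := by simp
  snd_mem e _ := by simp
  apart e he f hf h1 h2 x hx y hy := by
    rw [mem_singleton.1 hx, mem_singleton.1 hy]
    exact ⟨fun h => h1 (h ▸ rfl), hT e he f hf h1 h2⟩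
  family_connected := by simpa
  family_subset := by simpa
  family_apart L hL M hM hne := by
    rw [mem_singleton.1 hL, mem_singleton.1 hM] at hne
    exact absurd rfl hne

variable {α β : Type*} [DecidableEq α] [DecidableEq β] {H : SimpleGraph (α × β)} [DecidableRel H.Adj]
  {S : Finset (α × β)}

theorem HasLargePacking.glue {R C T : Finset (α × β)}
    {ρ : α × β → Finset (α × β)} {K : Finset (α × β)} (h : HasLargePacking H (S \ R)) (hR : R ⊆ S)
    (hC : C ⊆ R) (hCS : ∀ c ∈ C, ∀ s ∈ S, H.Adj c s → s ∈ R) (hT : T ⊆ R)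
    (hP : Packing H C T ρ {K})
    (hcard : 6 * #R + 4 + crossSum H (S \ R) ≤ crossSum H S + 6 * #T + 2 * span K) :
    HasLargePacking H S := by
  obtain ⟨T', ρ', 𝒦, hT', hP', hle⟩ := h
  have hap : Apart H C (S \ R) := fun x hx y hy => by
    rw [mem_sdiff] at hy
    exact ⟨fun h => hy.2 (h ▸ hC hx), fun h => hy.2 (hCS x hx y hy.1 h)⟩
  have hTT : Disjoint T' T :=
    Finset.disjoint_of_subset_left hT' (Finset.disjoint_of_subset_right hT sdiff_disjoint)
  have hnot : ∀ e ∈ T', e ∉ T := fun e he he' => Finset.disjoint_left.1 hTT he he'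
  have hKC : K ⊆ C := hP.family_subset K (mem_singleton_self _)
  have hKconn := hP.family_connected K (mem_singleton_self _)
  have hK : K ∉ 𝒦 := by
    intro hK
    obtain ⟨x, hx⟩ := hKconn.nonempty
    exact (hap x (hKC hx) x (hP'.family_subset K hK hx)).1 rfl
  refine ⟨T' ∪ T, fun e => if e ∈ T then ρ e else ρ' e, insert K 𝒦,
    union_subset (hT'.trans sdiff_subset) (hT.trans hR), ?_, ?_⟩
  · have hρ : ∀ e ∈ T' ∪ T, (e ∈ T ∧ (if e ∈ T then ρ e else ρ' e) = ρ e) ∨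
        (e ∈ T' ∧ (if e ∈ T then ρ e else ρ' e) = ρ' e) := by
      intro e he
      rcases mem_union.1 he with h | h
      · exact .inr ⟨h, if_neg (hnot e h)⟩
      · exact .inl ⟨h, if_pos h⟩
    refine ⟨?_, ?_, ?_, ?_, ?_, ?_, ?_, ?_⟩
    · intro e he
      rcases hρ e he with ⟨h, h'⟩ | ⟨h, h'⟩ <;> rw [h']
      exacts [hP.connected e h, hP'.connected e h]
    · intro e he
      rcases hρ e he with ⟨h, h'⟩ | ⟨h, h'⟩ <;> rw [h']
      exacts [(hP.subset e h).trans (hC.trans hR), (hP'.subset e h).trans sdiff_subset]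
    · intro e he
      rcases hρ e he with ⟨h, h'⟩ | ⟨h, h'⟩ <;> rw [h']
      exacts [hP.fst_mem e h, hP'.fst_mem e h]
    · intro e he
      rcases hρ e he with ⟨h, h'⟩ | ⟨h, h'⟩ <;> rw [h']
      exacts [hP.snd_mem e h, hP'.snd_mem e h]
    · intro e he f hf h1 h2
      rcases hρ e he with ⟨h, h'⟩ | ⟨h, h'⟩ <;> rcases hρ f hf with ⟨k, k'⟩ | ⟨k, k'⟩ <;>
        rw [h', k']
      · exact hP.apart e h f k h1 h2
      · exact hap.mono (hP.subset e h) (hP'.subset f k)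
      · exact (hap.mono (hP.subset f k) (hP'.subset e h)).symm
      · exact hP'.apart e h f k h1 h2
    · intro L hL
      rcases mem_insert.1 hL with rfl | hL
      exacts [hKconn, hP'.family_connected L hL]
    · intro L hL
      rcases mem_insert.1 hL with rfl | hL
      exacts [hKC.trans (hC.trans hR), (hP'.family_subset L hL).trans sdiff_subset]
    · intro L hL M hM hne
      rcases mem_insert.1 hL with hL | hL <;> rcases mem_insert.1 hM with hM | hM
      · exact absurd (hL.trans hM.symm) hne
      · exact hap.mono (hL ▸ hKC) (hP'.family_subset M hM)
      · exact (hap.mono (hM ▸ hKC) (hP'.family_subset L hL)).symm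
      · exact hP'.family_apart L hL M hM hne
  · rw [card_union_of_disjoint hTT, card_insert_of_notMem hK, sum_insert hK]
    have := card_sdiff_add_card_eq_card hR
    omega

theorem HasLargePacking.of_erase {e : α × β} (he : e ∈ S)
    (h : HasLargePacking H (S \ {e})) (hd : 3 ≤ #(S.filter (H.Adj e))) :
    HasLargePacking H S := by
  obtain ⟨T, ρ, 𝒦, hT, hP, hle⟩ := h
  refine ⟨T, ρ, 𝒦, hT.trans sdiff_subset, { hP with
    subset := fun f hf => (hP.subset f hf).trans sdiff_subset
    family_subset := fun f hf => (hP.family_subset f hf).trans sdiff_subset }, ?_⟩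
  have h1 := crossSum_eq_sdiff_add (H := H) (singleton_subset_iff.2 he)
  have h2 : S.filter (H.Adj e) \ {e} = S.filter (H.Adj e) := by
    rw [sdiff_singleton_eq_erase, erase_eq_of_notMem]
    simp
  have := card_sdiff_add_card_eq_card (singleton_subset_iff.2 he)
  rw [sum_singleton, h2] at h1
  rw [card_singleton] at this
  omega

end

section

open Finset

theorem filter_adj_eq_singleton {ι : Type*} {H : SimpleGraph ι} [DecidableRel H.Adj]
    {S : Finset ι} {e f : ι} (hf : f ∈ S) (h : H.Adj e f)
    (hd : #(S.filter (H.Adj e)) = 1) : S.filter (H.Adj e) = {f} := by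
  obtain ⟨g, hg⟩ := card_eq_one.1 hd
  have : f ∈ S.filter (H.Adj e) := mem_filter.2 ⟨hf, h⟩
  rw [hg, mem_singleton] at this
  rw [hg, this]

theorem not_adj_of_notMem_filter {ι : Type*} {H : SimpleGraph ι} [DecidableRel H.Adj]
    {S : Finset ι} {e f : ι} {A : Finset ι} (h : S.filter (H.Adj e) = A)
    (hf : f ∈ S) (hA : f ∉ A) : ¬H.Adj e f :=
  fun hef => hA (h ▸ mem_filter.2 ⟨hf, hef⟩)

variable {α β : Type*} [DecidableEq α] [DecidableEq β] {H : SimpleGraph (α × β)}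
  [DecidableRel H.Adj] {S : Finset (α × β)}

theorem HasLargePacking.glue_singletons {R C T K : Finset (α × β)}
    (h : HasLargePacking H (S \ R)) (hR : R ⊆ S) (hC : C ⊆ R)
    (hCS : ∀ c ∈ C, S.filter (H.Adj c) ⊆ R) (hTC : T ⊆ C)
    (hT : ∀ e ∈ T, ∀ f ∈ T, e.1 ≠ f.1 → e.2 ≠ f.2 → ¬H.Adj e f) (hK : CrossConnected H K)
    (hKC : K ⊆ C)
    (hcard : 6 * #R + 4 ≤ ∑ e ∈ R, (#(S.filter (H.Adj e)) + #(S.filter (H.Adj e) \ R)) +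
      6 * #T + 2 * span K) : HasLargePacking H S := by
  refine h.glue hR hC (fun c hc s hs hcs => hCS c hc (mem_filter.2 ⟨hs, hcs⟩)) (hTC.trans hC)
    (.of_singletons hTC hT hK hKC) ?_
  rw [crossSum_eq_sdiff_add hR]
  omega

theorem crossConnected_pair {ι : Type*} [DecidableEq ι] {H : SimpleGraph ι} {e f : ι}
    (h : H.Adj e f) : CrossConnected H {e, f} :=
  .insert (.singleton f) (mem_singleton_self f) h.symm

theorem crossConnected_triple {ι : Type*} [DecidableEq ι] {H : SimpleGraph ι} {e f g : ι}
    (h : H.Adj e f) (h' : H.Adj f g) : CrossConnected H {e, f, g} :=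
  .insert (crossConnected_pair h') (by simp) h.symm

theorem four_le_span_pair {α β : Type*} [DecidableEq α] [DecidableEq β] {e f : α × β}
    (h1 : e.1 ≠ f.1) (h2 : e.2 ≠ f.2) : 4 ≤ span {e, f} := by
  simp [span, image_insert, card_pair h1, card_pair h2]

theorem hasLargePacking_of_isolated {e : α × β} (he : e ∈ S) (hN : S.filter (H.Adj e) = ∅)
    (ih : ∀ R ⊆ S, R.Nonempty → HasLargePacking H (S \ R)) : HasLargePacking H S := by
  have hR : {e} ⊆ S := singleton_subset_iff.2 he
  refine (ih _ hR (singleton_nonempty e)).glue_singletons (C := {e}) (T := {e}) (K := {e}) hR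
    subset_rfl (fun c hc => by rw [mem_singleton.1 hc, hN]; exact empty_subset _) subset_rfl
    (by simp) (.singleton e) subset_rfl ?_
  simp [span]

theorem filter_adj_eq_pair {e f : α × β} (hf : f ∈ S) (h : H.Adj e f)
    (hd : #(S.filter (H.Adj e)) = 2) :
    ∃ g ∈ S, g ≠ f ∧ H.Adj e g ∧ S.filter (H.Adj e) = {f, g} := by
  have hf' : f ∈ S.filter (H.Adj e) := mem_filter.2 ⟨hf, h⟩
  have : #((S.filter (H.Adj e)).erase f) = 1 := by rw [card_erase_of_mem hf', hd]
  obtain ⟨g, hg⟩ := card_eq_one.1 this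
  have hg' : g ∈ (S.filter (H.Adj e)).erase f := by simp [hg]
  rw [mem_erase, mem_filter] at hg'
  exact ⟨g, hg'.2.1, hg'.1, hg'.2.2, by rw [← hg, insert_erase hf']⟩

theorem hasLargePacking_of_path_two {e f : α × β} (he : e ∈ S) (hf : f ∈ S)
    (hNe : S.filter (H.Adj e) = {f}) (hNf : S.filter (H.Adj f) = {e})
    (ih : ∀ R ⊆ S, R.Nonempty → HasLargePacking H (S \ R)) : HasLargePacking H S := by
  have hef : H.Adj e f := (mem_filter.1 (hNe ▸ mem_singleton_self f)).2
  have hR : {e, f} ⊆ S := by simp [insert_subset_iff, *]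
  have hCS : ∀ c ∈ ({e, f} : Finset (α × β)), S.filter (H.Adj c) ⊆ {e, f} := by simp [hNe, hNf]
  have hc := card_pair hef.ne
  by_cases hadj : e.1 ≠ f.1 ∧ e.2 ≠ f.2
  · refine (ih _ hR (by simp)).glue_singletons (C := {e, f}) (T := {e}) (K := {e, f}) hR
      subset_rfl hCS (by simp) (by simp) (crossConnected_pair hef) subset_rfl ?_
    have := four_le_span_pair hadj.1 hadj.2
    rw [sum_pair hef.ne, hNe, hNf, hc]
    simp only [card_singleton]
    omega
  · refine (ih _ hR (by simp)).glue_singletons (C := {e, f}) (T := {e, f}) (K := {e, f}) hR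
      subset_rfl hCS subset_rfl ?_ (crossConnected_pair hef) subset_rfl ?_
    · simp
      grind
    have := three_le_span hc.ge
    rw [sum_pair hef.ne, hNe, hNf, hc]
    simp only [card_singleton]
    omega

theorem hasLargePacking_of_path_three {e₁ e₂ e₃ : α × β} (h₁ : e₁ ∈ S) (h₂ : e₂ ∈ S) (h₃ : e₃ ∈ S)
    (h₁₃ : e₁ ≠ e₃) (hN₁ : S.filter (H.Adj e₁) = {e₂}) (hN₂ : S.filter (H.Adj e₂) = {e₁, e₃})
    (hN₃ : S.filter (H.Adj e₃) = {e₂})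
    (ih : ∀ R ⊆ S, R.Nonempty → HasLargePacking H (S \ R)) : HasLargePacking H S := by
  have h₁₂ : H.Adj e₁ e₂ := (mem_filter.1 (hN₁ ▸ mem_singleton_self _)).2
  have h₃₂ : H.Adj e₃ e₂ := (mem_filter.1 (hN₃ ▸ mem_singleton_self _)).2
  have hR : {e₁, e₂, e₃} ⊆ S := by simp [insert_subset_iff, *]
  have hc : #{e₁, e₂, e₃} = 3 := card_eq_three.2 ⟨_, _, _, h₁₂.ne, h₁₃, h₃₂.ne', rfl⟩
  have hn := not_adj_of_notMem_filter hN₁ h₃ (by simpa using h₃₂.ne)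
  refine (ih _ hR (by simp)).glue_singletons (C := {e₁, e₂, e₃}) (T := {e₁, e₃})
    (K := {e₁, e₂, e₃}) hR subset_rfl ?_ ?_ ?_ (crossConnected_triple h₁₂ h₃₂.symm) subset_rfl ?_
  · simp [hN₁, hN₂, hN₃, insert_subset_iff]
  · simp [insert_subset_iff]
  · simp [hn, H.adj_comm e₃]
  · have := four_le_span hc.ge
    rw [sum_insert (by simp [h₁₂.ne, h₁₃]), sum_pair h₃₂.ne', hN₁, hN₂, hN₃, hc, card_pair h₁₃]
    simp only [card_singleton]
    omega

theorem sum_four {ι M : Type*} [DecidableEq ι] [AddCommMonoid M] {a b c d : ι}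
    (h : [a, b, c, d].Nodup)
    (f : ι → M) : ∑ i ∈ {a, b, c, d}, f i = f a + (f b + (f c + f d)) := by
  have : ({a, b, c, d} : Finset ι) = [a, b, c, d].toFinset := by simp
  rw [this, List.sum_toFinset _ h]
  simp

theorem exists_eq_of_span_le_four {e₁ e₂ e₃ e₄ : α × β} (h : [e₁, e₂, e₃, e₄].Nodup)
    (hs : span {e₁, e₂, e₃, e₄} ≤ 4) (h₁ : e₁.1 ≠ e₂.1) (h₂ : e₁.2 ≠ e₂.2)
    (h₃ : e₃.1 ≠ e₄.1) (h₄ : e₃.2 ≠ e₄.2) :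
    (e₃ = (e₁.1, e₂.2) ∧ e₄ = (e₂.1, e₁.2)) ∨ (e₃ = (e₂.1, e₁.2) ∧ e₄ = (e₁.1, e₂.2)) := by
  have hA : {e₁.1, e₂.1} ⊆ ({e₁, e₂, e₃, e₄} : Finset (α × β)).image Prod.fst := by
    simp [insert_subset_iff]
  have hB : {e₁.2, e₂.2} ⊆ ({e₁, e₂, e₃, e₄} : Finset (α × β)).image Prod.snd := by
    simp [insert_subset_iff]
  have hA' := card_le_card hA
  have hB' := card_le_card hB
  rw [card_pair h₁] at hA'
  rw [card_pair h₂] at hB'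
  rw [span] at hs
  replace hA := eq_of_subset_of_card_le hA (by rw [card_pair h₁]; omega)
  replace hB := eq_of_subset_of_card_le hB (by rw [card_pair h₂]; omega)
  have a3 : e₃.1 ∈ ({e₁.1, e₂.1} : Finset α) := by simp [hA]
  have a4 : e₄.1 ∈ ({e₁.1, e₂.1} : Finset α) := by simp [hA]
  have b3 : e₃.2 ∈ ({e₁.2, e₂.2} : Finset β) := by simp [hB]
  have b4 : e₄.2 ∈ ({e₁.2, e₂.2} : Finset β) := by simp [hB]
  simp only [mem_insert, mem_singleton] at a3 a4 b3 b4
  simp only [List.nodup_cons, List.mem_cons] at h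
  simp only [Prod.ext_iff] at h ⊢
  grind

theorem packing_of_square {α β : Type*} [DecidableEq α] [DecidableEq β] {H : SimpleGraph (α × β)}
    {e₁ e₂ e₃ e₄ : α × β} (h₁₂ : e₁ ≠ e₂) (h₃₄ : H.Adj e₃ e₄)
    (hK : CrossConnected H {e₁, e₂, e₃, e₄}) (hap : Apart H {e₁} {e₃, e₄})
    (h : e₁.1 = e₃.1 ∧ e₂.2 = e₃.2 ∧ e₂.1 = e₄.1 ∨ e₁.2 = e₃.2 ∧ e₂.1 = e₃.1 ∧ e₂.2 = e₄.2) :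
    Packing H {e₁, e₂, e₃, e₄} {e₁, e₂, e₃} (fun e => if e = e₂ then {e₃, e₄} else {e})
      {{e₁, e₂, e₃, e₄}} where
  connected e _ := by
    split_ifs
    exacts [crossConnected_pair h₃₄, .singleton e]
  subset e he := by
    split_ifs
    · simp [insert_subset_iff]
    · rw [singleton_subset_iff]
      simp only [mem_insert, mem_singleton] at he ⊢
      tauto
  fst_mem e _ := by
    split_ifs with he
    · rw [he, image_insert, image_singleton, mem_insert, mem_singleton]
      exact h.elim (fun h => .inr h.2.2) fun h => .inl h.2.1
    · simp
  snd_mem e _ := by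
    split_ifs with he
    · rw [he, image_insert, image_singleton, mem_insert, mem_singleton]
      exact h.elim (fun h => .inl h.2.1) fun h => .inr h.2.2
    · simp
  apart e he f hf h1 h2 := by
    have h13 : ¬(e₁.1 ≠ e₃.1 ∧ e₁.2 ≠ e₃.2) := fun h' => h.elim (h'.1 ·.1) (h'.2 ·.1)
    have h23 : ¬(e₂.1 ≠ e₃.1 ∧ e₂.2 ≠ e₃.2) := fun h' => h.elim (h'.2 ·.2.1) (h'.1 ·.2.1)
    simp only [mem_insert, mem_singleton] at he hf
    rcases he with rfl | rfl | rfl <;> rcases hf with rfl | rfl | rfl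
    · exact absurd rfl h1
    · rw [if_neg h₁₂, if_pos rfl]
      exact hap
    · exact absurd ⟨h1, h2⟩ h13
    · rw [if_neg h₁₂, if_pos rfl]
      exact hap.symm
    · exact absurd rfl h1
    · exact absurd ⟨h1, h2⟩ h23
    · exact absurd ⟨h1.symm, h2.symm⟩ h13
    · exact absurd ⟨h1.symm, h2.symm⟩ h23
    · exact absurd rfl h1
  family_connected := by simpa
  family_subset := by simp
  family_apart := by simp

theorem hasLargePacking_of_path_four {e₁ e₂ e₃ e₄ : α × β} (h₁ : e₁ ∈ S) (h₂ : e₂ ∈ S)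
    (h₃ : e₃ ∈ S) (h₄ : e₄ ∈ S) (hnd : [e₁, e₂, e₃, e₄].Nodup)
    (hN₁ : S.filter (H.Adj e₁) = {e₂}) (hN₂ : S.filter (H.Adj e₂) = {e₁, e₃})
    (hN₃ : S.filter (H.Adj e₃) = {e₂, e₄}) (hN₄ : S.filter (H.Adj e₄) = {e₃})
    (ih : ∀ R ⊆ S, R.Nonempty → HasLargePacking H (S \ R)) : HasLargePacking H S := by
  have h₁₂ : H.Adj e₁ e₂ := (mem_filter.1 (hN₁ ▸ mem_singleton_self _)).2
  have h₂₃ : H.Adj e₂ e₃ := (mem_filter.1 (hN₂ ▸ (by simp : e₃ ∈ {e₁, e₃}))).2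
  have h₃₄ : H.Adj e₃ e₄ := (mem_filter.1 (hN₃ ▸ (by simp : e₄ ∈ {e₂, e₄}))).2
  have hR : {e₁, e₂, e₃, e₄} ⊆ S := by simp [insert_subset_iff, *]
  have hc : #{e₁, e₂, e₃, e₄} = 4 := by
    simpa using List.toFinset_card_of_nodup hnd
  have hsum := sum_four hnd fun e => #(S.filter (H.Adj e)) +
    #(S.filter (H.Adj e) \ {e₁, e₂, e₃, e₄})
  have hnd' := hnd
  simp only [List.nodup_cons, List.mem_cons, List.not_mem_nil, or_false, not_or] at hnd
  obtain ⟨⟨-, h13, h14⟩, ⟨-, h24⟩, -⟩ := hnd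
  rw [hN₁, hN₂, hN₃, hN₄, card_pair h13, card_pair h24, card_singleton, card_singleton] at hsum
  have hn13 := not_adj_of_notMem_filter hN₁ h₃ (by simpa using h₂₃.ne')
  have hn14 := not_adj_of_notMem_filter hN₁ h₄ (by simpa using Ne.symm h24)
  have hn24 := not_adj_of_notMem_filter hN₂ h₄ (by simp [Ne.symm h14, h₃₄.ne'])
  have hCS : ∀ c ∈ ({e₁, e₂, e₃, e₄} : Finset (α × β)),
      S.filter (H.Adj c) ⊆ {e₁, e₂, e₃, e₄} := by
    simp [hN₁, hN₂, hN₃, hN₄, insert_subset_iff]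
  have hK : CrossConnected H {e₁, e₂, e₃, e₄} := .insert (crossConnected_triple h₂₃ h₃₄)
    (by simp) h₁₂.symm
  have hspan : 4 ≤ span {e₁, e₂, e₃, e₄} := four_le_span (by omega)
  have large : ∀ T ⊆ ({e₁, e₂, e₃, e₄} : Finset (α × β)), #T = 3 →
      (∀ e ∈ T, ∀ f ∈ T, e.1 ≠ f.1 → e.2 ≠ f.2 → ¬H.Adj e f) → HasLargePacking H S := by
    intro T hT hcT hTT
    refine (ih _ hR (by simp)).glue_singletons hR subset_rfl hCS hT hTT hK subset_rfl ?_
    rw [hsum, hc, hcT]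
    omega
  by_cases hadj : e₁.1 ≠ e₂.1 ∧ e₁.2 ≠ e₂.2; swap
  · refine large {e₁, e₂, e₄} (by simp [insert_subset_iff])
      (card_eq_three.2 ⟨_, _, _, h₁₂.ne, h14, h24, rfl⟩) ?_
    simp only [mem_insert, mem_singleton]
    grind [H.adj_comm, H.irrefl]
  by_cases hadj' : e₃.1 ≠ e₄.1 ∧ e₃.2 ≠ e₄.2; swap
  · refine large {e₁, e₃, e₄} (by simp [insert_subset_iff])
      (card_eq_three.2 ⟨_, _, _, h13, h14, h₃₄.ne, rfl⟩) ?_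
    simp only [mem_insert, mem_singleton]
    grind [H.adj_comm, H.irrefl]
  by_cases hs : span {e₁, e₂, e₃, e₄} ≤ 4; swap
  · refine (ih _ hR (by simp)).glue_singletons (T := {e₁, e₃}) hR subset_rfl hCS
      (by simp [insert_subset_iff]) (by simp [hn13, H.adj_comm e₃]) hK subset_rfl ?_
    rw [hsum, hc, card_pair h13]
    omega
  have hsq := exists_eq_of_span_le_four hnd' hs hadj.1 hadj.2 hadj'.1 hadj'.2
  have hap : Apart H {e₁} {e₃, e₄} := by
    simp [Apart, h13, h14, hn13, hn14]
  have hK₂ : e₁.1 = e₃.1 ∧ e₂.2 = e₃.2 ∧ e₂.1 = e₄.1 ∨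
      e₁.2 = e₃.2 ∧ e₂.1 = e₃.1 ∧ e₂.2 = e₄.2 := by
    rcases hsq with ⟨rfl, rfl⟩ | ⟨rfl, rfl⟩ <;> simp
  have hP := packing_of_square h₁₂.ne h₃₄ hK hap hK₂
  refine (ih _ hR (by simp)).glue hR subset_rfl
    (fun c hc s hs hcs => hCS c hc (mem_filter.2 ⟨hs, hcs⟩)) (by simp [insert_subset_iff]) hP ?_
  rw [crossSum_eq_sdiff_add hR, hsum, hc, card_eq_three.2 ⟨_, _, _, h₁₂.ne, h13, h₂₃.ne, rfl⟩]
  omega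

theorem hasLargePacking_of_long_path {e₁ e₂ e₃ e₄ e₅ : α × β} (h₁ : e₁ ∈ S) (h₂ : e₂ ∈ S)
    (h₃ : e₃ ∈ S) (h₄ : e₄ ∈ S) (hnd : [e₁, e₂, e₃, e₄].Nodup)
    (hnd₅ : e₅ ∉ [e₁, e₂, e₃, e₄])
    (hN₁ : S.filter (H.Adj e₁) = {e₂}) (hN₂ : S.filter (H.Adj e₂) = {e₁, e₃})
    (hN₃ : S.filter (H.Adj e₃) = {e₂, e₄}) (hN₄ : S.filter (H.Adj e₄) = {e₃, e₅})
    (ih : ∀ R ⊆ S, R.Nonempty → HasLargePacking H (S \ R)) : HasLargePacking H S := by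
  have h₁₂ : H.Adj e₁ e₂ := (mem_filter.1 (hN₁ ▸ mem_singleton_self _)).2
  have h₂₃ : H.Adj e₂ e₃ := (mem_filter.1 (hN₂ ▸ (by simp : e₃ ∈ {e₁, e₃}))).2
  have hR : {e₁, e₂, e₃, e₄} ⊆ S := by simp [insert_subset_iff, *]
  have hc : #{e₁, e₂, e₃, e₄} = 4 := by
    simpa using List.toFinset_card_of_nodup hnd
  have hsum := sum_four hnd fun e => #(S.filter (H.Adj e)) +
    #(S.filter (H.Adj e) \ {e₁, e₂, e₃, e₄})
  simp only [List.nodup_cons, List.mem_cons, List.not_mem_nil, or_false, not_or] at hnd hnd₅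
  obtain ⟨⟨-, h13, h14⟩, ⟨-, h24⟩, -⟩ := hnd
  rw [hN₁, hN₂, hN₃, hN₄, card_pair h13, card_pair h24, card_singleton,
    card_pair (Ne.symm hnd₅.2.2.1)] at hsum
  have hn13 := not_adj_of_notMem_filter hN₁ h₃ (by simpa using h₂₃.ne')
  have hout : 0 < #(({e₃, e₅} : Finset (α × β)) \ {e₁, e₂, e₃, e₄}) :=
    card_pos.2 ⟨e₅, by simp [hnd₅]⟩
  have hspan : 4 ≤ span {e₁, e₂, e₃} :=
    four_le_span (card_eq_three.2 ⟨_, _, _, h₁₂.ne, h13, h₂₃.ne, rfl⟩).ge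
  refine (ih _ hR (by simp)).glue_singletons (C := {e₁, e₂, e₃}) (T := {e₁, e₃}) hR
    (by simp [insert_subset_iff]) (by simp [hN₁, hN₂, hN₃, insert_subset_iff])
    (by simp [insert_subset_iff]) (by simp [hn13, H.adj_comm e₃])
    (crossConnected_triple h₁₂ h₂₃) subset_rfl ?_
  rw [hsum, hc, card_pair h13]
  omega

theorem hasLargePacking_of_triangle {e₁ e₂ e₃ : α × β} (h₁ : e₁ ∈ S) (h₂ : e₂ ∈ S) (h₃ : e₃ ∈ S)
    (hN₁ : S.filter (H.Adj e₁) = {e₂, e₃}) (hN₂ : S.filter (H.Adj e₂) = {e₁, e₃})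
    (hN₃ : S.filter (H.Adj e₃) = {e₁, e₂})
    (ih : ∀ R ⊆ S, R.Nonempty → HasLargePacking H (S \ R)) : HasLargePacking H S := by
  have h₁₂ : H.Adj e₁ e₂ := (mem_filter.1 (hN₁ ▸ (by simp : e₂ ∈ {e₂, e₃}))).2
  have h₂₃ : H.Adj e₂ e₃ := (mem_filter.1 (hN₂ ▸ (by simp : e₃ ∈ {e₁, e₃}))).2
  have h₁₃ : H.Adj e₁ e₃ := (mem_filter.1 (hN₁ ▸ (by simp : e₃ ∈ {e₂, e₃}))).2
  have hR : {e₁, e₂, e₃} ⊆ S := by simp [insert_subset_iff, *]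
  have hc : #{e₁, e₂, e₃} = 3 := card_eq_three.2 ⟨_, _, _, h₁₂.ne, h₁₃.ne, h₂₃.ne, rfl⟩
  have hCS : ∀ c ∈ ({e₁, e₂, e₃} : Finset (α × β)), S.filter (H.Adj c) ⊆ {e₁, e₂, e₃} := by
    simp [hN₁, hN₂, hN₃, insert_subset_iff]
  have hK := crossConnected_triple h₁₂ h₂₃
  have hspan := four_le_span hc.ge
  have hsum : ∑ e ∈ {e₁, e₂, e₃}, (#(S.filter (H.Adj e)) +
      #(S.filter (H.Adj e) \ {e₁, e₂, e₃})) ≥ 6 := by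
    rw [sum_insert (by simp [h₁₂.ne, h₁₃.ne]), sum_pair h₂₃.ne, hN₁, hN₂, hN₃, card_pair h₂₃.ne,
      card_pair h₁₃.ne, card_pair h₁₂.ne]
    omega
  have large : ∀ e ∈ ({e₁, e₂, e₃} : Finset (α × β)), ∀ f ∈ ({e₁, e₂, e₃} : Finset (α × β)),
      e ≠ f → (e.1 = f.1 ∨ e.2 = f.2) → HasLargePacking H S := by
    intro e he f hf hne hef
    refine (ih _ hR (by simp)).glue_singletons (T := {e, f}) hR subset_rfl hCS
      (by simp [insert_subset_iff] at he hf ⊢; tauto) ?_ hK subset_rfl ?_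
    · simp only [mem_insert, mem_singleton]
      grind
    · rw [hc, card_pair hne]
      omega
  by_cases g₁₂ : e₁.1 = e₂.1 ∨ e₁.2 = e₂.2
  · exact large e₁ (by simp) e₂ (by simp) h₁₂.ne g₁₂
  by_cases g₁₃ : e₁.1 = e₃.1 ∨ e₁.2 = e₃.2
  · exact large e₁ (by simp) e₃ (by simp) h₁₃.ne g₁₃
  by_cases g₂₃ : e₂.1 = e₃.1 ∨ e₂.2 = e₃.2
  · exact large e₂ (by simp) e₃ (by simp) h₂₃.ne g₂₃
  rw [not_or] at g₁₂ g₁₃ g₂₃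
  have hs : span {e₁, e₂, e₃} = 6 := by
    rw [span]
    simp only [image_insert, image_singleton]
    rw [card_eq_three.2 ⟨_, _, _, g₁₂.1, g₁₃.1, g₂₃.1, rfl⟩,
      card_eq_three.2 ⟨_, _, _, g₁₂.2, g₁₃.2, g₂₃.2, rfl⟩]
  refine (ih _ hR (by simp)).glue_singletons (T := {e₁}) hR subset_rfl hCS (by simp) (by simp)
    hK subset_rfl ?_
  rw [hc, card_singleton, hs]
  omega

theorem hasLargePacking_of_four_cycle {e₁ e₂ e₃ e₄ : α × β} (h₁ : e₁ ∈ S) (h₂ : e₂ ∈ S)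
    (h₃ : e₃ ∈ S) (h₄ : e₄ ∈ S) (hnd : [e₁, e₂, e₃, e₄].Nodup)
    (hN₁ : S.filter (H.Adj e₁) = {e₂, e₄}) (hN₂ : S.filter (H.Adj e₂) = {e₁, e₃})
    (hN₃ : S.filter (H.Adj e₃) = {e₂, e₄}) (hN₄ : S.filter (H.Adj e₄) = {e₁, e₃})
    (ih : ∀ R ⊆ S, R.Nonempty → HasLargePacking H (S \ R)) : HasLargePacking H S := by
  have h₁₂ : H.Adj e₁ e₂ := (mem_filter.1 (hN₁ ▸ (by simp : e₂ ∈ {e₂, e₄}))).2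
  have h₂₃ : H.Adj e₂ e₃ := (mem_filter.1 (hN₂ ▸ (by simp : e₃ ∈ {e₁, e₃}))).2
  have hR : {e₁, e₂, e₃, e₄} ⊆ S := by simp [insert_subset_iff, *]
  have hc : #{e₁, e₂, e₃, e₄} = 4 := by
    simpa using List.toFinset_card_of_nodup hnd
  have hsum := sum_four hnd fun e => #(S.filter (H.Adj e)) +
    #(S.filter (H.Adj e) \ {e₁, e₂, e₃, e₄})
  simp only [List.nodup_cons, List.mem_cons, List.not_mem_nil, or_false, not_or] at hnd
  obtain ⟨⟨-, h13, h14⟩, ⟨-, h24⟩, h34, -⟩ := hnd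
  rw [hN₁, hN₂, hN₃, hN₄, card_pair h13, card_pair h24] at hsum
  have hn13 := not_adj_of_notMem_filter hN₁ h₃ (by simp [h₂₃.ne', h34])
  have hspan : 4 ≤ span {e₁, e₂, e₃} :=
    four_le_span (card_eq_three.2 ⟨_, _, _, h₁₂.ne, h13, h₂₃.ne, rfl⟩).ge
  refine (ih _ hR (by simp)).glue_singletons (C := {e₁, e₂, e₃}) (T := {e₁, e₃}) hR
    (by simp [insert_subset_iff]) (by simp [hN₁, hN₂, hN₃, insert_subset_iff])
    (by simp [insert_subset_iff]) (by simp [hn13, H.adj_comm e₃])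
    (crossConnected_triple h₁₂ h₂₃) subset_rfl ?_
  rw [hsum, hc, card_pair h13]
  omega

/-- Four consecutive edges of a crossing cycle, the middle two of which have a common endpoint. -/
theorem hasLargePacking_of_adjacent {e₀ e₁ e₂ e₃ x y : α × β} (h₀ : e₀ ∈ S) (h₁ : e₁ ∈ S)
    (h₂ : e₂ ∈ S) (h₃ : e₃ ∈ S) (hnd : [e₀, e₁, e₂, e₃].Nodup)
    (hx : x ∉ [e₀, e₁, e₂, e₃]) (hy : y ∉ [e₀, e₁, e₂, e₃])
    (hN₀ : S.filter (H.Adj e₀) = {e₁, x}) (hN₁ : S.filter (H.Adj e₁) = {e₀, e₂})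
    (hN₂ : S.filter (H.Adj e₂) = {e₁, e₃}) (hN₃ : S.filter (H.Adj e₃) = {e₂, y})
    (hadj : e₁.1 = e₂.1 ∨ e₁.2 = e₂.2)
    (ih : ∀ R ⊆ S, R.Nonempty → HasLargePacking H (S \ R)) : HasLargePacking H S := by
  have h₁₂ : H.Adj e₁ e₂ := (mem_filter.1 (hN₁ ▸ (by simp : e₂ ∈ {e₀, e₂}))).2
  have hR : {e₀, e₁, e₂, e₃} ⊆ S := by simp [insert_subset_iff, *]
  have hc : #{e₀, e₁, e₂, e₃} = 4 := by
    simpa using List.toFinset_card_of_nodup hnd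
  have hsum := sum_four hnd fun e => #(S.filter (H.Adj e)) +
    #(S.filter (H.Adj e) \ {e₀, e₁, e₂, e₃})
  simp only [List.nodup_cons, List.mem_cons, List.not_mem_nil, or_false, not_or] at hnd hx hy
  rw [hN₀, hN₁, hN₂, hN₃, card_pair (Ne.symm hx.2.1), card_pair hnd.1.2.1, card_pair hnd.2.1.2,
    card_pair (Ne.symm hy.2.2.1)] at hsum
  have hox : 0 < #(({e₁, x} : Finset (α × β)) \ {e₀, e₁, e₂, e₃}) :=
    card_pos.2 ⟨x, by simp [hx]⟩
  have hoy : 0 < #(({e₂, y} : Finset (α × β)) \ {e₀, e₁, e₂, e₃}) :=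
    card_pos.2 ⟨y, by simp [hy]⟩
  have hspan : 3 ≤ span {e₁, e₂} := three_le_span (card_pair h₁₂.ne).ge
  refine (ih _ hR (by simp)).glue_singletons (C := {e₁, e₂}) (T := {e₁, e₂}) hR
    (by simp [insert_subset_iff]) (by simp [hN₁, hN₂, insert_subset_iff])
    subset_rfl ?_ (crossConnected_pair h₁₂) subset_rfl ?_
  · simp only [mem_insert, mem_singleton]
    grind
  rw [hsum, hc, card_pair h₁₂.ne]
  omega

theorem sum_five {ι M : Type*} [DecidableEq ι] [AddCommMonoid M] {a b c d e : ι}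
    (h : [a, b, c, d, e].Nodup) (f : ι → M) :
    ∑ i ∈ {a, b, c, d, e}, f i = f a + (f b + (f c + (f d + f e))) := by
  have : ({a, b, c, d, e} : Finset ι) = [a, b, c, d, e].toFinset := by simp
  rw [this, List.sum_toFinset _ h]
  simp

theorem three_le_card_of_five_cycle {ι : Type*} [DecidableEq ι] {a b c d e : ι} (hab : a ≠ b)
    (hbc : b ≠ c) (hcd : c ≠ d) (hde : d ≠ e) (hea : e ≠ a) : 3 ≤ #{a, b, c, d, e} := by
  by_cases hac : a = c
  · subst hac
    have := card_eq_three.2 ⟨a, d, e, hcd, hea.symm, hde, rfl⟩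
    exact this.ge.trans (card_le_card (by simp))
  · have := card_eq_three.2 ⟨a, b, c, hab, hac, hbc, rfl⟩
    exact this.ge.trans (card_le_card (by simp [insert_subset_iff]))

theorem hasLargePacking_of_five_cycle {e₀ e₁ e₂ e₃ e₄ : α × β} (h₀ : e₀ ∈ S) (h₁ : e₁ ∈ S)
    (h₂ : e₂ ∈ S) (h₃ : e₃ ∈ S) (h₄ : e₄ ∈ S) (hnd : [e₀, e₁, e₂, e₃, e₄].Nodup)
    (hN₀ : S.filter (H.Adj e₀) = {e₁, e₄}) (hN₁ : S.filter (H.Adj e₁) = {e₀, e₂})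
    (hN₂ : S.filter (H.Adj e₂) = {e₁, e₃}) (hN₃ : S.filter (H.Adj e₃) = {e₂, e₄})
    (hN₄ : S.filter (H.Adj e₄) = {e₃, e₀})
    (hind : ∀ e ∈ S, ∀ f ∈ S, H.Adj e f → e.1 ≠ f.1 ∧ e.2 ≠ f.2)
    (ih : ∀ R ⊆ S, R.Nonempty → HasLargePacking H (S \ R)) : HasLargePacking H S := by
  have h₀₁ : H.Adj e₀ e₁ := (mem_filter.1 (hN₀ ▸ (by simp : e₁ ∈ {e₁, e₄}))).2
  have h₁₂ : H.Adj e₁ e₂ := (mem_filter.1 (hN₁ ▸ (by simp : e₂ ∈ {e₀, e₂}))).2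
  have h₂₃ : H.Adj e₂ e₃ := (mem_filter.1 (hN₂ ▸ (by simp : e₃ ∈ {e₁, e₃}))).2
  have h₃₄ : H.Adj e₃ e₄ := (mem_filter.1 (hN₃ ▸ (by simp : e₄ ∈ {e₂, e₄}))).2
  have h₄₀ : H.Adj e₄ e₀ := (mem_filter.1 (hN₄ ▸ (by simp : e₀ ∈ {e₃, e₀}))).2
  have hR : {e₀, e₁, e₂, e₃, e₄} ⊆ S := by simp [insert_subset_iff, *]
  have hc : #{e₀, e₁, e₂, e₃, e₄} = 5 := by
    simpa using List.toFinset_card_of_nodup hnd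
  have hsum := sum_five hnd fun e => #(S.filter (H.Adj e)) +
    #(S.filter (H.Adj e) \ {e₀, e₁, e₂, e₃, e₄})
  simp only [List.nodup_cons, List.mem_cons, List.not_mem_nil, or_false, not_or] at hnd
  rw [hN₀, hN₁, hN₂, hN₃, hN₄, card_pair hnd.2.1.2.2, card_pair hnd.1.2.1, card_pair hnd.2.1.2.1,
    card_pair hnd.2.2.1.2, card_pair (Ne.symm hnd.1.2.2.1)] at hsum
  have hn13 := not_adj_of_notMem_filter hN₁ h₃ (by simp [Ne.symm hnd.1.2.2.1, h₂₃.ne'])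
  have hspan : 6 ≤ span {e₀, e₁, e₂, e₃, e₄} := by
    have i₀ := hind _ h₀ _ h₁ h₀₁
    have i₁ := hind _ h₁ _ h₂ h₁₂
    have i₂ := hind _ h₂ _ h₃ h₂₃
    have i₃ := hind _ h₃ _ h₄ h₃₄
    have i₄ := hind _ h₄ _ h₀ h₄₀
    rw [span]
    simp only [image_insert, image_singleton]
    exact add_le_add (three_le_card_of_five_cycle i₀.1 i₁.1 i₂.1 i₃.1 i₄.1)
      (three_le_card_of_five_cycle i₀.2 i₁.2 i₂.2 i₃.2 i₄.2)
  refine (ih _ hR (by simp)).glue_singletons (T := {e₁, e₃}) hR subset_rfl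
    (by simp [hN₀, hN₁, hN₂, hN₃, hN₄, insert_subset_iff])
    (by simp [insert_subset_iff]) (by simp [hn13, H.adj_comm e₃])
    (.insert (.insert (crossConnected_triple h₂₃ h₃₄) (mem_insert_self _ _) h₁₂.symm)
      (mem_insert_self _ _) h₀₁.symm) subset_rfl ?_
  rw [hsum, hc, card_pair hnd.2.1.2.1]
  omega

theorem hasLargePacking_of_long_cycle {e₀ e₁ e₂ e₃ e₄ x y : α × β} (h₀ : e₀ ∈ S) (h₁ : e₁ ∈ S)
    (h₂ : e₂ ∈ S) (h₃ : e₃ ∈ S) (h₄ : e₄ ∈ S) (hnd : [e₀, e₁, e₂, e₃, e₄].Nodup)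
    (hx : x ∉ [e₀, e₁, e₂, e₃, e₄]) (hy : y ∉ [e₀, e₁, e₂, e₃, e₄])
    (hN₀ : S.filter (H.Adj e₀) = {e₁, x}) (hN₁ : S.filter (H.Adj e₁) = {e₀, e₂})
    (hN₂ : S.filter (H.Adj e₂) = {e₁, e₃}) (hN₃ : S.filter (H.Adj e₃) = {e₂, e₄})
    (hN₄ : S.filter (H.Adj e₄) = {e₃, y})
    (hind : ∀ e ∈ S, ∀ f ∈ S, H.Adj e f → e.1 ≠ f.1 ∧ e.2 ≠ f.2)
    (ih : ∀ R ⊆ S, R.Nonempty → HasLargePacking H (S \ R)) : HasLargePacking H S := by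
  have h₁₂ : H.Adj e₁ e₂ := (mem_filter.1 (hN₁ ▸ (by simp : e₂ ∈ {e₀, e₂}))).2
  have h₂₃ : H.Adj e₂ e₃ := (mem_filter.1 (hN₂ ▸ (by simp : e₃ ∈ {e₁, e₃}))).2
  have hR : {e₀, e₁, e₂, e₃, e₄} ⊆ S := by simp [insert_subset_iff, *]
  have hc : #{e₀, e₁, e₂, e₃, e₄} = 5 := by
    simpa using List.toFinset_card_of_nodup hnd
  have hsum := sum_five hnd fun e => #(S.filter (H.Adj e)) +
    #(S.filter (H.Adj e) \ {e₀, e₁, e₂, e₃, e₄})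
  simp only [List.nodup_cons, List.mem_cons, List.not_mem_nil, or_false, not_or] at hnd hx hy
  rw [hN₀, hN₁, hN₂, hN₃, hN₄, card_pair (Ne.symm hx.2.1), card_pair hnd.1.2.1,
    card_pair hnd.2.1.2.1, card_pair hnd.2.2.1.2, card_pair (Ne.symm hy.2.2.2.1)] at hsum
  have hox : 0 < #(({e₁, x} : Finset (α × β)) \ {e₀, e₁, e₂, e₃, e₄}) :=
    card_pos.2 ⟨x, by simp [hx]⟩
  have hoy : 0 < #(({e₃, y} : Finset (α × β)) \ {e₀, e₁, e₂, e₃, e₄}) :=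
    card_pos.2 ⟨y, by simp [hy]⟩
  have hn13 := not_adj_of_notMem_filter hN₁ h₃ (by simp [Ne.symm hnd.1.2.2.1, h₂₃.ne'])
  have hspan : 5 ≤ span {e₁, e₂, e₃} := by
    obtain ⟨a₁, b₁⟩ := hind _ h₁ _ h₂ h₁₂
    obtain ⟨a₂, b₂⟩ := hind _ h₂ _ h₃ h₂₃
    have h13 : e₁.1 ≠ e₃.1 ∨ e₁.2 ≠ e₃.2 := by
      rw [← not_and_or, ← Prod.ext_iff]
      exact hnd.2.1.2.1
    have hA : 2 ≤ #{e₁.1, e₂.1, e₃.1} :=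
      (card_pair a₂).ge.trans (card_le_card (subset_insert _ _))
    have hB : 2 ≤ #{e₁.2, e₂.2, e₃.2} :=
      (card_pair b₂).ge.trans (card_le_card (subset_insert _ _))
    rw [span]
    simp only [image_insert, image_singleton]
    rcases h13 with h | h
    · have := card_eq_three.2 ⟨_, _, _, a₁, h, a₂, rfl⟩
      omega
    · have := card_eq_three.2 ⟨_, _, _, b₁, h, b₂, rfl⟩
      omega
  refine (ih _ hR (by simp)).glue_singletons (C := {e₁, e₂, e₃}) (T := {e₁, e₃}) hR
    (by simp [insert_subset_iff])
    (by simp [hN₁, hN₂, hN₃, insert_subset_iff])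
    (by simp [insert_subset_iff]) (by simp [hn13, H.adj_comm e₃])
    (crossConnected_triple h₁₂ h₂₃) subset_rfl ?_
  rw [hsum, hc, card_pair hnd.2.1.2.1]
  omega

theorem hasLargePacking_of_leaf {e₁ : α × β} (h₁ : e₁ ∈ S) (hd₁ : #(S.filter (H.Adj e₁)) = 1)
    (hd : ∀ e ∈ S, #(S.filter (H.Adj e)) = 1 ∨ #(S.filter (H.Adj e)) = 2)
    (ih : ∀ R ⊆ S, R.Nonempty → HasLargePacking H (S \ R)) : HasLargePacking H S := by
  obtain ⟨e₂, hN₁⟩ := card_eq_one.1 hd₁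
  have mem₁ : ∀ f ∈ S, H.Adj e₁ f → f = e₂ := fun f hf h =>
    mem_singleton.1 (hN₁ ▸ mem_filter.2 ⟨hf, h⟩)
  obtain ⟨h₂, h₁₂⟩ : e₂ ∈ S ∧ H.Adj e₁ e₂ := mem_filter.1 (hN₁ ▸ mem_singleton_self _)
  rcases hd e₂ h₂ with hd₂ | hd₂
  · exact hasLargePacking_of_path_two h₁ h₂ hN₁ (filter_adj_eq_singleton h₁ h₁₂.symm hd₂) ih
  obtain ⟨e₃, h₃, h31, h₂₃, hN₂⟩ := filter_adj_eq_pair h₁ h₁₂.symm hd₂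
  have mem₂ : ∀ f ∈ S, H.Adj e₂ f → f = e₁ ∨ f = e₃ := fun f hf h => by
    have : f ∈ S.filter (H.Adj e₂) := mem_filter.2 ⟨hf, h⟩
    simpa [hN₂] using this
  rcases hd e₃ h₃ with hd₃ | hd₃
  · exact hasLargePacking_of_path_three h₁ h₂ h₃ h31.symm hN₁ hN₂
      (filter_adj_eq_singleton h₂ h₂₃.symm hd₃) ih
  obtain ⟨e₄, h₄, h42, h₃₄, hN₃⟩ := filter_adj_eq_pair h₂ h₂₃.symm hd₃
  have h14 : e₁ ≠ e₄ := by
    rintro rfl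
    exact h₂₃.ne' (mem₁ e₃ h₃ h₃₄.symm)
  have hnd : [e₁, e₂, e₃, e₄].Nodup := by
    simp [h₁₂.ne, h31.symm, h14, h₂₃.ne, h42.symm, h₃₄.ne]
  rcases hd e₄ h₄ with hd₄ | hd₄
  · exact hasLargePacking_of_path_four h₁ h₂ h₃ h₄ hnd hN₁ hN₂ hN₃
      (filter_adj_eq_singleton h₃ h₃₄.symm hd₄) ih
  obtain ⟨e₅, h₅, h53, h₄₅, hN₄⟩ := filter_adj_eq_pair h₃ h₃₄.symm hd₄
  have h51 : e₅ ≠ e₁ := by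
    rintro rfl
    exact h42 (mem₁ e₄ h₄ h₄₅.symm)
  have h52 : e₅ ≠ e₂ := by
    rintro rfl
    rcases mem₂ e₄ h₄ h₄₅.symm with h | h
    exacts [h14 h.symm, h₃₄.ne' h]
  exact hasLargePacking_of_long_path h₁ h₂ h₃ h₄ hnd (by simp [h51, h52, h53, h₄₅.ne']) hN₁ hN₂ hN₃
    hN₄ ih

theorem hasLargePacking_of_forall_card_eq_two {e : α × β} (he : e ∈ S)
    (hd : ∀ e ∈ S, #(S.filter (H.Adj e)) = 2)
    (ih : ∀ R ⊆ S, R.Nonempty → HasLargePacking H (S \ R)) : HasLargePacking H S := by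
  obtain ⟨e₁, h₁, e₂, h₂, h₁₂, hadj⟩ : ∃ e₁ ∈ S, ∃ e₂ ∈ S, H.Adj e₁ e₂ ∧
      ((e₁.1 = e₂.1 ∨ e₁.2 = e₂.2) ∨ ∀ e ∈ S, ∀ f ∈ S, H.Adj e f → e.1 ≠ f.1 ∧ e.2 ≠ f.2) := by
    by_cases h : ∃ e₁ ∈ S, ∃ e₂ ∈ S, H.Adj e₁ e₂ ∧ (e₁.1 = e₂.1 ∨ e₁.2 = e₂.2)
    · obtain ⟨e₁, h₁, e₂, h₂, h₁₂, hadj⟩ := h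
      exact ⟨e₁, h₁, e₂, h₂, h₁₂, .inl hadj⟩
    · push Not at h
      obtain ⟨f, hf⟩ := card_pos.1 (by rw [hd e he]; exact two_pos : 0 < #(S.filter (H.Adj e)))
      rw [mem_filter] at hf
      exact ⟨e, he, f, hf.1, hf.2, .inr h⟩
  have mem : ∀ {a b c f : α × β}, S.filter (H.Adj a) = {b, c} → f ∈ S → H.Adj f a →
      f = b ∨ f = c := fun {a b c f} h hf hfa => by
    have : f ∈ S.filter (H.Adj a) := mem_filter.2 ⟨hf, hfa.symm⟩
    simpa [h] using this
  obtain ⟨e₀, h₀, h02, h₁₀, hN₁⟩ := filter_adj_eq_pair h₂ h₁₂ (hd e₁ h₁)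
  obtain ⟨e₃, h₃, h31, h₂₃, hN₂⟩ := filter_adj_eq_pair h₁ h₁₂.symm (hd e₂ h₂)
  by_cases h30 : e₃ = e₀
  · subst h30
    obtain ⟨z, -, -, -, hN₃⟩ := filter_adj_eq_pair h₁ h₁₀.symm (hd e₃ h₃)
    rcases mem hN₃ h₂ h₂₃ with h | rfl
    · exact absurd h h₁₂.ne'
    · exact hasLargePacking_of_triangle h₁ h₂ h₃ hN₁ hN₂ hN₃ ih
  obtain ⟨x, hx, hx1, h₀x, hN₀⟩ := filter_adj_eq_pair h₁ h₁₀.symm (hd e₀ h₀)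
  obtain ⟨y, hy, hy2, h₃y, hN₃⟩ := filter_adj_eq_pair h₂ h₂₃.symm (hd e₃ h₃)
  rw [pair_comm] at hN₁
  by_cases h03 : H.Adj e₀ e₃
  · rcases mem hN₀ h₃ h03.symm with h | rfl
    · exact absurd h h31
    rcases mem hN₃ h₀ h03 with h | rfl
    · exact absurd h h02
    exact hasLargePacking_of_four_cycle h₀ h₁ h₂ h₃
      (by simp [h₁₀.ne', h02, h03.ne, h₁₂.ne, h31.symm, h₂₃.ne]) hN₀ hN₁ hN₂
      (by rw [hN₃, pair_comm]) ih
  have hx2 : x ≠ e₂ := by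
    rintro rfl
    exact (mem hN₂ h₀ h₀x).elim h₁₀.ne' (Ne.symm h30)
  have hx3 : x ≠ e₃ := by
    rintro rfl
    exact h03 h₀x
  have hy0 : y ≠ e₀ := by
    rintro rfl
    exact h03 h₃y.symm
  have hy1 : y ≠ e₁ := by
    rintro rfl
    exact (mem hN₁ h₃ h₃y).elim h30 h₂₃.ne'
  rcases hadj with hadj | hind
  · exact hasLargePacking_of_adjacent h₀ h₁ h₂ h₃
      (by simp [h₁₀.ne', h02, Ne.symm h30, h₁₂.ne, h31.symm, h₂₃.ne])
      (by simp [h₀x.ne', hx1, hx2, hx3]) (by simp [hy0, hy1, hy2, h₃y.ne']) hN₀ hN₁ hN₂ hN₃ hadj ih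
  have hnd : [e₀, e₁, e₂, e₃, y].Nodup := by
    simp [h₁₀.ne', h02, Ne.symm h30, h₁₂.ne, h31.symm, h₂₃.ne, hy0.symm, hy1.symm, hy2.symm, h₃y.ne]
  obtain ⟨z, hz, hz3, hyz, hN₄⟩ := filter_adj_eq_pair h₃ h₃y.symm (hd y hy)
  by_cases hz0 : z = e₀
  · subst hz0
    rcases mem hN₀ hy hyz with h | rfl
    · exact absurd h hy1
    exact hasLargePacking_of_five_cycle h₀ h₁ h₂ h₃ hy hnd hN₀ hN₁ hN₂ hN₃ hN₄ hind ih
  have hxy : x ≠ y := by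
    rintro rfl
    exact (mem hN₄ h₀ h₀x).elim (Ne.symm h30) (Ne.symm hz0)
  have hz1 : z ≠ e₁ := by
    rintro rfl
    exact (mem hN₁ hy hyz).elim hy0 hy2
  have hz2 : z ≠ e₂ := by
    rintro rfl
    exact (mem hN₂ hy hyz).elim hy1 h₃y.ne'
  exact hasLargePacking_of_long_cycle h₀ h₁ h₂ h₃ hy hnd (by simp [h₀x.ne', hx1, hx2, hx3, hxy])
    (by simp [hz0, hz1, hz2, hz3, hyz.ne']) hN₀ hN₁ hN₂ hN₃ hN₄ hind ih

theorem hasLargePacking (H : SimpleGraph (α × β)) [DecidableRel H.Adj] (S : Finset (α × β)) :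
    HasLargePacking H S := by
  induction S using Finset.strongInduction with
  | H S ih =>
  replace ih : ∀ R ⊆ S, R.Nonempty → HasLargePacking H (S \ R) := fun R hR hne =>
    ih _ (sdiff_ssubset hR hne)
  by_cases h3 : ∃ e ∈ S, 3 ≤ #(S.filter (H.Adj e))
  · obtain ⟨e, he, hd⟩ := h3
    exact (ih _ (singleton_subset_iff.2 he) (singleton_nonempty e)).of_erase he hd
  by_cases h0 : ∃ e ∈ S, #(S.filter (H.Adj e)) = 0
  · obtain ⟨e, he, hd⟩ := h0
    exact hasLargePacking_of_isolated he (card_eq_zero.1 hd) ih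
  push Not at h3 h0
  have hd : ∀ e ∈ S, #(S.filter (H.Adj e)) = 1 ∨ #(S.filter (H.Adj e)) = 2 := fun e he => by
    have := h3 e he
    have := h0 e he
    omega
  by_cases hd1 : ∃ e ∈ S, #(S.filter (H.Adj e)) = 1
  · obtain ⟨e, he, hd1⟩ := hd1
    exact hasLargePacking_of_leaf he hd1 hd ih
  rcases S.eq_empty_or_nonempty with rfl | ⟨e, he⟩
  · exact ⟨∅, fun e => {e}, ∅, by simp, by constructor <;> simp, by simp⟩
  push Not at hd1
  exact hasLargePacking_of_forall_card_eq_two he (fun e he => (hd e he).resolve_left (hd1 e he)) ih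
end

theorem card_add_four_le_of_joinedIn {α β : Type*} {A : Finset α} {B : Finset β}
    {E : Finset (α × β)} (hE : E ⊆ A ×ˢ B) (hA : 2 ≤ A.card) {P : α → ℂ} (hP : Set.InjOn P A)
    {Q : β → ℂ} (hQ : Set.InjOn Q B) {W : α × β → Set ℂ}
    (hW : ∀ e ∈ E, JoinedIn (W e) (P e.1) (Q e.2)) (hWP : ∀ e ∈ E, ∀ a ∈ A, P a ∈ W e → a = e.1)
    (hWQ : ∀ e ∈ E, ∀ b ∈ B, Q b ∈ W e → b = e.2)
    (hdisj : ∀ e ∈ E, ∀ f ∈ E, e.1 ≠ f.1 → e.2 ≠ f.2 → Disjoint (W e) (W f)) :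
    E.card + 4 ≤ 2 * (A.card + B.card) := by
  classical
  have hW' : ∀ e ∈ E, ∃ γ : ℝ → ℂ, Continuous γ ∧ γ 0 = P e.1 ∧ γ 1 = Q e.2 ∧ ∀ t, γ t ∈ W e := by
    intro e he
    obtain ⟨γ, hγ⟩ := hW e he
    exact ⟨γ.extend, γ.continuous_extend, γ.extend_zero, γ.extend_one, fun t => hγ _⟩
  choose! γ hγ h0 h1 hγW using hW'
  let ι : A × B → α × β := Prod.map Subtype.val Subtype.val
  have hι : Function.Injective ι := Subtype.val_injective.prodMap Subtype.val_injective
  have hcard : (Finset.univ.filter fun e : A × B => ι e ∈ E).card = E.card := by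
    refine Finset.card_nbij ι (by simp [Set.MapsTo]) hι.injOn fun e he => ?_
    have := Finset.mem_product.1 (hE he)
    exact ⟨(⟨e.1, this.1⟩, ⟨e.2, this.2⟩), by simpa [ι] using he, rfl⟩
  have hmem : ∀ e : A × B, e ∈ Finset.univ.filter (fun e : A × B => ι e ∈ E) ↔ ι e ∈ E := by simp
  have key := card_add_four_le_of_curves (Finset.univ.filter fun e : A × B => ι e ∈ E)
    (by simpa) (P := fun a : A => P a) (fun a b h => Subtype.ext (hP a.2 b.2 h))
    (Q := fun b : B => Q b) (fun a b h => Subtype.ext (hQ a.2 b.2 h)) (fun e => γ (ι e))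
    (fun e he => hγ _ ((hmem e).1 he)) (fun e he => h0 _ ((hmem e).1 he))
    (fun e he => h1 _ ((hmem e).1 he)) ?_ ?_ ?_
  · rwa [hcard, Fintype.card_coe, Fintype.card_coe] at key
  · intro e he a ha t h
    rw [hmem] at he
    exact ha (Subtype.ext (hWP _ he a a.2 (h ▸ hγW _ he t)))
  · intro e he b hb t h
    rw [hmem] at he
    exact hb (Subtype.ext (hWQ _ he b b.2 (h ▸ hγW _ he t)))
  · intro e he f hf h1 h2 s t h
    rw [hmem] at he hf
    exact Set.disjoint_left.1 (hdisj _ he _ hf (fun h => h1 (Subtype.ext h))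
      fun h => h2 (Subtype.ext h)) (hγW _ he s) (h ▸ hγW _ hf t)

/-- Points `pos` and open arcs `U` that represent the vertices and the edges `E` of a bipartite
graph in the plane, with crossing graph `H`. -/
structure EdgeCurves {α β : Type*} (E : Set (α × β)) (H : SimpleGraph (α × β)) (pos : α ⊕ β → ℂ)
    (U : α × β → Set ℂ) : Prop where
  pos_injective : Function.Injective pos
  isPathConnected : ∀ e ∈ E, IsPathConnected (U e)
  isPathConnected_insert_fst : ∀ e ∈ E, IsPathConnected (insert (pos (.inl e.1)) (U e))
  isPathConnected_insert_snd : ∀ e ∈ E, IsPathConnected (insert (pos (.inr e.2)) (U e))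
  pos_notMem : ∀ e ∈ E, ∀ v, pos v ∉ U e
  adj_iff : ∀ e ∈ E, ∀ f ∈ E, e ≠ f → (H.Adj e f ↔ (U e ∩ U f).Nonempty)

theorem IsPathConnected.insert_biUnion {ι X : Type*} [TopologicalSpace X] {x : X} {U : ι → Set X}
    {K : Finset ι} {e : ι} (he : e ∈ K) (h : IsPathConnected (insert x (U e)))
    (he' : (U e).Nonempty) (hK : IsPathConnected (⋃ i ∈ K, U i)) :
    IsPathConnected (insert x (⋃ i ∈ K, U i)) := by
  have : insert x (⋃ i ∈ K, U i) = insert x (U e) ∪ ⋃ i ∈ K, U i := by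
    rw [Set.insert_union, Set.union_eq_self_of_subset_left]
    exact Set.subset_biUnion_of_mem (u := U) he
  rw [this]
  refine h.union hK ?_
  obtain ⟨y, hy⟩ := he'
  exact ⟨y, .inr hy, Set.mem_biUnion he hy⟩

section

open Finset

theorem EdgeCurves.pos_notMem_biUnion {α β : Type*} {E : Set (α × β)}
    {H : SimpleGraph (α × β)} {pos : α ⊕ β → ℂ} {U : α × β → Set ℂ} (h : EdgeCurves E H pos U)
    {K : Finset (α × β)}
    (hKE : ↑K ⊆ E) (v : α ⊕ β) : pos v ∉ ⋃ e ∈ K, U e := by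
  simp only [Set.mem_iUnion, not_exists]
  exact fun e he => h.pos_notMem e (hKE he) v

theorem Apart.disjoint_biUnion {α β : Type*} {E : Set (α × β)}
    {H : SimpleGraph (α × β)} {pos : α ⊕ β → ℂ} {U : α × β → Set ℂ} (h : EdgeCurves E H pos U)
    {K L : Finset (α × β)}
    (hKL : Apart H K L) (hK : ↑K ⊆ E) (hL : ↑L ⊆ E) :
    Disjoint (⋃ e ∈ K, U e) (⋃ e ∈ L, U e) := by
  simp only [Set.disjoint_iUnion_left, Set.disjoint_iUnion_right]
  intro f hf e he
  obtain ⟨hne, hadj⟩ := hKL e he f hf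
  rwa [h.adj_iff e (hK he) f (hL hf) hne, Set.not_nonempty_iff_eq_empty,
    ← Set.disjoint_iff_inter_eq_empty] at hadj

variable {α β : Type*} [DecidableEq α] [DecidableEq β] {E : Set (α × β)} {H : SimpleGraph (α × β)}
  {pos : α ⊕ β → ℂ} {U : α × β → Set ℂ} {S T : Finset (α × β)}

theorem CrossConnected.isPathConnected (h : EdgeCurves E H pos U)
    {K : Finset (α × β)}
    (hK : CrossConnected H K) (hKE : ↑K ⊆ E) : IsPathConnected (⋃ e ∈ K, U e) := by
  induction hK with
  | singleton e => simpa using h.isPathConnected e (hKE (by simp))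
  | @insert K e f hK hf hfe ih =>
    rw [coe_insert, Set.insert_subset_iff] at hKE
    rw [Finset.set_biUnion_insert]
    refine (h.isPathConnected e hKE.1).union (ih hKE.2) ?_
    obtain ⟨x, hxf, hxe⟩ := (h.adj_iff f (hKE.2 hf) e hKE.1 hfe.ne).1 hfe
    exact ⟨x, hxe, Set.mem_biUnion hf hxf⟩

theorem EdgeCurves.isPathConnected_insert_inl (h : EdgeCurves E H pos U)
    {K : Finset (α × β)}
    (hK : CrossConnected H K) (hKE : ↑K ⊆ E) {a : α} (ha : a ∈ K.image Prod.fst) :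
    IsPathConnected (insert (pos (.inl a)) (⋃ e ∈ K, U e)) := by
  obtain ⟨e, he, rfl⟩ := mem_image.1 ha
  exact .insert_biUnion he (h.isPathConnected_insert_fst e (hKE he))
    (h.isPathConnected e (hKE he)).nonempty (hK.isPathConnected h hKE)

theorem EdgeCurves.isPathConnected_insert_inr (h : EdgeCurves E H pos U)
    {K : Finset (α × β)}
    (hK : CrossConnected H K) (hKE : ↑K ⊆ E) {b : β} (hb : b ∈ K.image Prod.snd) :
    IsPathConnected (insert (pos (.inr b)) (⋃ e ∈ K, U e)) := by
  obtain ⟨e, he, rfl⟩ := mem_image.1 hb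
  exact .insert_biUnion he (h.isPathConnected_insert_snd e (hKE he))
    (h.isPathConnected e (hKE he)).nonempty (hK.isPathConnected h hKE)

theorem EdgeCurves.card_add_four_le (h : EdgeCurves E H pos U) {A : Finset α} {B : Finset β}
    (hA : 2 ≤ #A) (hT : T ⊆ A ×ˢ B) (hS : ↑S ⊆ E) {ρ : α × β → Finset (α × β)}
    {𝒦 : Finset (Finset (α × β))} (hP : Packing H S T ρ 𝒦) : #T + 4 ≤ 2 * (#A + #B) := by
  have hρ : ∀ e ∈ T, ↑(ρ e) ⊆ E := fun e he => (coe_subset.2 (hP.subset e he)).trans hS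
  have hinj := h.pos_injective
  have hpos : ∀ e ∈ T, ∀ v, pos v ∉ ⋃ f ∈ ρ e, U f := fun e he v =>
    h.pos_notMem_biUnion (hρ e he) v
  refine card_add_four_le_of_joinedIn hT hA (P := fun a => pos (.inl a))
    (hinj.comp Sum.inl_injective).injOn (Q := fun b => pos (.inr b))
    (hinj.comp Sum.inr_injective).injOn
    (W := fun e => insert (pos (.inl e.1)) (insert (pos (.inr e.2)) (⋃ f ∈ ρ e, U f)))
    ?_ ?_ ?_ ?_
  · intro e he
    obtain ⟨x, hx⟩ := ((hP.connected e he).isPathConnected h (hρ e he)).nonempty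
    refine JoinedIn.trans (y := x) ?_ ?_
    · exact ((h.isPathConnected_insert_inl (hP.connected e he) (hρ e he)
        (hP.fst_mem e he)).joinedIn _ (.inl rfl) _ (.inr hx)).mono
        (Set.insert_subset_insert (Set.subset_insert _ _))
    · exact ((h.isPathConnected_insert_inr (hP.connected e he) (hρ e he)
        (hP.snd_mem e he)).joinedIn _ (.inr hx) _ (.inl rfl)).mono (Set.subset_insert _ _)
  · intro e he a _ ha
    rcases ha with ha | ha | ha
    · exact Sum.inl_injective (hinj ha)
    · exact absurd (hinj ha) Sum.inl_ne_inr
    · exact absurd ha (hpos e he _)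
  · intro e he b _ hb
    rcases hb with hb | hb | hb
    · exact absurd (hinj hb) Sum.inr_ne_inl
    · exact Sum.inr_injective (hinj hb)
    · exact absurd hb (hpos e he _)
  · intro e he f hf h1 h2
    have := (hP.apart e he f hf h1 h2).disjoint_biUnion h (hρ e he) (hρ f hf)
    simp only [Set.disjoint_insert_left, Set.disjoint_insert_right, Set.mem_insert_iff, hinj.eq_iff,
      Sum.inl.injEq, Sum.inr.injEq, reduceCtorEq, h1.symm, h2.symm, hpos e he, hpos f hf,
      this, or_self, not_false_eq_true, and_self]

theorem EdgeCurves.sum_span_add_four_le (h : EdgeCurves E H pos U) {A : Finset α} {B : Finset β}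
    (hA : 2 ≤ #A) (hS : S ⊆ A ×ˢ B) (hSE : ↑S ⊆ E) {ρ : α × β → Finset (α × β)}
    {𝒦 : Finset (Finset (α × β))} (hP : Packing H S T ρ 𝒦) :
    ∑ K ∈ 𝒦, span K + 4 ≤ 2 * (#A + #B + #𝒦) := by
  have hK : ∀ K ∈ 𝒦, ↑K ⊆ E := fun K hK => (coe_subset.2 (hP.family_subset K hK)).trans hSE
  choose! Q hQ using fun K hK' =>
    ((hP.family_connected K hK').isPathConnected h (hK K hK')).nonempty
  have hdisj : ∀ K ∈ 𝒦, ∀ L ∈ 𝒦, K ≠ L → Disjoint (⋃ e ∈ K, U e) (⋃ e ∈ L, U e) :=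
    fun K hK' L hL hne => (hP.family_apart K hK' L hL hne).disjoint_biUnion h (hK K hK') (hK L hL)
  have hmemQ : ∀ K ∈ 𝒦, ∀ L ∈ 𝒦, Q L ∈ ⋃ e ∈ K, U e → L = K := by
    intro K hK' L hL hmem
    by_contra hne
    exact Set.disjoint_left.1 (hdisj K hK' L hL (Ne.symm hne)) hmem (hQ L hL)
  have hpos : ∀ K ∈ 𝒦, ∀ v, pos v ∉ ⋃ e ∈ K, U e := fun K hK' v =>
    h.pos_notMem_biUnion (hK K hK') v
  have hinj := h.pos_injective
  let V : Finset (α × β) → Finset (α ⊕ β) := fun K => (K.image Prod.fst).disjSum (K.image Prod.snd)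
  have hV : ∀ K ∈ 𝒦, V K ⊆ A.disjSum B := fun K hK' => by
    refine disjSum_mono (image_subset_iff.2 fun e he => ?_) (image_subset_iff.2 fun e he => ?_)
    exacts [(mem_product.1 (hS (hP.family_subset K hK' he))).1,
      (mem_product.1 (hS (hP.family_subset K hK' he))).2]
  have hcard : #((A.disjSum B ×ˢ 𝒦).filter fun p => p.1 ∈ V p.2) = ∑ K ∈ 𝒦, span K := by
    rw [card_filter, sum_product_right]
    refine sum_congr rfl fun K hK' => ?_
    rw [← card_filter]
    change #((A.disjSum B).filter (· ∈ V K)) = _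
    rw [filter_mem_eq_inter, inter_eq_right.2 (hV K hK'), card_disjSum, span]
  rw [← hcard, ← card_disjSum]
  refine card_add_four_le_of_joinedIn (filter_subset _ _) (by rw [card_disjSum]; omega)
    (P := pos) hinj.injOn (Q := Q) (fun K hK' L hL hKL => ?_)
    (W := fun p => insert (pos p.1) (⋃ e ∈ p.2, U e)) ?_ ?_ ?_ ?_
  · exact hmemQ L hL K hK' (hKL ▸ hQ L hL)
  all_goals
    simp only [mem_filter, mem_product, and_imp, Prod.forall]
    intro v K _ hK' hv
  · rcases v with a | b
    · exact (h.isPathConnected_insert_inl (hP.family_connected K hK') (hK K hK')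
        (inl_mem_disjSum.1 hv)).joinedIn _ (.inl rfl) _ (.inr (hQ K hK'))
    · exact (h.isPathConnected_insert_inr (hP.family_connected K hK') (hK K hK')
        (inr_mem_disjSum.1 hv)).joinedIn _ (.inl rfl) _ (.inr (hQ K hK'))
  · rintro w - (hw | hw)
    · exact hinj hw
    · exact absurd hw (hpos K hK' w)
  · rintro L hL (hw | hw)
    · exact absurd (hw ▸ hQ L hL) (hpos L hL v)
    · exact hmemQ K hK' L hL hw
  · intro w L _ hL _ hvw hKL
    simp only [Set.disjoint_insert_left, Set.disjoint_insert_right, Set.mem_insert_iff, hinj.eq_iff,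
      hvw.symm, hdisj K hK' L hL hKL, hpos K hK', hpos L hL, or_self, not_false_eq_true,
      and_self]

theorem EdgeCurves.six_mul_card_le [DecidableRel H.Adj] (h : EdgeCurves E H pos U) {A : Finset α}
    {B : Finset β} (hA : 2 ≤ #A) (hS : S ⊆ A ×ˢ B) (hSE : ↑S ⊆ E) :
    6 * #S + 32 ≤ crossSum H S + 16 * (#A + #B) := by
  obtain ⟨T, ρ, 𝒦, hT, hP, hle⟩ := hasLargePacking H S
  have h1 := h.card_add_four_le hA (hT.trans hS) hSE hP
  have h2 := h.sum_span_add_four_le hA hS hSE hP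
  omega

theorem exists_independent_two_mul_card_le (H : SimpleGraph (α × β)) [DecidableRel H.Adj]
    (S : Finset (α × β)) : ∃ T ⊆ S, (∀ e ∈ T, ∀ f ∈ T, ¬H.Adj e f) ∧
      2 * #S ≤ crossSum H S + 2 * #T := by
  induction S using Finset.strongInduction with
  | H S ih =>
  by_cases hS : ∃ e ∈ S, ∃ f ∈ S, H.Adj e f
  · obtain ⟨e, he, f, hf, hef⟩ := hS
    have hsub := singleton_subset_iff.2 he
    obtain ⟨T, hT, hind, hle⟩ := ih (S \ {e}) (sdiff_ssubset hsub (singleton_nonempty e))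
    refine ⟨T, hT.trans sdiff_subset, hind, ?_⟩
    have h1 := crossSum_eq_sdiff_add (H := H) hsub
    have h2 : 0 < #(S.filter (H.Adj e)) := card_pos.2 ⟨f, mem_filter.2 ⟨hf, hef⟩⟩
    have h3 : 0 < #(S.filter (H.Adj e) \ {e}) :=
      card_pos.2 ⟨f, mem_sdiff.2 ⟨mem_filter.2 ⟨hf, hef⟩, by simpa using hef.ne'⟩⟩
    have := card_sdiff_add_card_eq_card hsub
    rw [card_singleton] at this
    rw [sum_singleton] at h1
    omega
  · push Not at hS
    exact ⟨S, subset_rfl, hS, Nat.le_add_left _ _⟩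

/-- The crossings of pairs of edges without common endpoint. -/
def independentCrossings {α β : Type*} (H : SimpleGraph (α × β)) : SimpleGraph (α × β) where
  Adj e f := H.Adj e f ∧ e.1 ≠ f.1 ∧ e.2 ≠ f.2
  symm := ⟨fun _ _ h => ⟨h.1.symm, h.2.1.symm, h.2.2.symm⟩⟩
  loopless := ⟨fun _ h => h.2.1 rfl⟩

theorem EdgeCurves.two_mul_card_le [DecidableRel (independentCrossings H).Adj]
    (h : EdgeCurves E H pos U) {A : Finset α}
    {B : Finset β} (hA : 2 ≤ #A) (hS : S ⊆ A ×ˢ B) (hSE : ↑S ⊆ E) :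
    2 * #S + 8 ≤ crossSum (independentCrossings H) S + 4 * (#A + #B) := by
  obtain ⟨T, hT, hind, hle⟩ := exists_independent_two_mul_card_le (independentCrossings H) S
  have hP : Packing H S T (fun e => {e}) ∅ := by
    refine ⟨fun e _ => .singleton e, fun e he => singleton_subset_iff.2 (hT he), by simp, by simp,
      ?_, by simp, by simp, by simp⟩
    intro e he f hf h1 h2 x hx y hy
    rw [mem_singleton.1 hx, mem_singleton.1 hy]
    exact ⟨fun h => h1 (h ▸ rfl), fun h => hind e he f hf ⟨h, h1, h2⟩⟩
  have := h.card_add_four_le hA (hT.trans hS) hSE hP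
  omega

end

theorem Drawing.edgeInterior_mk {V : Type*} {G : SimpleGraph V} (D : Drawing G) {u v : V}
    (h : G.Adj u v) : D.edgeInterior s(u, v) = (D.arc h).extend '' Set.Ioo 0 1 := by
  have key : D.edgeInterior s(u, v) = D.arc h '' {t | t ≠ 0 ∧ t ≠ 1} := by
    ext x
    simp only [Drawing.edgeInterior, Set.mem_iUnion]
    constructor
    · rintro ⟨u', v', h', he, hx⟩
      rcases Sym2.eq_iff.1 he with ⟨rfl, rfl⟩ | ⟨rfl, rfl⟩
      · exact hx
      · obtain ⟨t, ht, rfl⟩ := hx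
        refine ⟨unitInterval.symm t, ⟨fun h => ht.2 ?_, fun h => ht.1 ?_⟩, ?_⟩
        · exact unitInterval.symm_eq_zero.1 h
        · exact unitInterval.symm_eq_one.1 h
        · rw [D.arc_symm h']
          simp
    · exact fun hx => ⟨u, v, h, rfl, hx⟩
  rw [key]
  ext x
  constructor
  · rintro ⟨t, ht, rfl⟩
    exact ⟨t, ⟨unitInterval.pos_iff_ne_zero.2 ht.1, unitInterval.lt_one_iff_ne_one.2 ht.2⟩,
      Path.extend_apply _ t.2⟩
  · rintro ⟨t, ht, rfl⟩
    refine ⟨⟨t, ht.1.le, ht.2.le⟩, ⟨fun h => ht.1.ne' ?_, fun h => ht.2.ne ?_⟩,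
      (Path.extend_apply _ _).symm⟩
    exacts [congrArg Subtype.val h, congrArg Subtype.val h]

/-- The graph on all potential edges of a bipartite graph whose adjacency is to cross in the drawing
`D`. -/
def Drawing.crossingGraph {α β : Type*} {G : SimpleGraph (α ⊕ β)} (D : Drawing G) :
    SimpleGraph (α × β) where
  Adj e f := D.Crosses s(.inl e.1, .inr e.2) s(.inl f.1, .inr f.2)
  symm := ⟨fun _ _ h => ⟨h.2.1, h.1, h.2.2.1.symm, Set.inter_comm _ _ ▸ h.2.2.2⟩⟩
  loopless := ⟨fun _ h => h.2.2.1 rfl⟩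

theorem bipartite_edge_injective {α β : Type*} :
    Function.Injective fun e : α × β => s((.inl e.1 : α ⊕ β), .inr e.2) := by
  rintro ⟨a, b⟩ ⟨c, d⟩ h
  simpa [Sym2.eq_iff] using h

theorem Drawing.edgeCurves {α β : Type*} {G : SimpleGraph (α ⊕ β)} (D : Drawing G) :
    EdgeCurves {e | G.Adj (.inl e.1) (.inr e.2)} D.crossingGraph
      (fun v => Complex.equivRealProdCLM.symm (D.pos v))
      (fun e => Complex.equivRealProdCLM.symm '' D.edgeInterior s(.inl e.1, .inr e.2)) := by
  have hc := Complex.equivRealProdCLM.symm.continuous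
  have hinj := Complex.equivRealProdCLM.symm.injective
  refine ⟨hinj.comp D.pos_inj, ?_, ?_, ?_, ?_, ?_⟩
  all_goals intro e (he : G.Adj _ _)
  · rw [D.edgeInterior_mk he]
    exact (((convex_Ioo 0 1).isPathConnected ⟨1 / 2, by norm_num⟩).image
      (D.arc he).continuous_extend).image hc
  · rw [D.edgeInterior_mk he, ← Set.image_insert_eq]
    nth_rw 1 [← (D.arc he).extend_zero]
    rw [← Set.image_insert_eq, Set.Ioo_insert_left zero_lt_one]
    exact (((convex_Ico 0 1).isPathConnected ⟨0, by norm_num⟩).image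
      (D.arc he).continuous_extend).image hc
  · rw [D.edgeInterior_mk he, ← Set.image_insert_eq]
    nth_rw 1 [← (D.arc he).extend_one]
    rw [← Set.image_insert_eq, Set.Ioo_insert_right zero_lt_one]
    exact (((convex_Ioc 0 1).isPathConnected ⟨1, by norm_num⟩).image
      (D.arc he).continuous_extend).image hc
  · intro v hv
    rw [hinj.mem_set_image, D.edgeInterior_mk he] at hv
    obtain ⟨t, ht, hv⟩ := hv
    rw [Path.extend_apply _ (Set.Ioo_subset_Icc_self ht)] at hv
    rcases D.arc_avoid he v _ hv with h | h
    · exact ht.1.ne' (congrArg Subtype.val h)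
    · exact ht.2.ne (congrArg Subtype.val h)
  · intro f hf hne
    rw [← Set.image_inter hinj, Set.image_nonempty]
    exact ⟨fun h => h.2.2.2, fun h => ⟨he, hf, bipartite_edge_injective.ne hne, h⟩⟩

open Finset in
theorem crossSum_crossingGraph_le {α β : Type*} [Fintype α] [Fintype β]
    {G : SimpleGraph (α ⊕ β)} (D : Drawing G) [DecidableRel D.crossingGraph.Adj] :
    crossSum D.crossingGraph univ ≤ 2 * D.crossCount + 1 := by
  have h1 : crossSum D.crossingGraph univ =
      #((univ : Finset ((α × β) × (α × β))).filter fun p => D.crossingGraph.Adj p.1 p.2) := by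
    rw [card_filter, Fintype.sum_prod_type (γ := ℕ)
      (f := fun p : (α × β) × (α × β) => if D.crossingGraph.Adj p.1 p.2 then 1 else 0)]
    exact sum_congr rfl fun e _ => card_filter (D.crossingGraph.Adj e) _
  have h2 : crossSum D.crossingGraph univ ≤
      {p : Sym2 (α ⊕ β) × Sym2 (α ⊕ β) | D.Crosses p.1 p.2}.ncard := by
    rw [h1, ← Set.ncard_coe_finset, ← Set.ncard_image_of_injective _
      (bipartite_edge_injective.prodMap bipartite_edge_injective)]
    refine Set.ncard_le_ncard ?_ (Set.toFinite _)
    rintro _ ⟨p, hp, rfl⟩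
    exact (mem_filter.1 hp).2
  rw [Drawing.crossCount]
  omega

theorem nonempty_drawing {V : Type*} [Finite V] (G : SimpleGraph V) : Nonempty (Drawing G) := by
  obtain ⟨n, ⟨φ⟩⟩ := Finite.exists_equiv_fin V
  let x : V → ℝ := fun v => (φ v : ℕ)
  have hx : Function.Injective x :=
    Nat.cast_injective.comp (Fin.val_injective.comp φ.injective)
  have hpos : Function.Injective fun v => (x v, x v ^ 2) := fun u v h => hx (Prod.ext_iff.1 h).1
  refine ⟨{
    pos := fun v => (x v, x v ^ 2)
    pos_inj := hpos
    arc := fun u v _ =>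
      { toFun := fun t => AffineMap.lineMap (x u, x u ^ 2) (x v, x v ^ 2) (t : ℝ)
        continuous_toFun := AffineMap.lineMap_continuous.comp continuous_subtype_val
        source' := by simp
        target' := by simp }
    arc_symm := ?_
    arc_inj := ?_
    arc_avoid := ?_ }⟩
  · intro u v h
    refine Path.ext (funext fun t => ?_)
    exact (AffineMap.lineMap_apply_one_sub _ _ _).symm
  · intro u v h s t hst
    exact Subtype.ext (AffineMap.lineMap_injective ℝ (hpos.ne h.ne) hst)
  · intro u v h w t ht
    obtain ⟨h1, h2⟩ := Prod.ext_iff.1 ht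
    have key : (t : ℝ) * (1 - t) * (x v - x u) ^ 2 = 0 := by
      simp only [Path.coe_mk_mk, AffineMap.lineMap_apply, vsub_eq_sub, vadd_eq_add, Prod.fst_add,
        Prod.snd_add, Prod.smul_fst, Prod.smul_snd, Prod.fst_sub, Prod.snd_sub, smul_eq_mul]
        at h1 h2
      rw [← h1] at h2
      linear_combination h2
    have hne : (x v - x u) ^ 2 ≠ 0 := pow_ne_zero _ (sub_ne_zero.2 (hx.ne h.ne'))
    rcases mul_eq_zero.1 ((mul_eq_zero.1 key).resolve_right hne) with h0 | h0
    · exact .inl (Subtype.ext h0)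
    · exact .inr (Subtype.ext (sub_eq_zero.1 h0).symm)

section

open Finset

theorem choose_sq_mul_le_sum {α β : Type*} [Fintype α] [Fintype β] {n k c : ℕ}
    (hα : Fintype.card α = n)
    (hβ : Fintype.card β = n) {F : Finset α → Finset β → ℕ}
    (h : ∀ A B, #A = k → #B = k → c ≤ F A B) :
    n.choose k ^ 2 * c ≤ ∑ A ∈ powersetCard k univ, ∑ B ∈ powersetCard k univ, F A B := by
  calc
    _ = ∑ A ∈ powersetCard k (univ : Finset α), ∑ B ∈ powersetCard k (univ : Finset β), c := by
      simp only [sum_const, card_powersetCard, card_univ, hα, hβ, smul_eq_mul]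
      ring
    _ ≤ _ := sum_le_sum fun A hA => sum_le_sum fun B hB =>
      h A B (mem_powersetCard.1 hA).2 (mem_powersetCard.1 hB).2

theorem independentCrossings_idem {α β : Type*} (H : SimpleGraph (α × β)) :
    independentCrossings (independentCrossings H) = independentCrossings H := by
  ext e f
  exact ⟨fun h => h.1, fun h => ⟨h, h.2⟩⟩

variable {α β : Type*} [DecidableEq α] [DecidableEq β]

theorem crossSum_add_crossSum_le {ι : Type*} [DecidableEq ι] {H H₀ H₁ : SimpleGraph ι}
    [DecidableRel H.Adj] [DecidableRel H₀.Adj] [DecidableRel H₁.Adj] {S S₀ S₁ : Finset ι}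
    (h₀ : H₀ ≤ H) (h₁ : H₁ ≤ H) (hS₀ : S₀ ⊆ S) (hS₁ : S₁ ⊆ S) (hdisj : Disjoint S₀ S₁) :
    crossSum H₀ S₀ + crossSum H₁ S₁ ≤ crossSum H S := by
  calc
    _ ≤ ∑ e ∈ S₀, #(S.filter (H.Adj e)) + ∑ e ∈ S₁, #(S.filter (H.Adj e)) :=
      add_le_add
        (sum_le_sum fun e _ => card_le_card
          (filter_subset_filter _ hS₀ |>.trans (monotone_filter_right _ fun _ _ h => h₀ h)))
        (sum_le_sum fun e _ => card_le_card
          (filter_subset_filter _ hS₁ |>.trans (monotone_filter_right _ fun _ _ h => h₁ h)))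
    _ = ∑ e ∈ S₀ ∪ S₁, #(S.filter (H.Adj e)) := (sum_union hdisj).symm
    _ ≤ _ := sum_le_sum_of_subset (union_subset hS₀ hS₁)

theorem crossSum_sup_le {ι : Type*} [DecidableEq ι] (H₀ H₁ : SimpleGraph ι)
    [DecidableRel H₀.Adj] [DecidableRel H₁.Adj] [DecidableRel (H₀ ⊔ H₁).Adj] (S : Finset ι) :
    crossSum (H₀ ⊔ H₁) S ≤ crossSum H₀ S + crossSum H₁ S := by
  rw [crossSum, crossSum, crossSum, ← sum_add_distrib]
  refine sum_le_sum fun e _ => (card_le_card ?_).trans (card_union_le _ _)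
  intro f
  simp only [mem_filter, mem_union, SimpleGraph.sup_adj]
  tauto

theorem sum_crossSum_product [Fintype α] [Fintype β] (H : SimpleGraph (α × β))
    [DecidableRel H.Adj] (k l : ℕ) :
    ∑ A ∈ powersetCard k univ, ∑ B ∈ powersetCard l univ, crossSum H (A ×ˢ B) =
      ∑ e, ∑ f ∈ univ.filter (H.Adj e), #((powersetCard k univ).filter ({e.1, f.1} ⊆ ·)) *
        #((powersetCard l univ).filter ({e.2, f.2} ⊆ ·)) := by
  have h (A : Finset α) (B : Finset β) : crossSum H (A ×ˢ B) =
      ∑ e, ∑ f ∈ univ.filter (H.Adj e),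
        (if {e.1, f.1} ⊆ A then 1 else 0) * (if {e.2, f.2} ⊆ B then 1 else 0) := by
    have he (e : α × β) : (if e ∈ A ×ˢ B then #((A ×ˢ B).filter (H.Adj e)) else 0) =
        ∑ f ∈ univ.filter (H.Adj e),
          (if {e.1, f.1} ⊆ A then 1 else 0) * (if {e.2, f.2} ⊆ B then 1 else 0) := by
      have : (A ×ˢ B).filter (H.Adj e) = (univ.filter (H.Adj e)).filter (· ∈ A ×ˢ B) := by
        ext f
        simp [and_comm]
      rw [this, card_filter, ← mul_boole, sum_mul]
      refine sum_congr rfl fun f _ => ?_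
      simp only [mem_product, insert_subset_iff, singleton_subset_iff, mul_ite, mul_one,
        mul_zero, ← ite_and]
      exact if_congr (by tauto) rfl rfl
    rw [crossSum, ← sum_congr rfl fun e _ => he e, sum_ite_mem, univ_inter]
  simp_rw [h]
  rw [← sum_product', sum_comm]
  refine sum_congr rfl fun e _ => ?_
  rw [sum_comm]
  refine sum_congr rfl fun f _ => ?_
  rw [card_filter, card_filter, sum_mul_sum, ← sum_product']

theorem card_powersetCard_filter_pair_subset [Fintype α] {k : ℕ} (hk : 2 ≤ k) (x y : α) :
    #((powersetCard k univ).filter ({x, y} ⊆ ·)) =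
      if x = y then (Fintype.card α - 1).choose (k - 1)
      else (Fintype.card α - 2).choose (k - 2) := by
  have h2 := card_le_two (a := x) (b := y)
  rw [card_filter_powersetCard_subset _ _ _ (subset_univ _) (h2.trans hk), card_univ]
  split_ifs with h
  · simp [h]
  · rw [card_pair h]

theorem sum_crossSum_product_add [Fintype α] [Fintype β] (H : SimpleGraph (α × β))
    [DecidableRel H.Adj] [DecidableRel (independentCrossings H).Adj] {n k : ℕ}
    (hα : Fintype.card α = n) (hβ : Fintype.card β = n) (hk : 2 ≤ k) :
    ∑ A ∈ powersetCard k univ, ∑ B ∈ powersetCard k univ, crossSum H (A ×ˢ B) +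
        (n - 2).choose (k - 2) * (n - 1).choose (k - 1) * crossSum (independentCrossings H) univ =
      (n - 2).choose (k - 2) ^ 2 * crossSum (independentCrossings H) univ +
        (n - 2).choose (k - 2) * (n - 1).choose (k - 1) * crossSum H univ := by
  have hI (e : α × β) : #(univ.filter ((independentCrossings H).Adj e)) =
      ∑ f ∈ univ.filter (H.Adj e), if e.1 ≠ f.1 ∧ e.2 ≠ f.2 then 1 else 0 := by
    rw [← card_filter, filter_filter]
    exact congrArg card (filter_congr fun f _ => Iff.rfl)
  rw [sum_crossSum_product, crossSum, crossSum, sum_congr rfl fun e _ => hI e, mul_sum, mul_sum,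
    mul_sum, ← sum_add_distrib, ← sum_add_distrib]
  refine sum_congr rfl fun e _ => ?_
  rw [mul_sum, mul_sum, card_eq_sum_ones, mul_sum, ← sum_add_distrib, ← sum_add_distrib]
  refine sum_congr rfl fun f hf => ?_
  have hne : e ≠ f := (mem_filter.1 hf).2.ne
  rw [Ne, Prod.ext_iff, not_and_or] at hne
  rw [card_powersetCard_filter_pair_subset hk, card_powersetCard_filter_pair_subset hk, hα, hβ]
  by_cases h1 : e.1 = f.1 <;> by_cases h2 : e.2 = f.2
  · tauto
  all_goals
    simp only [h1, h2, ne_eq, not_true_eq_false, not_false_eq_true, and_true, and_false, and_self,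
      if_true,
      if_false]
    ring

theorem le_crossSum_univ [Fintype α] [Fintype β] (hα : Fintype.card α = 21)
    (hβ : Fintype.card β = 21) (H : SimpleGraph (α × β)) [DecidableRel H.Adj]
    [DecidableRel (independentCrossings H).Adj]
    (h : ∀ A B, #A = 15 → #B = 15 → 454 ≤ crossSum H (A ×ˢ B))
    (h' : ∀ A B, #A = 10 → #B = 10 → 56 ≤ crossSum (independentCrossings H) (A ×ˢ B)) :
    1636 ≤ crossSum H univ := by
  classical
  have h1 := choose_sq_mul_le_sum hα hβ h
  have h2 := choose_sq_mul_le_sum hα hβ h'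
  have h3 := sum_crossSum_product_add H hα hβ (k := 15) (by norm_num)
  have h4 := sum_crossSum_product_add (independentCrossings H) hα hβ (k := 10) (by norm_num)
  simp only [independentCrossings_idem] at h4
  simp only [Nat.choose] at h1 h2 h3 h4
  omega

theorem exists_drawing_crossCount_eq {V : Type*} [Finite V] (G : SimpleGraph V) :
    ∃ D : Drawing G, D.crossCount = crossingNumber G := by
  obtain ⟨D⟩ := nonempty_drawing G
  exact Nat.sInf_mem (s := {n | ∃ D : Drawing G, D.crossCount = n}) ⟨_, D, rfl⟩

theorem le_crossCount_add_crossCount [Fintype α] [Fintype β] (hα : Fintype.card α = 21)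
    (hβ : Fintype.card β = 21) {G₀ G₁ : SimpleGraph (α ⊕ β)}
    (hadj : ∀ a b, ¬G₀.Adj (.inl a) (.inr b) ↔ G₁.Adj (.inl a) (.inr b)) (D₀ : Drawing G₀)
    (D₁ : Drawing G₁) : 817 ≤ D₀.crossCount + D₁.crossCount := by
  classical
  let H := D₀.crossingGraph ⊔ D₁.crossingGraph
  let S₀ : Finset α → Finset β → Finset (α × β) := fun A B =>
    (A ×ˢ B).filter fun e => G₀.Adj (.inl e.1) (.inr e.2)
  let S₁ : Finset α → Finset β → Finset (α × β) := fun A B =>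
    (A ×ˢ B).filter fun e => G₁.Adj (.inl e.1) (.inr e.2)
  have hS₁ (A B) : S₁ A B = (A ×ˢ B).filter fun e => ¬G₀.Adj (.inl e.1) (.inr e.2) := by
    simp only [hadj, S₁]
  have hdisj (A B) : Disjoint (S₀ A B) (S₁ A B) := by
    rw [hS₁]
    exact disjoint_filter_filter_not _ _ _
  have hcard (A B) : #(S₀ A B) + #(S₁ A B) = #A * #B := by
    rw [hS₁, ← card_product]
    exact card_filter_add_card_filter_not _
  have hE₀ (A B) : ↑(S₀ A B) ⊆ {e : α × β | G₀.Adj (.inl e.1) (.inr e.2)} := fun e he =>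
    (mem_filter.1 he).2
  have hE₁ (A B) : ↑(S₁ A B) ⊆ {e : α × β | G₁.Adj (.inl e.1) (.inr e.2)} := fun e he =>
    (mem_filter.1 he).2
  have key : 1636 ≤ crossSum H univ := by
    refine le_crossSum_univ hα hβ H (fun A B hA hB => ?_) fun A B hA hB => ?_
    · have h₀ := D₀.edgeCurves.six_mul_card_le (S := S₀ A B) (by omega) (filter_subset _ _)
        (hE₀ A B)
      have h₁ := D₁.edgeCurves.six_mul_card_le (S := S₁ A B) (by omega) (filter_subset _ _)
        (hE₁ A B)
      have h₂ := crossSum_add_crossSum_le (H := H) (S₀ := S₀ A B) (S₁ := S₁ A B)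
        le_sup_left le_sup_right
        (filter_subset _ _) (filter_subset _ _) (hdisj A B)
      have h₃ := hcard A B
      rw [hA, hB] at h₀ h₁ h₃
      omega
    · have h₀ := D₀.edgeCurves.two_mul_card_le (S := S₀ A B) (by omega) (filter_subset _ _)
        (hE₀ A B)
      have h₁ := D₁.edgeCurves.two_mul_card_le (S := S₁ A B) (by omega) (filter_subset _ _)
        (hE₁ A B)
      have h₂ := crossSum_add_crossSum_le (H := independentCrossings H)
        (H₀ := independentCrossings D₀.crossingGraph) (H₁ := independentCrossings D₁.crossingGraph)
        (S₀ := S₀ A B) (S₁ := S₁ A B)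
        (fun _ _ h => ⟨.inl h.1, h.2⟩) (fun _ _ h => ⟨.inr h.1, h.2⟩) (filter_subset _ _)
        (filter_subset _ _) (hdisj A B)
      have h₃ := hcard A B
      rw [hA, hB] at h₀ h₁ h₃
      omega
  have h₀ := crossSum_crossingGraph_le D₀
  have h₁ := crossSum_crossingGraph_le D₁
  have h₂ : crossSum H univ ≤ _ := crossSum_sup_le D₀.crossingGraph D₁.crossingGraph univ
  omega

end

/-- `cr₂(K_{21,21}) ≥ 817`. -/
theorem cr2_K21_21_lower_bound :
    817 ≤ kCrossingNumber 2 (completeBipartiteGraph (Fin 21) (Fin 21)) := by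
  refine le_csInf ⟨_, ![completeBipartiteGraph (Fin 21) (Fin 21), ⊥], ?_, ?_, rfl⟩ ?_
  · rw [← Finset.sup_univ_eq_iSup]
    simp [Fin.univ_succ]
  · intro i j hij
    fin_cases i <;> fin_cases j <;> simp at hij ⊢
  rintro _ ⟨f, hf, hdisj, rfl⟩
  rw [Fin.sum_univ_two]
  obtain ⟨D₀, hD₀⟩ := exists_drawing_crossCount_eq (f 0)
  obtain ⟨D₁, hD₁⟩ := exists_drawing_crossCount_eq (f 1)
  rw [← hD₀, ← hD₁]
  refine le_crossCount_add_crossCount (Fintype.card_fin 21) (Fintype.card_fin 21)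
    (fun a b => ⟨fun h => ?_, fun h₁ h₀ => ?_⟩) D₀ D₁
  · have hab : (⨆ i, f i).Adj (.inl a) (.inr b) := by
      rw [hf]
      simp
    obtain ⟨i, hi⟩ := SimpleGraph.iSup_adj.1 hab
    fin_cases i
    exacts [absurd hi h, hi]
  · exact Set.disjoint_left.1 (hdisj 0 1 zero_ne_one)
      (show s(.inl a, .inr b) ∈ (f 0).edgeSet from h₀) h₁
end

section
/- Every graph with at most 8 edges is planar; the only nonplanar graph with 9 edges is K_{3,3}; and the only nonplanar graphs with 10 edges are K_5, K_{3,3} with one extra edge added, and K_{3,3} with one edge subdivided. -/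
open SimpleGraph

/-- A graph is planar if it has a drawing in the plane with no crossings. -/
def IsPlanar {V : Type*} (G : SimpleGraph V) : Prop :=
  ∃ D : Drawing G, D.crossCount = 0

/-- `K_{3,3}` with one edge subdivided: parts `{0,1,2}` and `{3,4,5}`, with
the edge `03` subdivided by the new vertex `6`. -/
def K33Subdivided : SimpleGraph (Fin 7) :=
  SimpleGraph.fromEdgeSet
    {s(0, 4), s(0, 5), s(1, 3), s(1, 4), s(1, 5), s(2, 3), s(2, 4), s(2, 5), s(0, 6), s(6, 3)}

/-! ### Straight-line drawings in general position -/

/-- Twice the signed area of the triangle `abc`. -/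
def orient (a b c : ℝ × ℝ) : ℝ := (b.1 - a.1) * (c.2 - a.2) - (b.2 - a.2) * (c.1 - a.1)

lemma orient_rotate (a b c : ℝ × ℝ) : orient b c a = orient a b c := by
  unfold orient; ring

lemma orient_swap (a b c : ℝ × ℝ) : orient b a c = -orient a b c := by
  unfold orient; ring

lemma orient_lineMap (a b c d : ℝ × ℝ) (t : ℝ) :
    orient a b (AffineMap.lineMap c d t) = (1 - t) * orient a b c + t * orient a b d := by
  simp only [orient, AffineMap.lineMap_apply_module, Prod.fst_add, Prod.snd_add, Prod.smul_fst,
    Prod.smul_snd, smul_eq_mul]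
  ring

lemma orient_self_left (a b : ℝ × ℝ) : orient a b a = 0 := by
  unfold orient; ring

lemma orient_self_right (a b : ℝ × ℝ) : orient a b b = 0 := by
  unfold orient; ring

lemma orient_lineMap_self (a b : ℝ × ℝ) (t : ℝ) :
    orient a b (AffineMap.lineMap a b t) = 0 := by
  rw [orient_lineMap, orient_self_left, orient_self_right]; ring

@[fun_prop]
lemma Continuous.orient {X : Type*} [TopologicalSpace X] {f g h : X → ℝ × ℝ}
    (hf : Continuous f) (hg : Continuous g) (hh : Continuous h) :
    Continuous fun x => orient (f x) (g x) (h x) := by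
  unfold _root_.orient; fun_prop

lemma dense_orient_ne_zero {a b : ℝ × ℝ} (hab : a ≠ b) : Dense {x | orient a b x ≠ 0} := by
  intro x
  by_cases hx : orient a b x = 0
  swap
  · exact subset_closure hx
  set n : ℝ × ℝ := (-(b.2 - a.2), b.1 - a.1)
  have hn : 0 < (b.1 - a.1) ^ 2 + (b.2 - a.2) ^ 2 := by
    by_contra! h
    apply hab
    ext
    · nlinarith [sq_nonneg (b.1 - a.1), sq_nonneg (b.2 - a.2)]
    · nlinarith [sq_nonneg (b.1 - a.1), sq_nonneg (b.2 - a.2)]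
  have hlim : Filter.Tendsto (fun t : ℝ => x + t • n) (nhdsWithin 0 {0}ᶜ) (nhds x) := by
    have h : Continuous fun t : ℝ => x + t • n := by fun_prop
    simpa using (h.tendsto 0).mono_left nhdsWithin_le_nhds
  refine mem_closure_of_tendsto hlim ?_
  filter_upwards [self_mem_nhdsWithin] with t ht
  have h : orient a b (x + t • n) =
      orient a b x + t * ((b.1 - a.1) ^ 2 + (b.2 - a.2) ^ 2) := by
    simp only [orient, n, Prod.fst_add, Prod.snd_add, Prod.smul_fst, Prod.smul_snd, smul_eq_mul]
    ring
  rw [h, hx, zero_add]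
  exact mul_ne_zero ht hn.ne'

/-- Every nonempty open set contains a point off finitely many given lines and points. -/
lemma exists_mem_orient_ne_zero {ι : Type*} [Finite ι] (p : ι → ℝ × ℝ) {U : Set (ℝ × ℝ)}
    (hU : IsOpen U) (hne : U.Nonempty) :
    ∃ x ∈ U, (∀ i, x ≠ p i) ∧ ∀ i j, p i ≠ p j → orient (p i) (p j) x ≠ 0 := by
  let q : (ι × ι) ⊕ ι → (ℝ × ℝ) × (ℝ × ℝ) :=
    Sum.elim (fun i => (p i.1, p i.2)) (fun i => (p i, p i + (1, 0)))
  have hd : Dense (⋂ i : {i // (q i).1 ≠ (q i).2},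
      {x | orient (q i.1).1 (q i.1).2 x ≠ 0}) :=
    dense_iInter_of_isOpen (fun i => isOpen_ne_fun (by fun_prop) (by fun_prop))
      fun i => dense_orient_ne_zero i.2
  obtain ⟨x, hx, hxU⟩ := hd.exists_mem_open hU hne
  rw [Set.mem_iInter] at hx
  refine ⟨x, hxU, fun i h => ?_, fun i j hij => hx ⟨.inl (i, j), hij⟩⟩
  refine hx ⟨.inr i, by simp [q]⟩ ?_
  rw [h]
  exact orient_self_left _ _

section

variable {V : Type*}

/-- `p` places the vertices so that the vertices in `T` are in general position and the
straight segments representing two edges without common endpoint do not meet, witnessed by one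
of the edges lying strictly on one side of the line spanned by the other. -/
structure IsStraightDrawing (G : SimpleGraph V) (T : Set V) (p : V → ℝ × ℝ) : Prop where
  injOn : Set.InjOn p T
  orient_ne_zero : ∀ i ∈ T, ∀ j ∈ T, ∀ k ∈ T, i ≠ j → i ≠ k → j ≠ k →
    orient (p i) (p j) (p k) ≠ 0
  separated : ∀ a b c d, G.Adj a b → G.Adj c d → a ≠ c → a ≠ d → b ≠ c → b ≠ d →
    0 < orient (p a) (p b) (p c) * orient (p a) (p b) (p d) ∨
      0 < orient (p c) (p d) (p a) * orient (p c) (p d) (p b)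

/-- A graph is straight planar if it has a crossing-free straight-line drawing in general
position. -/
def IsStraightPlanar (G : SimpleGraph V) : Prop := ∃ p, IsStraightDrawing G Set.univ p

/-- A vertex `v` may be placed generically close to a point `m` where the edges at `v` do not
cross other edges. -/
lemma IsStraightDrawing.exists_insert [Finite V] {G H : SimpleGraph V} {T : Set V}
    {p : V → ℝ × ℝ} (hp : IsStraightDrawing H T p) (v : V)
    (hGH : ∀ a b, a ≠ v → b ≠ v → G.Adj a b → H.Adj a b) (m : ℝ × ℝ)
    (hm : ∀ w c d, G.Adj v w → G.Adj c d → c ≠ v → d ≠ v → c ≠ w → d ≠ w →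
      0 < orient m (p w) (p c) * orient m (p w) (p d) ∨
        0 < orient (p c) (p d) m * orient (p c) (p d) (p w)) :
    ∃ p', IsStraightDrawing G (insert v T) p' := by
  classical
  have hev : ∀ᶠ x in nhds m, ∀ w c d, G.Adj v w → G.Adj c d → c ≠ v → d ≠ v → c ≠ w → d ≠ w →
      0 < orient x (p w) (p c) * orient x (p w) (p d) ∨
        0 < orient (p c) (p d) x * orient (p c) (p d) (p w) := by
    simp only [Filter.eventually_all]
    intro w c d h1 h2 h3 h4 h5 h6
    have ho : IsOpen {x | 0 < orient x (p w) (p c) * orient x (p w) (p d) ∨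
        0 < orient (p c) (p d) x * orient (p c) (p d) (p w)} :=
      IsOpen.union
        (s₁ := {x | 0 < orient x (p w) (p c) * orient x (p w) (p d)})
        (s₂ := {x | 0 < orient (p c) (p d) x * orient (p c) (p d) (p w)})
        (isOpen_lt (by fun_prop) (by fun_prop)) (isOpen_lt (by fun_prop) (by fun_prop))
    exact ho.mem_nhds (hm w c d h1 h2 h3 h4 h5 h6)
  obtain ⟨U, hU, hUo, hmU⟩ := eventually_nhds_iff.1 hev
  obtain ⟨x, hxU, hxp, hx⟩ := exists_mem_orient_ne_zero p hUo ⟨m, hmU⟩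
  have key := hU x hxU
  have hne : ∀ w, w ≠ v → Function.update p v x w = p w := fun w hw =>
    Function.update_of_ne hw x p
  have hv : Function.update p v x v = x := Function.update_self v x p
  have hmem : ∀ i ∈ insert v T, i ≠ v → i ∈ T := by
    intro i hi hiv
    exact hi.resolve_left hiv
  refine ⟨Function.update p v x, ?_, ?_, ?_⟩
  · intro i hi j hj hij
    by_cases hiv : i = v <;> by_cases hjv : j = v
    · rw [hiv, hjv]
    · subst hiv
      rw [hv, hne j hjv] at hij
      exact absurd hij (hxp j)
    · subst hjv
      rw [hv, hne i hiv] at hij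
      exact absurd hij.symm (hxp i)
    · rw [hne i hiv, hne j hjv] at hij
      exact hp.injOn (hmem i hi hiv) (hmem j hj hjv) hij
  · have hT : ∀ i ∈ insert v T, ∀ j ∈ insert v T, i ≠ v → j ≠ v → i ≠ j →
        orient (p i) (p j) x ≠ 0 := fun i hi j hj hiv hjv hij =>
      hx i j fun h => hij (hp.injOn (hmem i hi hiv) (hmem j hj hjv) h)
    intro i hi j hj k hk hij hik hjk
    by_cases hiv : i = v
    · subst hiv
      rw [hv, hne j hij.symm, hne k hik.symm, ← orient_rotate]
      exact hT j hj k hk hij.symm hik.symm hjk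
    by_cases hjv : j = v
    · subst hjv
      rw [hv, hne i hiv, hne k hjk.symm, ← orient_rotate, ← orient_rotate]
      exact hT k hk i hi hjk.symm hij hik.symm
    by_cases hkv : k = v
    · subst hkv
      rw [hv, hne i hiv, hne j hjv]
      exact hT i hi j hj hiv hjv hij
    rw [hne i hiv, hne j hjv, hne k hkv]
    exact hp.orient_ne_zero i (hmem i hi hiv) j (hmem j hj hjv) k (hmem k hk hkv) hij hik hjk
  · intro a b c d hab hcd hac had hbc hbd
    by_cases hav : a = v
    · subst hav
      rw [hv, hne b hab.ne', hne c hac.symm, hne d had.symm]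
      exact key b c d hab hcd hac.symm had.symm hbc.symm hbd.symm
    by_cases hbv : b = v
    · subst hbv
      rw [hv, hne a hav, hne c hbc.symm, hne d hbd.symm, orient_swap x, orient_swap x, neg_mul_neg,
        mul_comm (orient (p c) (p d) (p a))]
      exact key a c d hab.symm hcd hbc.symm hbd.symm hac.symm had.symm
    by_cases hcv : c = v
    · subst hcv
      rw [hv, hne a hav, hne b hbv, hne d hcd.ne', or_comm]
      exact key d a b hcd hab hav hbv had hbd
    by_cases hdv : d = v
    · subst hdv
      rw [hv, hne a hav, hne b hbv, hne c hcv, orient_swap x, orient_swap x, neg_mul_neg,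
        mul_comm (orient (p a) (p b) (p c)), or_comm]
      exact key c a b hcd.symm hab hav hbv hac hbc
    rw [hne a hav, hne b hbv, hne c hcv, hne d hdv]
    exact hp.separated a b c d (hGH a b hav hbv hab) (hGH c d hcv hdv hcd) hac had hbc hbd

/-- Isolated vertices can be added to a drawing. -/
lemma IsStraightDrawing.isStraightPlanar [Finite V] {G : SimpleGraph V} {T : Set V}
    {p : V → ℝ × ℝ} (hp : IsStraightDrawing G T p) (hT : G.support ⊆ T) :
    IsStraightPlanar G := by
  have h : ∀ S : Set V, ∃ p', IsStraightDrawing G (S ∪ T) p' := by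
    intro S
    induction S, S.toFinite using Set.Finite.induction_on with
    | empty => exact ⟨p, by simpa using hp⟩
    | @insert v S _ _ ih =>
      obtain ⟨p', hp'⟩ := ih
      rw [Set.insert_union]
      by_cases hv : v ∈ G.support
      · rw [Set.insert_eq_of_mem (.inr (hT hv))]
        exact ⟨p', hp'⟩
      · exact hp'.exists_insert v (fun _ _ _ _ h => h) 0
          fun w _ _ h => absurd h.mem_support_left hv
  obtain ⟨p', hp'⟩ := h Set.univ
  exact ⟨p', by simpa using hp'⟩

/-- A pendant edge can be added to a straight planar graph. -/
lemma IsStraightPlanar.of_forall_adj_eq [Finite V] {G H : SimpleGraph V}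
    (hH : IsStraightPlanar H) {v w : V} (hw : ∀ a, G.Adj v a → a = w)
    (hGH : ∀ a b, a ≠ v → b ≠ v → G.Adj a b → H.Adj a b) : IsStraightPlanar G := by
  obtain ⟨p, hp⟩ := hH
  obtain ⟨p', h⟩ := hp.exists_insert v hGH (p w) <| by
    intro a c d hva hcd _ _ hca hda
    obtain rfl := hw a hva
    exact .inr <| mul_self_pos.2 <|
      hp.orient_ne_zero _ trivial _ trivial _ trivial hcd.ne hca hda
  exact ⟨p', by simpa using h⟩

/-- A vertex adjacent to both ends of an edge can be added to a straight planar graph. -/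
lemma IsStraightPlanar.of_forall_adj_eq_or_eq [Finite V] {G H : SimpleGraph V}
    (hH : IsStraightPlanar H) {v a b : V} (hab : H.Adj a b)
    (hv : ∀ w, G.Adj v w → w = a ∨ w = b)
    (hGH : ∀ a b, a ≠ v → b ≠ v → G.Adj a b → H.Adj a b) : IsStraightPlanar G := by
  obtain ⟨p, hp⟩ := hH
  have key : ∀ a b c d, H.Adj a b → H.Adj c d → c ≠ a → d ≠ a →
      0 < orient (midpoint ℝ (p a) (p b)) (p a) (p c) *
          orient (midpoint ℝ (p a) (p b)) (p a) (p d) ∨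
        0 < orient (p c) (p d) (midpoint ℝ (p a) (p b)) * orient (p c) (p d) (p a) := by
    intro a b c d hab hcd hca hda
    have h1 : ∀ x, orient (midpoint ℝ (p a) (p b)) (p a) x = -(orient (p a) (p b) x / 2) := by
      intro x
      simp only [orient, midpoint, AffineMap.lineMap_apply_module, invOf_eq_inv, Prod.fst_add,
        Prod.snd_add, Prod.smul_fst, Prod.smul_snd, smul_eq_mul]
      ring
    have h2 : orient (p c) (p d) (midpoint ℝ (p a) (p b)) =
        (orient (p c) (p d) (p a) + orient (p c) (p d) (p b)) / 2 := by
      rw [midpoint, orient_lineMap, invOf_eq_inv]; ring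
    have h3 : orient (p c) (p d) (p a) ≠ 0 :=
      hp.orient_ne_zero _ trivial _ trivial _ trivial hcd.ne hca hda
    have h4 := mul_self_pos.2 h3
    rw [h1, h1, h2]
    by_cases hcb : c = b
    · subst hcb
      right
      rw [orient_self_left]
      linarith
    by_cases hdb : d = b
    · subst hdb
      right
      rw [orient_self_right]
      linarith
    rcases hp.separated a b c d hab hcd hca.symm hda.symm (Ne.symm hcb) (Ne.symm hdb) with h | h
    · left
      linarith
    · right
      linarith
  obtain ⟨p', h⟩ := hp.exists_insert v hGH (midpoint ℝ (p a) (p b)) <| by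
    intro w c d hvw hcd hcv hdv hcw hdw
    rcases hv w hvw with rfl | rfl
    · exact key _ _ c d hab (hGH c d hcv hdv hcd) hcw hdw
    · rw [midpoint_comm]
      exact key _ _ c d hab.symm (hGH c d hcv hdv hcd) hcw hdw
  exact ⟨p', by simpa using h⟩

/-- A straight-line drawing is a crossing-free drawing. -/
lemma IsStraightPlanar.isPlanar {G : SimpleGraph V} (hG : IsStraightPlanar G) : IsPlanar G := by
  obtain ⟨p, hp⟩ := hG
  have hinj : Function.Injective p := Set.injOn_univ.1 hp.injOn
  have hor : ∀ {i j k}, i ≠ j → i ≠ k → j ≠ k → orient (p i) (p j) (p k) ≠ 0 := fun h1 h2 h3 =>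
    hp.orient_ne_zero _ trivial _ trivial _ trivial h1 h2 h3
  let D : Drawing G :=
    { pos := p
      pos_inj := hinj
      arc := fun u v _ =>
        { toFun := fun t => AffineMap.lineMap (p u) (p v) (t : ℝ)
          continuous_toFun := by
            exact AffineMap.lineMap_continuous.comp continuous_subtype_val
          source' := by simp
          target' := by simp }
      arc_symm := by
        intro u v h
        refine Path.ext (funext fun t => ?_)
        exact (AffineMap.lineMap_apply_one_sub (p u) (p v) (t : ℝ)).symm
      arc_inj := by
        intro u v h s t hst
        exact Subtype.ext (AffineMap.lineMap_injective ℝ (hinj.ne h.ne) hst)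
      arc_avoid := by
        intro u v h w t ht
        replace ht : AffineMap.lineMap (p u) (p v) (t : ℝ) = p w := ht
        have h0 : orient (p u) (p v) (p w) = 0 := by rw [← ht, orient_lineMap_self]
        by_cases huw : u = w
        · left
          subst huw
          rw [AffineMap.lineMap_eq_left_iff] at ht
          exact Subtype.ext (ht.resolve_left (hinj.ne h.ne))
        by_cases hvw : v = w
        · right
          subst hvw
          rw [AffineMap.lineMap_eq_right_iff] at ht
          exact Subtype.ext (ht.resolve_left (hinj.ne h.ne))
        exact absurd h0 (hor h.ne huw hvw) }
  refine ⟨D, ?_⟩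
  have hshare : ∀ a b d : V, ∀ s t : ℝ, a ≠ b → a ≠ d → b ≠ d → t ≠ 0 →
      AffineMap.lineMap (p a) (p b) s ≠ AffineMap.lineMap (p a) (p d) t := by
    intro a b d s t hab had hbd ht h
    have h0 := orient_lineMap_self (p a) (p b) s
    rw [h, orient_lineMap, orient_self_left, mul_zero, zero_add] at h0
    exact mul_ne_zero ht (hor hab had hbd) h0
  have hside : ∀ a b c d : V, ∀ s t : ℝ, 0 < t → t < 1 →
      0 < orient (p a) (p b) (p c) * orient (p a) (p b) (p d) →
      AffineMap.lineMap (p a) (p b) s ≠ AffineMap.lineMap (p c) (p d) t := by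
    intro a b c d s t ht0 ht1 hpos h
    have h0 := orient_lineMap_self (p a) (p b) s
    rw [h, orient_lineMap] at h0
    have h1 : 0 < 1 - t := by linarith
    rcases pos_and_pos_or_neg_and_neg_of_mul_pos hpos with ⟨hc, hd⟩ | ⟨hc, hd⟩
    · exact (add_pos (mul_pos h1 hc) (mul_pos ht0 hd)).ne' h0
    · exact (add_neg (mul_neg_of_pos_of_neg h1 hc) (mul_neg_of_pos_of_neg ht0 hd)).ne h0
  have hcross : {q : Sym2 V × Sym2 V | D.Crosses q.1 q.2} = ∅ := by
    rw [Set.eq_empty_iff_forall_notMem]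
    rintro ⟨e, f⟩ ⟨-, -, hef, z, hze, hzf⟩
    simp only [Drawing.edgeInterior, Set.mem_iUnion] at hze hzf
    obtain ⟨a, b, hab, rfl, s, ⟨hs0, hs1⟩, hs⟩ := hze
    obtain ⟨c, d, hcd, rfl, t, ⟨ht0, ht1⟩, ht⟩ := hzf
    have h : AffineMap.lineMap (p a) (p b) (s : ℝ) = AffineMap.lineMap (p c) (p d) (t : ℝ) :=
      hs.trans ht.symm
    have hs0' : 0 < (s : ℝ) := unitInterval.pos_iff_ne_zero.2 hs0
    have hs1' : (s : ℝ) < 1 := unitInterval.lt_one_iff_ne_one.2 hs1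
    have ht0' : 0 < (t : ℝ) := unitInterval.pos_iff_ne_zero.2 ht0
    have ht1' : (t : ℝ) < 1 := unitInterval.lt_one_iff_ne_one.2 ht1
    have ht1'' : 1 - (t : ℝ) ≠ 0 := by linarith
    by_cases hac : a = c
    · subst hac
      have hbd : b ≠ d := fun h => hef (by rw [h])
      exact hshare a b d s t hab.ne hcd.ne hbd ht0'.ne' h
    by_cases had : a = d
    · subst had
      have hbc : b ≠ c := fun h => hef (by rw [h, Sym2.eq_swap])
      refine hshare a b c s (1 - t) hab.ne hcd.ne' hbc ht1'' ?_
      rw [h, AffineMap.lineMap_apply_one_sub]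
    by_cases hbc : b = c
    · subst hbc
      refine hshare b a d (1 - s) t hab.ne' hcd.ne had ht0'.ne' ?_
      rw [← h, AffineMap.lineMap_apply_one_sub]
    by_cases hbd : b = d
    · subst hbd
      refine hshare b a c (1 - s) (1 - t) hab.ne' hcd.ne' hac ht1'' ?_
      rw [AffineMap.lineMap_apply_one_sub, h, AffineMap.lineMap_apply_one_sub]
    rcases hp.separated a b c d hab hcd hac had hbc hbd with h1 | h1
    · exact hside a b c d s t ht0' ht1' h1 h
    · exact hside c d a b t s hs0' hs1' h1 h.symm
  rw [Drawing.crossCount, hcross, Set.ncard_empty]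

/-! ### Drawings of small graphs -/

/-- Twice the signed area of a triangle with integer coordinates. -/
def intOrient (a b c : ℤ × ℤ) : ℤ := (b.1 - a.1) * (c.2 - a.2) - (b.2 - a.2) * (c.1 - a.1)

lemma orient_intCast (a b c : ℤ × ℤ) :
    orient ((a.1 : ℝ), (a.2 : ℝ)) ((b.1 : ℝ), (b.2 : ℝ)) ((c.1 : ℝ), (c.2 : ℝ)) =
      (intOrient a b c : ℝ) := by
  simp [orient, intOrient]

/-- Integer points drawing the graph on `Fin k` with adjacency `r`. -/
def IsIntDrawing {k : ℕ} (r : Fin k → Fin k → Prop) (q : Fin k → ℤ × ℤ) : Prop :=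
  (∀ i j, q i = q j → i = j) ∧
  (∀ i j k, i ≠ j → i ≠ k → j ≠ k → intOrient (q i) (q j) (q k) ≠ 0) ∧
  ∀ a b c d, r a b → r c d → a ≠ b → c ≠ d → a ≠ c → a ≠ d → b ≠ c → b ≠ d →
    0 < intOrient (q a) (q b) (q c) * intOrient (q a) (q b) (q d) ∨
      0 < intOrient (q c) (q d) (q a) * intOrient (q c) (q d) (q b)

set_option synthInstance.maxHeartbeats 400000 in
set_option synthInstance.maxSize 1000 in
instance {k : ℕ} (r : Fin k → Fin k → Prop) [DecidableRel r] (q : Fin k → ℤ × ℤ) :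
    Decidable (IsIntDrawing r q) := by
  unfold IsIntDrawing; infer_instance

lemma IsIntDrawing.isStraightPlanar [Finite V] {G : SimpleGraph V} {k : ℕ}
    {r : Fin k → Fin k → Prop} {q : Fin k → ℤ × ℤ} (hq : IsIntDrawing r q) {g : V → Fin k}
    (hg : Set.InjOn g G.support) (hr : ∀ u v, G.Adj u v → r (g u) (g v)) :
    IsStraightPlanar G := by
  obtain ⟨hinj, hor, hsep⟩ := hq
  refine IsStraightDrawing.isStraightPlanar (T := G.support)
    (p := fun v => (((q (g v)).1 : ℝ), ((q (g v)).2 : ℝ))) ⟨?_, ?_, ?_⟩ subset_rfl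
  · intro u hu v hv huv
    simp only [Prod.mk.injEq, Int.cast_inj] at huv
    exact hg hu hv (hinj _ _ (Prod.ext huv.1 huv.2))
  · intro u hu v hv w hw huv huw hvw
    rw [orient_intCast, Int.cast_ne_zero]
    exact hor _ _ _ (hg.ne hu hv huv) (hg.ne hu hw huw) (hg.ne hv hw hvw)
  · intro a b c d hab hcd hac had hbc hbd
    simp only [orient_intCast]
    have ha := hab.mem_support_left
    have hb := hab.mem_support_right
    have hc := hcd.mem_support_left
    have hd := hcd.mem_support_right
    exact_mod_cast hsep _ _ _ _ (hr a b hab) (hr c d hcd) (hg.ne ha hb hab.ne)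
      (hg.ne hc hd hcd.ne) (hg.ne ha hc hac) (hg.ne ha hd had) (hg.ne hb hc hbc) (hg.ne hb hd hbd)

lemma IsIntDrawing.isStraightPlanar_of_range [Finite V] {G : SimpleGraph V} {k : ℕ}
    {L : Finset (Sym2 (Fin (k + 1)))} {q : Fin (k + 1) → ℤ × ℤ}
    (hq : IsIntDrawing (fun i j => s(i, j) ∉ L) q) {f : Fin (k + 1) → V}
    (hf : Function.Injective f) (hG : G.support ⊆ Set.range f)
    (hL : ∀ e ∈ L, e.map f ∉ G.edgeSet) : IsStraightPlanar G := by
  have hinv := Function.leftInverse_invFun hf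
  refine hq.isStraightPlanar (g := Function.invFun f) ?_ ?_
  · intro u hu v hv huv
    obtain ⟨i, rfl⟩ := hG hu
    obtain ⟨j, rfl⟩ := hG hv
    rw [hinv i, hinv j] at huv
    rw [huv]
  · intro u v huv h
    obtain ⟨i, rfl⟩ := hG huv.mem_support_left
    obtain ⟨j, rfl⟩ := hG huv.mem_support_right
    rw [hinv i, hinv j] at h
    exact hL _ h huv

lemma isStraightPlanar_of_ncard_support_le_four [Finite V] {G : SimpleGraph V}
    (h : G.support.ncard ≤ 4) : IsStraightPlanar G := by
  have hq : IsIntDrawing (k := 4) (fun _ _ => True) ![(0, 0), (10, 0), (6, 20), (5, 8)] := by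
    decide
  classical
  have := Fintype.ofFinite G.support
  obtain ⟨e⟩ : Nonempty (G.support ↪ Fin 4) := Function.Embedding.nonempty_of_card_le (by
    rwa [Fintype.card_fin, ← Nat.card_eq_fintype_card, Nat.card_coe_set_eq])
  refine hq.isStraightPlanar (g := fun v => if hv : v ∈ G.support then e ⟨v, hv⟩ else 0) ?_
    fun _ _ _ => trivial
  intro u hu v hv huv
  simp only [hu, hv, dif_pos] at huv
  exact congrArg Subtype.val (e.injective huv)

/-- The graph `K₅` minus an edge is planar. -/
lemma isStraightPlanar_of_five [Finite V] {G : SimpleGraph V} {f : Fin 5 → V}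
    (hf : Function.Injective f) (hG : G.support ⊆ Set.range f) (h : ¬ G.Adj (f 0) (f 1)) :
    IsStraightPlanar G := by
  have hq : IsIntDrawing (k := 5) (fun i j => s(i, j) ∉ ({s(0, 1)} : Finset _))
      ![(4, 2), (6, 20), (0, 0), (10, 0), (5, 8)] := by
    decide +kernel
  refine hq.isStraightPlanar_of_range hf hG ?_
  simpa using h

/-- The octahedron is planar. -/
lemma isStraightPlanar_of_octahedron [Finite V] {G : SimpleGraph V} {f : Fin 6 → V}
    (hf : Function.Injective f) (hG : G.support ⊆ Set.range f) {σ : Fin 6 → Fin 6}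
    (hσ : Function.Injective σ)
    (h₁ : ¬ G.Adj (f (σ 0)) (f (σ 1))) (h₂ : ¬ G.Adj (f (σ 2)) (f (σ 3)))
    (h₃ : ¬ G.Adj (f (σ 4)) (f (σ 5))) : IsStraightPlanar G := by
  have hq : IsIntDrawing (k := 6)
      (fun i j => s(i, j) ∉ ({s(0, 1), s(2, 3), s(4, 5)} : Finset _))
      ![(0, 0), (60, 40), (100, 0), (38, 41), (50, 100), (49, 17)] := by
    decide +kernel
  refine hq.isStraightPlanar_of_range (hf.comp hσ) ?_ ?_
  · rwa [(Finite.injective_iff_surjective.1 hσ).range_comp]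
  simp [h₁, h₂, h₃]

/-- The wheel with five spokes is planar. -/
lemma isStraightPlanar_of_wheel [Finite V] {G : SimpleGraph V} {f : Fin 6 → V}
    (hf : Function.Injective f) (hG : G.support ⊆ Set.range f) {σ : Fin 6 → Fin 6}
    (hσ : Function.Injective σ)
    (h₁ : ¬ G.Adj (f (σ 1)) (f (σ 2))) (h₂ : ¬ G.Adj (f (σ 2)) (f (σ 3)))
    (h₃ : ¬ G.Adj (f (σ 3)) (f (σ 4))) (h₄ : ¬ G.Adj (f (σ 4)) (f (σ 5)))
    (h₅ : ¬ G.Adj (f (σ 5)) (f (σ 1))) : IsStraightPlanar G := by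
  have hq : IsIntDrawing (k := 6)
      (fun i j => s(i, j) ∉ ({s(1, 2), s(2, 3), s(3, 4), s(4, 5), s(5, 1)} : Finset _))
      ![(1, 2), (100, 0), (-80, 60), (32, -94), (30, 95), (-81, -58)] := by
    decide +kernel
  refine hq.isStraightPlanar_of_range (hf.comp hσ) ?_ ?_
  · rwa [(Finite.injective_iff_surjective.1 hσ).range_comp]
  simp [h₁, h₂, h₃, h₄, h₅]

/-! ### Graphs of minimum degree at least three -/

lemma sum_eq_sum_of_support_subset_range [Fintype V] {G : SimpleGraph V} {k : ℕ} {f : Fin k → V}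
    (hf : Function.Injective f) (hG : G.support ⊆ Set.range f) (φ : V → ℕ)
    (hφ : ∀ v, v ∉ G.support → φ v = 0) : ∑ v, φ v = ∑ i, φ (f i) :=
  (Fintype.sum_of_injective f hf (fun i => φ (f i)) φ
    (fun v hv => hφ v fun h => hv (hG h)) fun _ => rfl).symm

lemma degree_eq_sum_toNat [Fintype V] {G : SimpleGraph V} [DecidableRel G.Adj] {k : ℕ}
    {f : Fin k → V} (hf : Function.Injective f) (hG : G.support ⊆ Set.range f) (v : V) :
    G.degree v = ∑ i, (decide (G.Adj v (f i))).toNat := by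
  rw [← sum_eq_sum_of_support_subset_range hf hG fun w => (decide (G.Adj v w)).toNat]
  · rw [← G.card_neighborFinset_eq_degree, G.neighborFinset_eq_filter, Finset.card_filter]
    refine Finset.sum_congr rfl fun w _ => ?_
    by_cases h : G.Adj v w <;> simp [h]
  · intro w hw
    have h : ¬ G.Adj v w := fun h => hw h.mem_support_right
    simp [h]

set_option synthInstance.maxHeartbeats 400000 in
set_option synthInstance.maxSize 1000 in
/-- The possible adjacencies in a graph with at most ten edges and minimum degree at least three
on the six vertices `v, x, y, z, u, w`, where `v` is adjacent exactly to `x, y, z`. -/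
lemma six_vertices_cases : ∀ xy xz yz xu xw yu yw zu zw uw : Bool,
    2 ≤ xy.toNat + xz.toNat + xu.toNat + xw.toNat →
    2 ≤ xy.toNat + yz.toNat + yu.toNat + yw.toNat →
    2 ≤ xz.toNat + yz.toNat + zu.toNat + zw.toNat →
    3 ≤ xu.toNat + yu.toNat + zu.toNat + uw.toNat →
    3 ≤ xw.toNat + yw.toNat + zw.toNat + uw.toNat →
    xy.toNat + xz.toNat + yz.toNat + xu.toNat + xw.toNat + yu.toNat + yw.toNat + zu.toNat +
      zw.toNat + uw.toNat ≤ 7 →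
    (xy = false ∧ zw = false) ∨ (xz = false ∧ yw = false) ∨ (yz = false ∧ xw = false) ∨
    (xy = false ∧ zu = false) ∨ (xz = false ∧ yu = false) ∨ (yz = false ∧ xu = false) ∨
    (yu = false ∧ yz = false ∧ zw = false) ∨ (zu = false ∧ yz = false ∧ yw = false) ∨
    (xu = false ∧ xz = false ∧ zw = false) ∨ (zu = false ∧ xz = false ∧ xw = false) ∨
    (xu = false ∧ xy = false ∧ yw = false) ∨ (yu = false ∧ xy = false ∧ xw = false) ∨
    (xu = true ∧ yu = true ∧ zu = true ∧ xw = true ∧ yw = true ∧ zw = true) := by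
  decide +kernel
lemma injective_of_finset_subset_range [DecidableEq V] {k : ℕ} {S : Finset V} {f : Fin k → V}
    (hS : k ≤ S.card) (hf : ∀ v ∈ S, ∃ i, f i = v) : Function.Injective f := by
  have hsub : S ⊆ Finset.univ.image f := fun v hv => by simpa using hf v hv
  have hcard : (Finset.univ.image f).card = (Finset.univ : Finset (Fin k)).card :=
    le_antisymm Finset.card_image_le (by
      rw [Finset.card_univ, Fintype.card_fin]
      exact hS.trans (Finset.card_le_card hsub))
  rw [← Set.injOn_univ, ← Finset.coe_univ]
  exact Finset.injOn_of_card_image_eq hcard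

lemma sum_degree_eq_two_mul_ncard [Fintype V] (G : SimpleGraph V) [DecidableRel G.Adj] :
    ∑ v, G.degree v = 2 * G.edgeSet.ncard := by
  classical
  rw [G.sum_degrees_eq_twice_card_edges, Set.ncard_eq_toFinset_card']
  rfl

lemma isContained_or_isStraightPlanar_of_five [Fintype V] [DecidableEq V] {G : SimpleGraph V}
    {S : Finset V} (hS : S.card = 5) (hG : G.support = S) :
    IsStraightPlanar G ∨ completeGraph (Fin 5) ⊑ G := by
  by_cases h : ∀ a ∈ S, ∀ b ∈ S, a ≠ b → G.Adj a b
  · right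
    let e := (Finset.equivFinOfCardEq hS).symm
    exact ⟨⟨⟨fun i => (e i : V), fun {i j} hij => h _ (e i).2 _ (e j).2
      fun h => hij (e.injective (Subtype.ext h))⟩,
      Subtype.val_injective.comp e.injective⟩⟩
  · left
    push Not at h
    obtain ⟨a, ha, b, hb, hab, hadj⟩ := h
    have hcard : ((S.erase a).erase b).card = 3 := by
      rw [Finset.card_erase_of_mem (Finset.mem_erase.2 ⟨hab.symm, hb⟩),
        Finset.card_erase_of_mem ha, hS]
    obtain ⟨x, y, z, -, -, -, hxyz⟩ := Finset.card_eq_three.1 hcard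
    have hf : ∀ v ∈ S, ∃ i, ![a, b, x, y, z] i = v := by
      intro v hv
      by_cases hva : v = a
      · exact ⟨0, hva.symm⟩
      by_cases hvb : v = b
      · exact ⟨1, hvb.symm⟩
      have hv' : v ∈ (S.erase a).erase b := by simp [hva, hvb, hv]
      rw [hxyz] at hv'
      simp only [Finset.mem_insert, Finset.mem_singleton] at hv'
      rcases hv' with rfl | rfl | rfl
      exacts [⟨2, rfl⟩, ⟨3, rfl⟩, ⟨4, rfl⟩]
    refine isStraightPlanar_of_five (injective_of_finset_subset_range hS.ge hf) ?_ hadj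
    rw [hG]
    exact hf

lemma isContained_or_isStraightPlanar_of_six [Fintype V] [DecidableEq V] {G : SimpleGraph V}
    [DecidableRel G.Adj] (hm : G.edgeSet.ncard ≤ 10) {S : Finset V} (hS : S.card = 6)
    (hG : G.support = S) (hdeg : ∀ v ∈ S, 3 ≤ G.degree v) :
    IsStraightPlanar G ∨ completeBipartiteGraph (Fin 3) (Fin 3) ⊑ G := by
  have hsum := sum_degree_eq_two_mul_ncard G
  obtain ⟨v, hvS, hv⟩ : ∃ v ∈ S, G.degree v = 3 := by
    by_contra! h
    have h1 : S.card * 4 ≤ ∑ v ∈ S, G.degree v := by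
      rw [← smul_eq_mul]
      exact Finset.card_nsmul_le_sum _ _ _ fun v hv =>
        Nat.lt_of_le_of_ne (hdeg v hv) (h v hv).symm
    have h2 : ∑ v ∈ S, G.degree v ≤ ∑ v, G.degree v :=
      Finset.sum_le_sum_of_subset (Finset.subset_univ S)
    omega
  have hNS : G.neighborFinset v ⊆ S.erase v := by
    intro w hw
    rw [mem_neighborFinset] at hw
    have : w ∈ G.support := hw.mem_support_right
    rw [hG] at this
    exact Finset.mem_erase.2 ⟨hw.ne', this⟩
  have hN := hv
  rw [← G.card_neighborFinset_eq_degree] at hN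
  have hR : (S.erase v \ G.neighborFinset v).card = 2 := by
    rw [Finset.card_sdiff_of_subset hNS, Finset.card_erase_of_mem hvS, hS, hN]
  obtain ⟨x, y, z, hxy, hxz, hyz, hxyz⟩ := Finset.card_eq_three.1 hN
  obtain ⟨u, w, huw, huw'⟩ := Finset.card_eq_two.1 hR
  have hvadj : ∀ a, G.Adj v a ↔ a = x ∨ a = y ∨ a = z := by
    intro a
    rw [← mem_neighborFinset, hxyz]
    simp
  have hvx : G.Adj v x := by simp [hvadj]
  have hvy : G.Adj v y := by simp [hvadj]
  have hvz : G.Adj v z := by simp [hvadj]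
  have hu : u ∈ S.erase v \ G.neighborFinset v := by simp [huw']
  have hw : w ∈ S.erase v \ G.neighborFinset v := by simp [huw']
  have hvu : ¬ G.Adj v u := by simpa using (Finset.mem_sdiff.1 hu).2
  have hvw : ¬ G.Adj v w := by simpa using (Finset.mem_sdiff.1 hw).2
  have hf : ∀ a ∈ S, ∃ i, ![v, x, y, z, u, w] i = a := by
    intro a ha
    by_cases hav : a = v
    · exact ⟨0, hav.symm⟩
    by_cases haN : G.Adj v a
    · rcases (hvadj a).1 haN with rfl | rfl | rfl
      exacts [⟨1, rfl⟩, ⟨2, rfl⟩, ⟨3, rfl⟩]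
    · have ha' : a ∈ S.erase v \ G.neighborFinset v := by simp [hav, ha, haN]
      rw [huw'] at ha'
      simp only [Finset.mem_insert, Finset.mem_singleton] at ha'
      rcases ha' with rfl | rfl
      exacts [⟨4, rfl⟩, ⟨5, rfl⟩]
  have hinj := injective_of_finset_subset_range hS.ge hf
  have hrange : G.support ⊆ Set.range ![v, x, y, z, u, w] := by
    rw [hG]
    exact hf
  have hmem : ∀ i, ![v, x, y, z, u, w] i ∈ S := by
    have himg : S = Finset.univ.image ![v, x, y, z, u, w] := by
      refine Finset.eq_of_subset_of_card_le (fun a ha => by simpa using hf a ha) ?_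
      rw [Finset.card_image_of_injective _ hinj, hS, Finset.card_univ, Fintype.card_fin]
    intro i
    rw [himg]
    exact Finset.mem_image_of_mem _ (Finset.mem_univ i)
  obtain ⟨adj, hadj⟩ : ∃ adj : V → V → Bool, ∀ a b, adj a b = decide (G.Adj a b) :=
    ⟨_, fun _ _ => rfl⟩
  have hd : ∀ i, 3 ≤ ∑ j, (adj (![v, x, y, z, u, w] i) (![v, x, y, z, u, w] j)).toNat :=
    fun i => by
      simp_rw [hadj]
      rw [← degree_eq_sum_toNat hinj hrange]
      exact hdeg _ (hmem i)
  have htot : ∑ i, ∑ j, (adj (![v, x, y, z, u, w] i) (![v, x, y, z, u, w] j)).toNat ≤ 20 := by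
    simp_rw [hadj, ← degree_eq_sum_toNat hinj hrange]
    rw [← sum_eq_sum_of_support_subset_range hinj hrange fun a => G.degree a, hsum]
    · omega
    · intro a ha
      rw [degree_eq_zero_iff_notMem_support]
      exact ha
  have hsymm : ∀ a b, adj a b = adj b a := fun a b => by simp only [hadj, G.adj_comm]
  have hself : ∀ a, adj a a = false := fun a => by simp [hadj]
  have hx : adj v x = true := by simp [hadj, hvx]
  have hy : adj v y = true := by simp [hadj, hvy]
  have hz : adj v z = true := by simp [hadj, hvz]
  have hu' : adj v u = false := by simp [hadj, hvu]
  have hw' : adj v w = false := by simp [hadj, hvw]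
  have d1 := hd 1
  have d2 := hd 2
  have d3 := hd 3
  have d4 := hd 4
  have d5 := hd 5
  simp only [Fin.sum_univ_six, Matrix.cons_val, hsymm y x, hsymm z x, hsymm z y, hsymm u x,
    hsymm u y, hsymm u z, hsymm w x, hsymm w y, hsymm w z, hsymm w u, hsymm _ v, hself, hx, hy,
    hz, hu', hw', Bool.toNat_true, Bool.toNat_false] at d1 d2 d3 d4 d5 htot
  have hcases := six_vertices_cases (adj x y) (adj x z) (adj y z) (adj x u) (adj x w) (adj y u)
    (adj y w) (adj z u) (adj z w) (adj u w)
    (by omega) (by omega) (by omega) (by omega) (by omega) (by omega)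
  simp only [hadj, decide_eq_false_iff_not, decide_eq_true_eq] at hcases
  have hoct := fun σ hσ => isStraightPlanar_of_octahedron hinj hrange (σ := σ) hσ
  have hwheel := fun σ hσ => isStraightPlanar_of_wheel hinj hrange (σ := σ) hσ
  have hwv := mt Adj.symm hvw
  rcases hcases with h | h | h | h | h | h | h | h | h | h | h | h | h
  · exact .inl (hoct ![0, 4, 1, 2, 3, 5] (by decide) hvu h.1 h.2)
  · exact .inl (hoct ![0, 4, 1, 3, 2, 5] (by decide) hvu h.1 h.2)
  · exact .inl (hoct ![0, 4, 2, 3, 1, 5] (by decide) hvu h.1 h.2)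
  · exact .inl (hoct ![0, 5, 1, 2, 3, 4] (by decide) hvw h.1 h.2)
  · exact .inl (hoct ![0, 5, 1, 3, 2, 4] (by decide) hvw h.1 h.2)
  · exact .inl (hoct ![0, 5, 2, 3, 1, 4] (by decide) hvw h.1 h.2)
  · exact .inl (hwheel ![1, 0, 4, 2, 3, 5] (by decide) hvu (mt Adj.symm h.1) h.2.1 h.2.2
      hwv)
  · exact .inl (hwheel ![1, 0, 4, 3, 2, 5] (by decide) hvu (mt Adj.symm h.1) (mt Adj.symm h.2.1)
      h.2.2 hwv)
  · exact .inl (hwheel ![2, 0, 4, 1, 3, 5] (by decide) hvu (mt Adj.symm h.1) h.2.1 h.2.2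
      hwv)
  · exact .inl (hwheel ![2, 0, 4, 3, 1, 5] (by decide) hvu (mt Adj.symm h.1) (mt Adj.symm h.2.1)
      h.2.2 hwv)
  · exact .inl (hwheel ![3, 0, 4, 1, 2, 5] (by decide) hvu (mt Adj.symm h.1) h.2.1 h.2.2
      hwv)
  · exact .inl (hwheel ![3, 0, 4, 2, 1, 5] (by decide) hvu (mt Adj.symm h.1) (mt Adj.symm h.2.1)
      h.2.2 hwv)
  · right
    obtain ⟨hxu, hyu, hzu, hxw, hyw, hzw⟩ := h
    have hcross : ∀ i j, G.Adj (![v, x, y, z, u, w] (![0, 4, 5] i))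
        (![v, x, y, z, u, w] (![1, 2, 3] j)) := by
      intro i j
      fin_cases i <;> fin_cases j
      exacts [hvx, hvy, hvz, hxu.symm, hyu.symm, hzu.symm, hxw.symm, hyw.symm, hzw.symm]
    refine ⟨⟨⟨![v, x, y, z, u, w] ∘ Sum.elim ![0, 4, 5] ![1, 2, 3], ?_⟩, hinj.comp (by decide)⟩⟩
    rintro (i | i) (j | j) hij
    · simp at hij
    · exact hcross i j
    · exact (hcross j i).symm
    · simp at hij

/-! ### Reduction of vertices of small degree -/

lemma ncard_edgeSet_le_of_isContained {W : Type*} [Finite V] {A : SimpleGraph W}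
    {G : SimpleGraph V} (h : A ⊑ G) : A.edgeSet.ncard ≤ G.edgeSet.ncard := by
  obtain ⟨f⟩ := h
  rw [← Nat.card_coe_set_eq, ← Nat.card_coe_set_eq]
  exact Nat.card_le_card_of_injective _ f.mapEdgeSet.injective

lemma ncard_edgeSet_completeBipartiteGraph_three :
    (completeBipartiteGraph (Fin 3) (Fin 3)).edgeSet.ncard = 9 := by
  simp [Set.ncard, encard_edgeSet_completeBipartiteGraph]

lemma ncard_edgeSet_completeGraph_five : (completeGraph (Fin 5)).edgeSet.ncard = 10 := by
  rw [Set.ncard_eq_toFinset_card']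
  decide +kernel

lemma edgeSet_K33Subdivided : K33Subdivided.edgeSet =
    {s(0, 4), s(0, 5), s(1, 3), s(1, 4), s(1, 5), s(2, 3), s(2, 4), s(2, 5), s(0, 6), s(6, 3)} := by
  rw [K33Subdivided, edgeSet_fromEdgeSet, sdiff_eq_left, Set.disjoint_left]
  simp

lemma ncard_edgeSet_K33Subdivided : K33Subdivided.edgeSet.ncard = 10 := by
  rw [edgeSet_K33Subdivided, Set.ncard_eq_toFinset_card']
  decide +kernel

/-- If `K₃,₃` is contained in the graph obtained by replacing a path `a v b` by an edge `ab`,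
then `K₃,₃` or its subdivision is contained in the original graph. -/
lemma isContained_of_isContained_suppress {G H : SimpleGraph V} {v a b : V}
    (hK : completeBipartiteGraph (Fin 3) (Fin 3) ⊑ H) (hv : ∀ w, ¬ H.Adj w v)
    (hva : G.Adj v a) (hvb : G.Adj v b)
    (hH : ∀ x y, H.Adj x y → s(x, y) = s(a, b) ∨ G.Adj x y) :
    completeBipartiteGraph (Fin 3) (Fin 3) ⊑ G ∨ K33Subdivided ⊑ G := by
  obtain ⟨f⟩ := hK
  have hf : Function.Injective f := f.injective
  have hadj : ∀ i j, H.Adj (f (.inl i)) (f (.inr j)) := fun i j => f.toHom.map_adj (by simp)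
  by_cases h : ∃ i j, s(f (.inl i), f (.inr j)) = s(a, b)
  · right
    obtain ⟨i, j, hij⟩ := h
    let l : Fin 3 → V := fun k => f (.inl (Equiv.swap 0 i k))
    let r : Fin 3 → V := fun k => f (.inr (Equiv.swap 0 j k))
    have hl : ∀ k k', l k = l k' ↔ k = k' := fun k k' => by simp [l, hf.eq_iff]
    have hr : ∀ k k', r k = r k' ↔ k = k' := fun k k' => by simp [r, hf.eq_iff]
    have hlr : ∀ k k', l k ≠ r k' := fun k k' => by simp [l, r, hf.eq_iff]
    have hlv : ∀ k, l k ≠ v := fun k h =>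
      hv _ (h ▸ (hadj (Equiv.swap 0 i k) 0).symm : H.Adj (f (.inr 0)) v)
    have hrv : ∀ k, r k ≠ v := fun k h =>
      hv _ (h ▸ hadj 0 (Equiv.swap 0 j k) : H.Adj (f (.inl 0)) v)
    have h00 : s(l 0, r 0) = s(a, b) := by simpa [l, r] using hij
    have hG : ∀ k k', (k ≠ 0 ∨ k' ≠ 0) → G.Adj (l k) (r k') := by
      intro k k' hk
      refine (hH _ _ (hadj _ _)).resolve_left fun h => ?_
      have h' := h.trans h00.symm
      rw [Sym2.eq_iff] at h'
      rcases h' with ⟨h1, h2⟩ | ⟨h1, -⟩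
      · exact hk.elim (fun h => h ((hl _ _).1 h1)) (fun h => h ((hr _ _).1 h2))
      · exact hlr _ _ h1
    have hv0 : G.Adj (l 0) v ∧ G.Adj v (r 0) := by
      rcases Sym2.eq_iff.1 h00 with ⟨h1, h2⟩ | ⟨h1, h2⟩
      · rw [h1, h2]
        exact ⟨hva.symm, hvb⟩
      · rw [h1, h2]
        exact ⟨hvb.symm, hva⟩
    let φ : Fin 7 → V := ![l 0, l 1, l 2, r 0, r 1, r 2, v]
    have hφ : Function.Injective φ := by
      intro m n hmn
      fin_cases m <;> fin_cases n <;>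
        simp_all [φ, (hlr _ _).symm, (hlv _).symm, (hrv _).symm]
    have hmap : ∀ e ∈ K33Subdivided.edgeSet, e.map φ ∈ G.edgeSet := by
      intro e he
      rw [edgeSet_K33Subdivided] at he
      simp only [Set.mem_insert_iff, Set.mem_singleton_iff] at he
      rcases he with rfl | rfl | rfl | rfl | rfl | rfl | rfl | rfl | rfl | rfl
      exacts [hG 0 1 (by simp), hG 0 2 (by simp), hG 1 0 (by simp), hG 1 1 (by simp),
        hG 1 2 (by simp), hG 2 0 (by simp), hG 2 1 (by simp), hG 2 2 (by simp), hv0.1, hv0.2]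
    exact ⟨⟨⟨φ, fun {m n} h => hmap s(m, n) h⟩, hφ⟩⟩
  · left
    push Not at h
    have hG : ∀ i j, G.Adj (f (.inl i)) (f (.inr j)) := fun i j =>
      (hH _ _ (hadj i j)).resolve_left (h i j)
    refine ⟨⟨⟨f, ?_⟩, hf⟩⟩
    rintro (i | i) (j | j) hij
    · simp at hij
    · exact hG i j
    · exact (hG j i).symm
    · simp at hij

/-- A graph with at most ten edges is straight planar or contains a subdivision of `K₅` or
`K₃,₃`. -/
lemma isStraightPlanar_or_isContained [Fintype V] (G : SimpleGraph V)
    (hm : G.edgeSet.ncard ≤ 10) :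
    IsStraightPlanar G ∨ completeBipartiteGraph (Fin 3) (Fin 3) ⊑ G ∨
      completeGraph (Fin 5) ⊑ G ∨ K33Subdivided ⊑ G := by
  classical
  induction hn : G.edgeSet.ncard using Nat.strong_induction_on generalizing G with
  | _ n ih =>
  subst hn
  by_cases hsmall : ∃ v, G.degree v = 1 ∨ G.degree v = 2
  · obtain ⟨v, hv | hv⟩ := hsmall
    · rw [← G.card_neighborFinset_eq_degree] at hv
      obtain ⟨w, hw⟩ := Finset.card_eq_one.1 hv
      have hvadj : ∀ a, G.Adj v a ↔ a = w := fun a => by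
        rw [← mem_neighborFinset, hw, Finset.mem_singleton]
      have hle : G.deleteEdges {s(v, w)} ≤ G := G.deleteEdges_le _
      have hlt : (G.deleteEdges {s(v, w)}).edgeSet.ncard < G.edgeSet.ncard := by
        rw [edgeSet_deleteEdges]
        exact Set.ncard_sdiff_singleton_lt_of_mem ((hvadj w).2 rfl)
      rcases ih _ hlt _ (hlt.le.trans hm) rfl with h | h | h | h
      · left
        refine h.of_forall_adj_eq (fun a => (hvadj a).1) fun a b ha hb hab => ?_
        rw [deleteEdges_adj, Set.mem_singleton_iff, Sym2.eq_iff]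
        exact ⟨hab, by tauto⟩
      · exact .inr (.inl (h.mono_right hle))
      · exact .inr (.inr (.inl (h.mono_right hle)))
      · exact .inr (.inr (.inr (h.mono_right hle)))
    · rw [← G.card_neighborFinset_eq_degree] at hv
      obtain ⟨a, b, hab, hN⟩ := Finset.card_eq_two.1 hv
      have hvadj : ∀ w, G.Adj v w ↔ w = a ∨ w = b := fun w => by
        rw [← mem_neighborFinset, hN, Finset.mem_insert, Finset.mem_singleton]
      have hva : G.Adj v a := (hvadj a).2 (.inl rfl)
      have hvb : G.Adj v b := (hvadj b).2 (.inr rfl)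
      set H := G.deleteIncidenceSet v ⊔ edge a b with hHdef
      have hH : ∀ x y, H.Adj x y ↔ (G.Adj x y ∧ x ≠ v ∧ y ≠ v) ∨ s(x, y) = s(a, b) := by
        intro x y
        rw [hHdef, sup_adj, deleteIncidenceSet_adj, edge_adj, Sym2.eq_iff]
        constructor
        · tauto
        · rintro (h | ⟨rfl, rfl⟩ | ⟨rfl, rfl⟩)
          · exact .inl h
          · exact .inr ⟨.inl ⟨rfl, rfl⟩, hab⟩
          · exact .inr ⟨.inr ⟨rfl, rfl⟩, hab.symm⟩
      have hlt : H.edgeSet.ncard < G.edgeSet.ncard := by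
        have hsub : H.edgeSet ⊆ insert s(a, b) ((G.edgeSet \ {s(v, a)}) \ {s(v, b)}) := by
          intro e
          induction e with
          | _ x y =>
          rw [mem_edgeSet, hH]
          simp only [Set.mem_insert_iff, Set.mem_sdiff, mem_edgeSet, Set.mem_singleton_iff,
            Sym2.eq_iff]
          tauto
        have h1 := (Set.ncard_le_ncard hsub).trans (Set.ncard_insert_le _ _)
        have h2 : ((G.edgeSet \ {s(v, a)}) \ {s(v, b)}).ncard < (G.edgeSet \ {s(v, a)}).ncard :=
          Set.ncard_sdiff_singleton_lt_of_mem ⟨hvb, by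
            simp only [Set.mem_singleton_iff, Sym2.eq_iff]
            rintro (⟨-, h⟩ | ⟨h, -⟩)
            · exact hab h.symm
            · exact hva.ne h⟩
        have h3 : (G.edgeSet \ {s(v, a)}).ncard < G.edgeSet.ncard :=
          Set.ncard_sdiff_singleton_lt_of_mem hva
        omega
      rcases ih _ hlt _ (hlt.le.trans hm) rfl with h | h | h | h
      · left
        exact h.of_forall_adj_eq_or_eq ((hH a b).2 (.inr rfl)) (fun w => (hvadj w).1)
          fun x y hx hy hxy => (hH x y).2 (.inl ⟨hxy, hx, hy⟩)
      · have := isContained_of_isContained_suppress h (v := v) (fun w hw => ?_) hva hvb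
          fun x y hxy => ((hH x y).1 hxy).symm.imp_right And.left
        · tauto
        · rcases (hH w v).1 hw with h | h
          · exact h.2.2 rfl
          · rcases Sym2.eq_iff.1 h with ⟨-, h⟩ | ⟨-, h⟩
            · exact hvb.ne h
            · exact hva.ne h
      · have := ncard_edgeSet_le_of_isContained h
        rw [ncard_edgeSet_completeGraph_five] at this
        omega
      · have := ncard_edgeSet_le_of_isContained h
        rw [ncard_edgeSet_K33Subdivided] at this
        omega
  · push Not at hsmall
    have hdeg : ∀ v ∈ G.support.toFinset, 3 ≤ G.degree v := by
      intro v hv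
      have h0 : G.degree v ≠ 0 := by
        rw [Ne, degree_eq_zero_iff_notMem_support, not_not]
        simpa using hv
      have := hsmall v
      omega
    have h1 : G.support.toFinset.card * 3 ≤ ∑ v ∈ G.support.toFinset, G.degree v := by
      rw [← smul_eq_mul]
      exact Finset.card_nsmul_le_sum _ _ _ hdeg
    have h2 : ∑ v ∈ G.support.toFinset, G.degree v ≤ ∑ v, G.degree v :=
      Finset.sum_le_sum_of_subset (Finset.subset_univ _)
    rw [sum_degree_eq_two_mul_ncard] at h2
    have hS : G.support = G.support.toFinset := by simp
    have hcard : G.support.toFinset.card ≤ 4 ∨ G.support.toFinset.card = 5 ∨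
        G.support.toFinset.card = 6 := by omega
    rcases hcard with h | h | h
    · left
      exact isStraightPlanar_of_ncard_support_le_four (by rwa [Set.ncard_eq_toFinset_card'])
    · have := isContained_or_isStraightPlanar_of_five h hS
      tauto
    · have := isContained_or_isStraightPlanar_of_six hm h hS hdeg
      tauto

/-! ### Recognising graphs by their number of edges -/

lemma nonempty_iso_of_isContained {W : Type*} [Finite V] {K : SimpleGraph W} {G : SimpleGraph V}
    (h : K ⊑ G) (hcard : G.edgeSet.ncard ≤ K.edgeSet.ncard) (hK : ∀ w, ∃ w', K.Adj w w') :
    Nonempty (G.induce G.support ≃g K) := by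
  obtain ⟨f⟩ := h
  have hf : Function.Injective f := f.injective
  have hsub : Sym2.map f '' K.edgeSet ⊆ G.edgeSet := by
    rintro _ ⟨e, he, rfl⟩
    exact f.toHom.map_mem_edgeSet he
  have heq : Sym2.map f '' K.edgeSet = G.edgeSet :=
    Set.eq_of_subset_of_ncard_le hsub
      (by rwa [Set.ncard_image_of_injective _ (Sym2.map.injective hf)])
  have hadj : ∀ a b, G.Adj (f a) (f b) ↔ K.Adj a b := by
    intro a b
    rw [← mem_edgeSet, ← heq, ← Sym2.map_mk, (Sym2.map.injective hf).mem_set_image, mem_edgeSet]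
  have hsupp : ∀ w, f w ∈ G.support := fun w =>
    (hK w).elim fun w' h => ((hadj w w').2 h).mem_support_left
  let φ : W → G.support := fun w => ⟨f w, hsupp w⟩
  have hφ : Function.Bijective φ := by
    refine ⟨fun a b h => hf (congrArg Subtype.val h), ?_⟩
    rintro ⟨v, hv⟩
    obtain ⟨u, huv⟩ := G.mem_support.1 hv
    rw [← mem_edgeSet, ← heq] at huv
    obtain ⟨e, -, he⟩ := huv
    have hve : v ∈ Sym2.map f e := by
      rw [he]
      exact Sym2.mem_mk_left v u
    obtain ⟨w, -, rfl⟩ := Sym2.mem_map.1 hve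
    exact ⟨w, rfl⟩
  exact ⟨Iso.symm ⟨Equiv.ofBijective φ hφ, fun {a b} => hadj a b⟩⟩

lemma exists_adj_completeBipartiteGraph_three (w : Fin 3 ⊕ Fin 3) :
    ∃ w', (completeBipartiteGraph (Fin 3) (Fin 3)).Adj w w' := by
  rcases w with i | i
  · exact ⟨.inr 0, by simp⟩
  · exact ⟨.inl 0, by simp⟩

lemma exists_adj_K33Subdivided (w : Fin 7) : ∃ w', K33Subdivided.Adj w w' := by
  refine ⟨![4, 3, 3, 1, 0, 0, 0] w, ?_⟩
  rw [← mem_edgeSet, edgeSet_K33Subdivided]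
  fin_cases w <;> simp

lemma exists_nonempty_iso_of_isContained {W : Type*} [Finite V] {K : SimpleGraph W}
    {G : SimpleGraph V} (h : K ⊑ G) (hcard : G.edgeSet.ncard = K.edgeSet.ncard + 1)
    (hK : ∀ w, ∃ w', K.Adj w w') :
    ∃ e ∈ G.edgeSet,
      Nonempty ((G.deleteEdges {e}).induce (G.deleteEdges {e}).support ≃g K) := by
  obtain ⟨f⟩ := h
  obtain ⟨e, heG, he⟩ : ∃ e ∈ G.edgeSet, e ∉ Sym2.map f '' K.edgeSet := by
    refine Set.exists_mem_notMem_of_ncard_lt_ncard ?_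
    have hf : Function.Injective f := f.injective
    rw [Set.ncard_image_of_injective _ (Sym2.map.injective hf), hcard]
    exact Nat.lt_succ_self _
  refine ⟨e, heG, nonempty_iso_of_isContained ⟨⟨⟨f, fun {a b} hab => ?_⟩, f.injective⟩⟩ ?_ hK⟩
  · rw [deleteEdges_adj, Set.mem_singleton_iff]
    exact ⟨f.toHom.map_adj hab, fun h => he ⟨s(a, b), hab, h⟩⟩
  · rw [edgeSet_deleteEdges, Set.ncard_sdiff_singleton_of_mem heG, hcard, Nat.add_sub_cancel]

end

/-- Every graph with at most 8 edges is planar; the only nonplanar graph with 9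
edges is `K_{3,3}`; and the only nonplanar graphs with 10 edges are `K_5`,
`K_{3,3}` with one extra edge added, and `K_{3,3}` with one edge subdivided
(all up to isolated vertices, i.e. on the support of the graph). -/
theorem nonplanar_graphs_with_few_edges :
    (∀ (V : Type) [Fintype V] (G : SimpleGraph V), G.edgeSet.ncard ≤ 8 → IsPlanar G) ∧
    (∀ (V : Type) [Fintype V] (G : SimpleGraph V), G.edgeSet.ncard = 9 → ¬ IsPlanar G →
      Nonempty ((G.induce G.support) ≃g completeBipartiteGraph (Fin 3) (Fin 3))) ∧
    (∀ (V : Type) [Fintype V] (G : SimpleGraph V), G.edgeSet.ncard = 10 → ¬ IsPlanar G →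
      Nonempty ((G.induce G.support) ≃g completeGraph (Fin 5)) ∨
      (∃ e ∈ G.edgeSet, Nonempty
        (((G.deleteEdges {e}).induce (G.deleteEdges {e}).support)
          ≃g completeBipartiteGraph (Fin 3) (Fin 3))) ∨
      Nonempty ((G.induce G.support) ≃g K33Subdivided)) := by
  refine ⟨fun V _ G hm => ?_, fun V _ G hm hG => ?_, fun V _ G hm hG => ?_⟩
  · rcases isStraightPlanar_or_isContained G (hm.trans (by norm_num)) with h | h | h | h
    · exact h.isPlanar
    · have := ncard_edgeSet_le_of_isContained h
      rw [ncard_edgeSet_completeBipartiteGraph_three] at this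
      omega
    · have := ncard_edgeSet_le_of_isContained h
      rw [ncard_edgeSet_completeGraph_five] at this
      omega
    · have := ncard_edgeSet_le_of_isContained h
      rw [ncard_edgeSet_K33Subdivided] at this
      omega
  · rcases isStraightPlanar_or_isContained G (hm.trans_le (by norm_num)) with h | h | h | h
    · exact absurd h.isPlanar hG
    · exact nonempty_iso_of_isContained h
        (by rw [hm, ncard_edgeSet_completeBipartiteGraph_three])
        exists_adj_completeBipartiteGraph_three
    · have := ncard_edgeSet_le_of_isContained h
      rw [ncard_edgeSet_completeGraph_five] at this
      omega
    · have := ncard_edgeSet_le_of_isContained h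
      rw [ncard_edgeSet_K33Subdivided] at this
      omega
  · rcases isStraightPlanar_or_isContained G hm.le with h | h | h | h
    · exact absurd h.isPlanar hG
    · right
      left
      exact exists_nonempty_iso_of_isContained h
        (by rw [hm, ncard_edgeSet_completeBipartiteGraph_three])
        exists_adj_completeBipartiteGraph_three
    · left
      exact nonempty_iso_of_isContained h (by rw [hm, ncard_edgeSet_completeGraph_five])
        fun w => exists_ne w |>.imp fun _ h => h.symm
    · right
      right
      exact nonempty_iso_of_isContained h (by rw [hm, ncard_edgeSet_K33Subdivided])
        exists_adj_K33Subdivided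
end
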